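/- Let G be an affine reductive algebraic group over an algebraically closed field k of characteristic zero, let X be an affine G-variety, and suppose the map η: X → S(G), x ↦ H_x = ∩_{λ∈Λ_x} P(λ) is proper, i.e. for every x ∈ X and every one-parameter subgroup λ of G, H_x ⊆ P(λ) implies λ ∈ Λ_x. Then a point x ∈ X is polystable if and only if the closed subgroup H_x is completely reducible in G. -/

import Mathlib

open scoped MatrixGroups

namespace PaperGIT

variable {k : Type} [Field k]

/-- The zero locus in affine space `k^σ` of a set of polynomials. -/
def zeroLocus {σ : Type} (I : Set (MvPolynomial σ k)) : Set (σ → k) :=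
  {x | ∀ f ∈ I, MvPolynomial.eval x f = 0}

/-- A subset of affine space is Zariski closed if it is the zero locus of a set
of polynomials. -/
def IsZClosed {σ : Type} (S : Set (σ → k)) : Prop :=
  ∃ I : Set (MvPolynomial σ k), S = zeroLocus I

/-- The Zariski closure of a subset of affine space. -/
def zClosure {σ : Type} (S : Set (σ → k)) : Set (σ → k) :=
  ⋂₀ {C | IsZClosed C ∧ S ⊆ C}

/-- A matrix viewed as a point of affine space. -/
def mat2pt {n : ℕ} (A : Matrix (Fin n) (Fin n) k) : Fin n × Fin n → k :=
  fun p => A p.1 p.2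

/-- An affine algebraic group over `k`, realized (as is always possible) as a
Zariski closed subgroup of some `GL n k`. -/
structure AlgGroup (k : Type) [Field k] where
  n : ℕ
  toSubgroup : Subgroup (GL (Fin n) k)
  closed : ∃ I : Set (MvPolynomial (Fin n × Fin n) k),
    ∀ A : GL (Fin n) k, A ∈ toSubgroup ↔
      mat2pt (A : Matrix (Fin n) (Fin n) k) ∈ zeroLocus I

/-- A one-parameter subgroup (cocharacter) of `G`: a group homomorphism
`k^× → G` whose matrix entries are Laurent polynomials in the parameter. -/
structure OnePS (G : AlgGroup k) where
  toFun : kˣ →* GL (Fin G.n) k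
  mem : ∀ t : kˣ, toFun t ∈ G.toSubgroup
  regular : ∃ p : Fin G.n × Fin G.n → MvPolynomial Bool k,
    ∀ (t : kˣ) (ij : Fin G.n × Fin G.n),
      (toFun t : Matrix (Fin G.n) (Fin G.n) k) ij.1 ij.2 =
        MvPolynomial.eval (fun b => if b then (t : k) else ((t⁻¹ : kˣ) : k)) (p ij)

/-- `GLimit lam g h` says that the morphism `t ↦ lam(t) * g * lam(t)⁻¹` of `k^×`
into `G` extends to a morphism `k → G` with value `h` at `t = 0`; i.e. that
`lam⁺g = lim_{t→0} lam(t) g lam(t)⁻¹` exists and equals `h`. -/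
def GLimit {G : AlgGroup k} (lam : OnePS G) (g h : GL (Fin G.n) k) : Prop :=
  h ∈ G.toSubgroup ∧
  ∃ q : Fin G.n × Fin G.n → Polynomial k,
    (∀ (t : kˣ) (ij : Fin G.n × Fin G.n),
      ((lam.toFun t * g * (lam.toFun t)⁻¹ : GL (Fin G.n) k) :
          Matrix (Fin G.n) (Fin G.n) k) ij.1 ij.2 = (q ij).eval (t : k)) ∧
    ∀ ij : Fin G.n × Fin G.n,
      (h : Matrix (Fin G.n) (Fin G.n) k) ij.1 ij.2 = (q ij).eval 0

/-- The R-parabolic subgroup `P(λ) = {g ∈ G : lim_{t→0} λ(t) g λ(t)⁻¹ exists}`. -/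
def Pset {G : AlgGroup k} (lam : OnePS G) : Set (GL (Fin G.n) k) :=
  {g | g ∈ G.toSubgroup ∧ ∃ h, GLimit lam g h}

/-- The R-Levi subgroup `L(λ) = {g ∈ G : lim_{t→0} λ(t) g λ(t)⁻¹ = g}`. -/
def Lset {G : AlgGroup k} (lam : OnePS G) : Set (GL (Fin G.n) k) :=
  {g | g ∈ G.toSubgroup ∧ GLimit lam g g}

/-- `L` is an R-Levi subgroup of the R-parabolic subgroup `P`, i.e. `L = L(μ)`
for some one-parameter subgroup `μ` with `P(μ) = P`. -/
def IsRLeviOf {G : AlgGroup k} (L P : Set (GL (Fin G.n) k)) : Prop :=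
  ∃ mu : OnePS G, Pset mu = P ∧ Lset mu = L

/-- `P` is an R-parabolic subgroup of `G`. -/
def IsRParabolic {G : AlgGroup k} (P : Set (GL (Fin G.n) k)) : Prop :=
  ∃ lam : OnePS G, P = Pset lam

/-- Two one-parameter subgroups are opposite if `P(λ) ∩ P(λ')` is an R-Levi
subgroup of both `P(λ)` and `P(λ')`. -/
def AreOpposite {G : AlgGroup k} (lam lam' : OnePS G) : Prop :=
  IsRLeviOf (Pset lam ∩ Pset lam') (Pset lam) ∧
  IsRLeviOf (Pset lam ∩ Pset lam') (Pset lam')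

/-- A subgroup (given as a subset) `H ⊆ G` is completely reducible in `G` if
every R-parabolic subgroup of `G` containing `H` has an R-Levi subgroup
containing `H`. -/
def CompletelyReducible (G : AlgGroup k) (H : Set (GL (Fin G.n) k)) : Prop :=
  ∀ lam : OnePS G, H ⊆ Pset lam →
    ∃ L : Set (GL (Fin G.n) k), IsRLeviOf L (Pset lam) ∧ H ⊆ L

/-- A subgroup (given as a subset) `H ⊆ G` is irreducible in `G` if it is not
contained in any proper R-parabolic subgroup of `G`. -/
def IrreducibleIn (G : AlgGroup k) (H : Set (GL (Fin G.n) k)) : Prop :=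
  ∀ lam : OnePS G, H ⊆ Pset lam → Pset lam = (G.toSubgroup : Set (GL (Fin G.n) k))

/-- The center `Z(G)` of `G`, as a subset. -/
def centerSet (G : AlgGroup k) : Set (GL (Fin G.n) k) :=
  {g | g ∈ G.toSubgroup ∧ ∀ h ∈ G.toSubgroup, g * h = h * g}

/-- The centralizer `Z_G(H)` of a subset `H` in `G`. -/
def centralizerSet (G : AlgGroup k) (H : Set (GL (Fin G.n) k)) :
    Set (GL (Fin G.n) k) :=
  {g | g ∈ G.toSubgroup ∧ ∀ h ∈ H, g * h = h * g}

/-- A subset of `GL n k` which is Zariski closed in `GL n k` (with the subspace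
topology coming from the space of matrices). -/
def ClosedInGL {n : ℕ} (S : Set (GL (Fin n) k)) : Prop :=
  ∃ I : Set (MvPolynomial (Fin n × Fin n) k),
    S = {A : GL (Fin n) k | mat2pt (A : Matrix (Fin n) (Fin n) k) ∈ zeroLocus I}

/-- Zariski connectedness (preconnectedness) of a subset of `GL n k`. -/
def IsConnSet {n : ℕ} (T : Set (GL (Fin n) k)) : Prop :=
  ∀ V W : Set (GL (Fin n) k), ClosedInGL V → ClosedInGL W →
    T ⊆ V ∪ W → T ∩ V ∩ W = ∅ → T ⊆ V ∨ T ⊆ W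

/-- The connected component of the identity of `G`. -/
def idComponent (G : AlgGroup k) : Set (GL (Fin G.n) k) :=
  ⋃₀ {C | C ⊆ (G.toSubgroup : Set (GL (Fin G.n) k)) ∧
      (1 : GL (Fin G.n) k) ∈ C ∧ IsConnSet C}

/-- A unipotent element of `GL n k`. -/
def IsUnipotentEl {n : ℕ} (A : GL (Fin n) k) : Prop :=
  ((A : Matrix (Fin n) (Fin n) k) - 1) ^ n = 0

/-- `G` is reductive: the unipotent radical of the identity component `G⁰` is
trivial, i.e. every connected normal subgroup of `G⁰` consisting of unipotent
elements is trivial. -/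
def IsReductive (G : AlgGroup k) : Prop :=
  ∀ H : Set (GL (Fin G.n) k),
    H ⊆ idComponent G → (1 : GL (Fin G.n) k) ∈ H →
    (∀ a ∈ H, ∀ b ∈ H, a * b ∈ H) → (∀ a ∈ H, a⁻¹ ∈ H) →
    (∀ g ∈ idComponent G, ∀ h ∈ H, g * h * g⁻¹ ∈ H) →
    IsConnSet H → (∀ h ∈ H, IsUnipotentEl h) →
    H = {1}

/-- A semisimple (diagonalizable) element of `GL n k`. -/
def IsSemisimpleEl {n : ℕ} (A : GL (Fin n) k) : Prop :=
  ∃ P : GL (Fin n) k,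
    ((P * A * P⁻¹ : GL (Fin n) k) : Matrix (Fin n) (Fin n) k).IsDiag

/-- A torus in `G`: a Zariski closed connected commutative subgroup all of
whose elements are semisimple. -/
def IsTorusIn (G : AlgGroup k) (T : Set (GL (Fin G.n) k)) : Prop :=
  T ⊆ (G.toSubgroup : Set (GL (Fin G.n) k)) ∧ (1 : GL (Fin G.n) k) ∈ T ∧
  (∀ a ∈ T, ∀ b ∈ T, a * b ∈ T) ∧ (∀ a ∈ T, a⁻¹ ∈ T) ∧
  ClosedInGL T ∧ IsConnSet T ∧
  (∀ a ∈ T, ∀ b ∈ T, a * b = b * a) ∧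
  (∀ a ∈ T, IsSemisimpleEl a)

/-- A maximal torus of `G`. -/
def IsMaximalTorusIn (G : AlgGroup k) (T : Set (GL (Fin G.n) k)) : Prop :=
  IsTorusIn G T ∧ ∀ T' : Set (GL (Fin G.n) k), IsTorusIn G T' → T ⊆ T' → T' = T

/-- A morphism of affine algebraic groups: a group homomorphism on the points
of `G` whose matrix entries are regular functions on `G`. -/
structure AlgGroupHom (G G' : AlgGroup k) where
  toFun : GL (Fin G.n) k → GL (Fin G'.n) k
  mem : ∀ g ∈ G.toSubgroup, toFun g ∈ G'.toSubgroup
  map_one : toFun 1 = 1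
  map_mul : ∀ g ∈ G.toSubgroup, ∀ h ∈ G.toSubgroup, toFun (g * h) = toFun g * toFun h
  regular : ∃ p : Fin G'.n × Fin G'.n → MvPolynomial ((Fin G.n × Fin G.n) ⊕ Unit) k,
    ∀ g ∈ G.toSubgroup, ∀ ij : Fin G'.n × Fin G'.n,
      (toFun g : Matrix (Fin G'.n) (Fin G'.n) k) ij.1 ij.2 =
        MvPolynomial.eval
          (Sum.elim (mat2pt (g : Matrix (Fin G.n) (Fin G.n) k))
            (fun _ => ((g⁻¹ : GL (Fin G.n) k) : Matrix (Fin G.n) (Fin G.n) k).det))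
          (p ij)

/-- Surjectivity of a morphism of algebraic groups (onto the points of `G'`). -/
def AlgGroupHom.Surj {G G' : AlgGroup k} (f : AlgGroupHom G G') : Prop :=
  ∀ g' ∈ G'.toSubgroup, ∃ g ∈ G.toSubgroup, f.toFun g = g'

/-- An affine `G`-variety: a Zariski closed subset of affine space `k^m`
together with an algebraic (polynomially defined) action of `G`. -/
structure GVariety (G : AlgGroup k) (m : ℕ) where
  carrier : Set (Fin m → k)
  closed : IsZClosed carrier
  act : GL (Fin G.n) k → (Fin m → k) → (Fin m → k)
  act_mem : ∀ g ∈ G.toSubgroup, ∀ x ∈ carrier, act g x ∈ carrier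
  act_one : ∀ x ∈ carrier, act 1 x = x
  act_mul : ∀ g ∈ G.toSubgroup, ∀ h ∈ G.toSubgroup, ∀ x ∈ carrier,
    act (g * h) x = act g (act h x)
  regular : ∃ p : Fin m → MvPolynomial ((Fin G.n × Fin G.n) ⊕ (Unit ⊕ Fin m)) k,
    ∀ g ∈ G.toSubgroup, ∀ x ∈ carrier, ∀ i : Fin m,
      act g x i =
        MvPolynomial.eval
          (Sum.elim (mat2pt (g : Matrix (Fin G.n) (Fin G.n) k))
            (Sum.elim
              (fun _ => ((g⁻¹ : GL (Fin G.n) k) : Matrix (Fin G.n) (Fin G.n) k).det)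
              x))
          (p i)

/-- `XLimit X lam x y` : the `lam`-ray through `x`, `t ↦ lam(t)·x`, extends to
a morphism `k → X` with value `y` at `0`; i.e. `lam⁺x` exists and equals `y`. -/
def XLimit {G : AlgGroup k} {m : ℕ} (X : GVariety G m) (lam : OnePS G)
    (x y : Fin m → k) : Prop :=
  y ∈ X.carrier ∧
  ∃ q : Fin m → Polynomial k,
    (∀ (t : kˣ) (i : Fin m), X.act (lam.toFun t) x i = (q i).eval (t : k)) ∧
    ∀ i : Fin m, y i = (q i).eval 0

/-- `lam ∈ Λ_x` : the limit `lam⁺x` exists. -/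
def InLambda {G : AlgGroup k} {m : ℕ} (X : GVariety G m) (x : Fin m → k)
    (lam : OnePS G) : Prop :=
  ∃ y, XLimit X lam x y

/-- `H_x = ∩_{λ ∈ Λ_x} P(λ)`. -/
def Hx {G : AlgGroup k} {m : ℕ} (X : GVariety G m) (x : Fin m → k) :
    Set (GL (Fin G.n) k) :=
  {g | g ∈ G.toSubgroup ∧ ∀ lam : OnePS G, InLambda X x lam → g ∈ Pset lam}

/-- `Λ_x` is symmetric: every `λ ∈ Λ_x` admits an opposite `λ' ∈ Λ_x`. -/
def SymmetricLambda {G : AlgGroup k} {m : ℕ} (X : GVariety G m)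
    (x : Fin m → k) : Prop :=
  ∀ lam : OnePS G, InLambda X x lam →
    ∃ lam' : OnePS G, InLambda X x lam' ∧ AreOpposite lam lam'

/-- The map `η : X → S(G)`, `x ↦ H_x`, is proper: `H_x ⊆ P(λ)` implies `λ ∈ Λ_x`. -/
def EtaProper {G : AlgGroup k} {m : ℕ} (X : GVariety G m) : Prop :=
  ∀ x ∈ X.carrier, ∀ lam : OnePS G, Hx X x ⊆ Pset lam → InLambda X x lam

/-- The `G`-orbit of `x`. -/
def orbitSet {G : AlgGroup k} {m : ℕ} (X : GVariety G m) (x : Fin m → k) :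
    Set (Fin m → k) :=
  {y | ∃ g ∈ G.toSubgroup, y = X.act g x}

/-- `x` is polystable: its `G`-orbit is Zariski closed. -/
def Polystable {G : AlgGroup k} {m : ℕ} (X : GVariety G m) (x : Fin m → k) : Prop :=
  IsZClosed (orbitSet X x)

/-- The stabilizer `G_x` of `x`, as a subset of `G`. -/
def stabSet {G : AlgGroup k} {m : ℕ} (X : GVariety G m) (x : Fin m → k) :
    Set (GL (Fin G.n) k) :=
  {g | g ∈ G.toSubgroup ∧ X.act g x = x}

/-- The center of the action, `G_X = ∩_{x ∈ X} G_x`. -/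
def actionCenter {G : AlgGroup k} {m : ℕ} (X : GVariety G m) :
    Set (GL (Fin G.n) k) :=
  {g | g ∈ G.toSubgroup ∧ ∀ x ∈ X.carrier, X.act g x = x}

/-- `x` is stable: polystable and `G_x/G_X` is finite (finitely many cosets
`g·G_X` with `g ∈ G_x`). -/
def Stable {G : AlgGroup k} {m : ℕ} (X : GVariety G m) (x : Fin m → k) : Prop :=
  Polystable X x ∧
  Set.Finite ((fun g => (fun h => g * h) '' actionCenter X) '' stabSet X x)

/-- `x` is properly stable: polystable with finite stabilizer. -/
def ProperlyStable {G : AlgGroup k} {m : ℕ} (X : GVariety G m) (x : Fin m → k) : Prop :=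
  Polystable X x ∧ (stabSet X x).Finite

/-- `x` is equicentral: polystable and `G_x = G_X`. -/
def Equicentral {G : AlgGroup k} {m : ℕ} (X : GVariety G m) (x : Fin m → k) : Prop :=
  Polystable X x ∧ stabSet X x = actionCenter X

/-- `x` is 1PS stable: polystable, and for every one-parameter subgroup `λ`
of `G` with `λ(k^×) ⊄ G_X` the limit `λ⁺x` does not exist. -/
def OnePSStable {G : AlgGroup k} {m : ℕ} (X : GVariety G m) (x : Fin m → k) : Prop :=
  Polystable X x ∧
  ∀ lam : OnePS G, ¬ (∀ t : kˣ, lam.toFun t ∈ actionCenter X) → ¬ InLambda X x lam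

/-- The weight space of weight `n ∈ ℤ` for the 1PS `lam` acting on `k^m`. -/
def weightSpace {G : AlgGroup k} {m : ℕ} (X : GVariety G m) (lam : OnePS G)
    (n : ℤ) : Set (Fin m → k) :=
  {w | ∀ t : kˣ, X.act (lam.toFun t) w = (((t ^ n : kˣ) : k)) • w}

/-- `μ(v, lam) = μ0`: decomposing `v` into nonzero weight vectors for `lam`,
the minimal occurring weight equals `μ0`. -/
def MuIs {G : AlgGroup k} {m : ℕ} (X : GVariety G m) (lam : OnePS G)
    (v : Fin m → k) (μ0 : ℤ) : Prop :=
  ∃ (s : Finset ℤ) (c : ℤ → (Fin m → k)),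
    (∀ n ∈ s, c n ∈ weightSpace X lam n ∧ c n ≠ 0) ∧
    v = ∑ n ∈ s, c n ∧ μ0 ∈ s ∧ ∀ n ∈ s, μ0 ≤ n

/-- `GL n k` itself, as an affine algebraic group. -/
def fullGL (k : Type) [Field k] (n : ℕ) : AlgGroup k where
  n := n
  toSubgroup := ⊤
  closed := ⟨∅, by intro A; simp [zeroLocus]⟩

/-- A subset `X ⊆ G^N` which is Zariski closed in `G^N`. -/
def GNClosed (G : AlgGroup k) (N : ℕ)
    (S : Set (Fin N → GL (Fin G.n) k)) : Prop :=
  ∃ I : Set (MvPolynomial (Fin N × (Fin G.n × Fin G.n)) k),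
    S = {x | (∀ i, x i ∈ G.toSubgroup) ∧
          ∀ f ∈ I, MvPolynomial.eval
            (fun p => ((x p.1 : Matrix (Fin G.n) (Fin G.n) k) p.2.1 p.2.2)) f = 0}

/-- Limits of the `lam`-ray through `x ∈ X ⊆ G^N`, for the simultaneous
conjugation action. -/
def GNLimit {G : AlgGroup k} {N : ℕ} (X : Set (Fin N → GL (Fin G.n) k))
    (lam : OnePS G) (x y : Fin N → GL (Fin G.n) k) : Prop :=
  y ∈ X ∧
  ∃ q : Fin N → Fin G.n × Fin G.n → Polynomial k,
    (∀ (t : kˣ) (i : Fin N) (ij : Fin G.n × Fin G.n),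
      ((lam.toFun t * x i * (lam.toFun t)⁻¹ : GL (Fin G.n) k) :
          Matrix (Fin G.n) (Fin G.n) k) ij.1 ij.2 = (q i ij).eval (t : k)) ∧
    ∀ (i : Fin N) (ij : Fin G.n × Fin G.n),
      (y i : Matrix (Fin G.n) (Fin G.n) k) ij.1 ij.2 = (q i ij).eval 0

/-- `lam ∈ Λ_x` for `x ∈ X ⊆ G^N`. -/
def GNInLambda {G : AlgGroup k} {N : ℕ} (X : Set (Fin N → GL (Fin G.n) k))
    (x : Fin N → GL (Fin G.n) k) (lam : OnePS G) : Prop :=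
  ∃ y, GNLimit X lam x y

/-- `H_x` for `x ∈ X ⊆ G^N`. -/
def GNHx {G : AlgGroup k} {N : ℕ} (X : Set (Fin N → GL (Fin G.n) k))
    (x : Fin N → GL (Fin G.n) k) : Set (GL (Fin G.n) k) :=
  {g | g ∈ G.toSubgroup ∧ ∀ lam : OnePS G, GNInLambda X x lam → g ∈ Pset lam}

/-- `φ_x`: the subgroup of `G` generated by the components of `x ∈ G^N`. -/
def phiSet {G : AlgGroup k} {N : ℕ} (x : Fin N → GL (Fin G.n) k) :
    Set (GL (Fin G.n) k) :=
  (Subgroup.closure (Set.range x) : Subgroup (GL (Fin G.n) k))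

/-- The orbit of `x ∈ G^N` under simultaneous conjugation. -/
def GNOrbit {G : AlgGroup k} {N : ℕ} (x : Fin N → GL (Fin G.n) k) :
    Set (Fin N → GL (Fin G.n) k) :=
  {y | ∃ g ∈ G.toSubgroup, y = fun i => g * x i * g⁻¹}

/-- Polystability of `x ∈ X ⊆ G^N`: the conjugation orbit is Zariski closed. -/
def GNPolystable (G : AlgGroup k) {N : ℕ} (x : Fin N → GL (Fin G.n) k) : Prop :=
  GNClosed G N (GNOrbit x)

/-- The stabilizer of `x ∈ G^N` under simultaneous conjugation. -/
def GNStab (G : AlgGroup k) {N : ℕ} (x : Fin N → GL (Fin G.n) k) :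
    Set (GL (Fin G.n) k) :=
  {g | g ∈ G.toSubgroup ∧ ∀ i, g * x i * g⁻¹ = x i}

/-- `G_X` for `X ⊆ G^N` with the simultaneous conjugation action. -/
def GNActionCenter (G : AlgGroup k) {N : ℕ}
    (X : Set (Fin N → GL (Fin G.n) k)) : Set (GL (Fin G.n) k) :=
  {g | g ∈ G.toSubgroup ∧ ∀ x ∈ X, ∀ i, g * x i * g⁻¹ = x i}

/-- `x ∈ X ⊆ G^N` is stable: polystable and `G_x/G_X` finite. -/
def GNStable (G : AlgGroup k) {N : ℕ} (X : Set (Fin N → GL (Fin G.n) k))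
    (x : Fin N → GL (Fin G.n) k) : Prop :=
  GNPolystable G x ∧
  Set.Finite ((fun g => (fun h => g * h) '' GNActionCenter G X) '' GNStab G x)

/-- `x ∈ X ⊆ G^N` is equicentral: polystable and `G_x = G_X`. -/
def GNEquicentral (G : AlgGroup k) {N : ℕ} (X : Set (Fin N → GL (Fin G.n) k))
    (x : Fin N → GL (Fin G.n) k) : Prop :=
  GNPolystable G x ∧ GNStab G x = GNActionCenter G X

/-- A subgroup `H ⊆ G` is isotropic: completely reducible with `Z_G(H) = Z(G)`. -/
def IsIsotropic (G : AlgGroup k) (H : Set (GL (Fin G.n) k)) : Prop :=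
  CompletelyReducible G H ∧ centralizerSet G H = centerSet G

end PaperGIT


namespace PaperGIT
section F1
set_option linter.unusedSectionVars false
set_option linter.unusedVariables false

open MvPolynomial

variable {k : Type} [Field k] {ι : Type} [Fintype ι] [DecidableEq ι]

/-- evaluation of a polynomial in matrix entries at a matrix -/
noncomputable def evM {R : Type} [CommRing R] [Algebra k R] (g : Matrix ι ι R) :
    MvPolynomial (ι × ι) k →ₐ[k] R :=
  aeval (fun p => g p.1 p.2)

/-- vanishing polynomials -/
def van (Γ : Set (Matrix ι ι k)) : Set (MvPolynomial (ι × ι) k) :=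
  {f | ∀ γ ∈ Γ, evM γ f = 0}

/-- R-points -/
def pts (Γ : Set (Matrix ι ι k)) (R : Type) [CommRing R] [Algebra k R] : Set (Matrix ι ι R) :=
  {g | ∀ f ∈ van Γ, evM g f = 0}

/-- Zariski closed subgroups of SL -/
structure IsSLGroup (Γ : Set (Matrix ι ι k)) : Prop where
  one_mem : 1 ∈ Γ
  mul_mem : ∀ a ∈ Γ, ∀ b ∈ Γ, a * b ∈ Γ
  inv_mem : ∀ a ∈ Γ, a.adjugate ∈ Γ
  det_one : ∀ a ∈ Γ, a.det = 1
  closed : ∀ g : Matrix ι ι k, g ∈ pts Γ k → g ∈ Γ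

lemma evM_map {R S : Type} [CommRing R] [Algebra k R] [CommRing S] [Algebra k S] (φ : R →ₐ[k] S)
    (g : Matrix ι ι R) (f : MvPolynomial (ι × ι) k) :
    evM (g.map φ) f = φ (evM g f) := by
  unfold evM
  rw [← AlgHom.comp_apply]
  congr 1
  ext p
  simp

lemma pts_map {Γ : Set (Matrix ι ι k)} {R S : Type} [CommRing R] [Algebra k R] [CommRing S]
    [Algebra k S] (φ : R →ₐ[k] S) {g : Matrix ι ι R} (hg : g ∈ pts Γ R) :
    g.map φ ∈ pts Γ S := by
  intro f hf
  rw [evM_map, hg f hf, map_zero]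

lemma subset_pts {Γ : Set (Matrix ι ι k)} {g : Matrix ι ι k} (hg : g ∈ Γ) : g ∈ pts Γ k :=
  fun f hf => hf g hg

lemma mem_pts_map {Γ : Set (Matrix ι ι k)} {g : Matrix ι ι k} (hg : g ∈ Γ) (R : Type)
    [CommRing R] [Algebra k R] : g.map (algebraMap k R) ∈ pts Γ R :=
  pts_map (Algebra.ofId k R) (subset_pts hg)

/-- density lemma: polynomial identities with coefficients in `R` valid on `Γ` are valid on
`R`-points -/
lemma density {Γ : Set (Matrix ι ι k)} {R : Type} [CommRing R] [Algebra k R]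
    (P : MvPolynomial (ι × ι) R)
    (hP : ∀ γ ∈ Γ, eval (fun p => algebraMap k R (γ p.1 p.2)) P = 0)
    {g : Matrix ι ι R} (hg : g ∈ pts Γ R) : eval (fun p => g p.1 p.2) P = 0 := by
  classical
  let b := Module.Basis.ofVectorSpace k R
  let J := P.support.biUnion fun m => (b.repr (P.coeff m)).support
  let Q : (Module.Basis.ofVectorSpaceIndex k R) → MvPolynomial (ι × ι) k := fun j =>
    ∑ m ∈ P.support, monomial m (b.repr (P.coeff m) j)
  have key : ∀ h : Matrix ι ι R, eval (fun p => h p.1 p.2) P = ∑ j ∈ J, evM h (Q j) * b j := by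
    intro h
    have h1 : ∀ m ∈ P.support, P.coeff m = ∑ j ∈ J, b.repr (P.coeff m) j • b j := by
      intro m hm
      conv_lhs => rw [← b.linearCombination_repr (P.coeff m)]
      rw [Finsupp.linearCombination_apply, Finsupp.sum]
      apply Finset.sum_subset
      · intro j hj
        exact Finset.mem_biUnion.2 ⟨m, hm, hj⟩
      · intro j _ hj
        rw [Finsupp.notMem_support_iff.1 hj, zero_smul]
    rw [eval_eq]
    calc _ = ∑ m ∈ P.support, (∑ j ∈ J, b.repr (P.coeff m) j • b j) *
          ∏ i ∈ m.support, (h i.1 i.2) ^ m i := by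
          apply Finset.sum_congr rfl
          intro m hm
          rw [← h1 m hm]
      _ = _ := by
          simp only [Finset.sum_mul]
          rw [Finset.sum_comm]
          apply Finset.sum_congr rfl
          intro j _
          simp only [Q, map_sum, Finset.sum_mul]
          apply Finset.sum_congr rfl
          intro m _
          simp only [evM, aeval_monomial, Algebra.smul_def, Finsupp.prod]
          ring
  rw [key]
  apply Finset.sum_eq_zero
  intro j _
  rw [hg (Q j) _, zero_mul]
  intro γ hγ
  have h2 := key (γ.map (algebraMap k R))
  simp only [Matrix.map_apply] at h2
  rw [hP γ hγ] at h2
  have h3 : ∀ j, evM (γ.map (algebraMap k R)) (Q j) = algebraMap k R (evM γ (Q j)) := fun j =>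
    evM_map (Algebra.ofId k R) γ (Q j)
  simp only [h3, ← Algebra.smul_def] at h2
  have h4 := linearIndependent_iff'.1 b.linearIndependent J (fun j => evM γ (Q j)) h2.symm
  by_cases hj : j ∈ J
  · exact h4 j hj
  · have : Q j = 0 := by
      apply Finset.sum_eq_zero
      intro m hm
      have : b.repr (P.coeff m) j = 0 := by
        by_contra hne
        exact hj (Finset.mem_biUnion.2 ⟨m, hm, Finsupp.mem_support_iff.2 hne⟩)
      rw [this, map_zero]
    rw [this, map_zero]

/-- the generic matrix -/
noncomputable def genM (k ι : Type) [Field k] : Matrix ι ι (MvPolynomial (ι × ι) k) :=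
  fun i j => X (i, j)

lemma evM_genM {R : Type} [CommRing R] [Algebra k R] (g : Matrix ι ι R) :
    (genM k ι).map (evM g) = g := by
  ext i j
  simp [genM, evM]

lemma evM_comp {R S : Type} [CommRing R] [Algebra k R] [CommRing S] [Algebra k S]
    (φ : R →ₐ[k] S) (M : Matrix ι ι R) (f : MvPolynomial (ι × ι) k) :
    φ (evM M f) = evM (M.map φ) f := (evM_map φ M f).symm

lemma eval_map_evM {R : Type} [CommRing R] [Algebra k R]
    (g : Matrix ι ι R) (f : MvPolynomial (ι × ι) k) :
    eval (fun p => g p.1 p.2) (map (algebraMap k R) f) = evM g f := by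
  rw [eval_map]; rfl

lemma pts_mul {Γ : Set (Matrix ι ι k)} (hΓ : IsSLGroup Γ) {R : Type} [CommRing R] [Algebra k R]
    {a b : Matrix ι ι R} (ha : a ∈ pts Γ R) (hb : b ∈ pts Γ R) : a * b ∈ pts Γ R := by
  -- first step: left factor in Γ
  have step1 : ∀ γ ∈ Γ, γ.map (algebraMap k R) * b ∈ pts Γ R := by
    intro γ hγ f hf
    have h1 : (evM (γ.map (algebraMap k _) * genM k ι) f) ∈ van Γ := by
      intro δ hδ
      rw [evM_comp, Matrix.map_mul, evM_genM, Matrix.map_map]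
      have : (⇑(evM δ) ∘ ⇑(algebraMap k (MvPolynomial (ι × ι) k))) = id := by
        ext x; simp
      rw [this, Matrix.map_id]
      exact hf _ (hΓ.mul_mem _ hγ _ hδ)
    have h2 := hb _ h1
    rw [evM_comp, Matrix.map_mul, evM_genM, Matrix.map_map] at h2
    have : (⇑(evM b) ∘ ⇑(algebraMap k (MvPolynomial (ι × ι) k))) = algebraMap k R := by
      ext x; simp
    rwa [this] at h2
  intro f hf
  let N : Matrix ι ι (MvPolynomial (ι × ι) R) :=
    (Matrix.of fun i j => X (i, j)) * b.map C
  let P : MvPolynomial (ι × ι) R := evM (k := k) N f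
  have hev : ∀ g : Matrix ι ι R, eval (fun p => g p.1 p.2) P = evM (g * b) f := by
    intro g
    have h0 : (eval (fun p => g p.1 p.2) P) =
      ((aeval (R := R) (fun p : ι × ι => g p.1 p.2)).restrictScalars k) P := by
      simp [aeval_eq_eval]
    rw [h0, evM_comp]
    congr 2
    ext i j
    simp [N, Matrix.mul_apply]
  rw [← hev]
  apply density P _ ha
  intro γ hγ
  have := hev (γ.map (algebraMap k R))
  simp only [Matrix.map_apply] at this
  rw [this]
  exact step1 γ hγ f hf

lemma pts_one {Γ : Set (Matrix ι ι k)} (hΓ : IsSLGroup Γ) {R : Type} [CommRing R] [Algebra k R] :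
    (1 : Matrix ι ι R) ∈ pts Γ R := by
  have := mem_pts_map hΓ.one_mem R
  simpa using this

lemma evM_det {R : Type} [CommRing R] [Algebra k R] (g : Matrix ι ι R) :
    evM g (genM k ι).det = g.det := by
  rw [AlgHom.map_det]
  congr 1
  exact evM_genM g

lemma pts_det {Γ : Set (Matrix ι ι k)} (hΓ : IsSLGroup Γ) {R : Type} [CommRing R] [Algebra k R]
    {a : Matrix ι ι R} (ha : a ∈ pts Γ R) : a.det = 1 := by
  have : (genM k ι).det - 1 ∈ van Γ := by
    intro γ hγ
    rw [map_sub, evM_det, hΓ.det_one γ hγ, map_one, sub_self]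
  have := ha _ this
  rw [map_sub, evM_det, map_one] at this
  exact sub_eq_zero.1 this

lemma pts_inv {Γ : Set (Matrix ι ι k)} (hΓ : IsSLGroup Γ) {R : Type} [CommRing R] [Algebra k R]
    {a : Matrix ι ι R} (ha : a ∈ pts Γ R) : a⁻¹ ∈ pts Γ R := by
  have hai : a⁻¹ = a.adjugate := by
    rw [Matrix.inv_def, pts_det hΓ ha]; simp
  rw [hai]
  intro f hf
  have h1 : evM (genM k ι).adjugate f ∈ van Γ := by
    intro γ hγ
    have h2 := AlgHom.map_adjugate (evM γ) (genM k ι)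
    rw [AlgHom.mapMatrix_apply, AlgHom.mapMatrix_apply, evM_genM] at h2
    rw [evM_comp, h2]
    exact hf _ (hΓ.inv_mem γ hγ)
  have h3 := ha _ h1
  have h2 := AlgHom.map_adjugate (evM a) (genM k ι)
  rw [AlgHom.mapMatrix_apply, AlgHom.mapMatrix_apply, evM_genM] at h2
  rwa [evM_comp, h2] at h3

lemma pts_isUnit {Γ : Set (Matrix ι ι k)} (hΓ : IsSLGroup Γ) {R : Type} [CommRing R] [Algebra k R]
    {a : Matrix ι ι R} (ha : a ∈ pts Γ R) : IsUnit a.det := by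
  rw [pts_det hΓ ha]; exact isUnit_one

lemma inv_mem' {Γ : Set (Matrix ι ι k)} (hΓ : IsSLGroup Γ) {a : Matrix ι ι k} (ha : a ∈ Γ) :
    a⁻¹ ∈ Γ := hΓ.closed _ (pts_inv hΓ (subset_pts ha))

end F1
end PaperGIT


namespace PaperGIT
section F2
set_option linter.unusedSectionVars false
set_option linter.unusedVariables false

open MvPolynomial

variable {k : Type} [Field k] {ι : Type} [Fintype ι] [DecidableEq ι]

lemma evM_deriv {R : Type} [CommRing R] [Algebra k R] (d : Derivation k R R) (g : Matrix ι ι R)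
    (f : MvPolynomial (ι × ι) k) :
    d (evM g f) = ∑ p, d (g p.1 p.2) * evM g (pderiv p f) := by
  induction f using MvPolynomial.induction_on with
  | C a => simp [evM]
  | add p q hp hq => simp [hp, hq, mul_add, Finset.sum_add_distrib]
  | mul_X p n hp =>
    simp only [map_mul, Derivation.leibniz, hp, smul_eq_mul, map_add, mul_add,
      Finset.sum_add_distrib, Finset.mul_sum]
    have h1 : evM g (X n : MvPolynomial (ι × ι) k) = g n.1 n.2 := by simp [evM]
    rw [h1]
    congr 1
    · rw [Finset.sum_eq_single n]
      · simp; ring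
      · intro b _ hb; simp [pderiv_X_of_ne hb.symm]
      · simp
    · apply Finset.sum_congr rfl
      intro i _; ring

open TrivSqZeroExt in
lemma evM_dual {R : Type} [CommRing R] [Algebra k R] (g η : Matrix ι ι R)
    (f : MvPolynomial (ι × ι) k) :
    evM (R := DualNumber R) (g.map inl + η.map inr) f =
      inl (evM g f) + inr (∑ p, η p.1 p.2 * evM g (pderiv p f)) := by
  induction f using MvPolynomial.induction_on with
  | C a =>
    simp only [evM, algHom_C, pderiv_C, map_zero, mul_zero, Finset.sum_const_zero]
    simp [TrivSqZeroExt.algebraMap_eq_inl']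
  | add p q hp hq => 
    simp only [map_add, hp, hq, mul_add, Finset.sum_add_distrib, inl_add, inr_add]
    ring
  | mul_X p n hp =>
    have h1 : evM g (X n : MvPolynomial (ι × ι) k) = g n.1 n.2 := by simp [evM]
    have h2 : evM (R := DualNumber R) (g.map inl + η.map inr) (X n : MvPolynomial (ι × ι) k) =
      inl (g n.1 n.2) + inr (η n.1 n.2) := by simp [evM]
    simp only [map_mul, Derivation.leibniz, hp, smul_eq_mul, map_add, mul_add,
      Finset.sum_add_distrib, h1, h2]
    have h3 : ∑ x, η x.1 x.2 * (evM g p * evM g (pderiv x (X n : MvPolynomial (ι × ι) k))) = η n.1 n.2 * evM g p := by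
      rw [Finset.sum_eq_single n]
      · simp
      · intro b _ hb; simp [pderiv_X_of_ne hb.symm]
      · simp
    rw [h3]
    ext
    · simp
    · simp [Finset.sum_mul]
      rw [add_comm]
      congr 1
      apply Finset.sum_congr rfl
      intro i _; ring

/-- The Lie algebra of `Γ` with coefficients in `R`. -/
noncomputable def lie (Γ : Set (Matrix ι ι k)) (R : Type) [CommRing R] [Algebra k R] :
    Submodule R (Matrix ι ι R) where
  carrier := {ξ | ∀ f ∈ van Γ, ∑ p : ι × ι, ξ p.1 p.2 * evM (1 : Matrix ι ι R) (pderiv p f) = 0}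
  zero_mem' := by intro f _; simp
  add_mem' := by
    intro a b ha hb f hf
    simp [add_mul, Finset.sum_add_distrib, ha f hf, hb f hf]
  smul_mem' := by
    intro c a ha f hf
    simp [mul_assoc, ← Finset.mul_sum, ha f hf]

lemma mem_lie {Γ : Set (Matrix ι ι k)} {R : Type} [CommRing R] [Algebra k R] {ξ : Matrix ι ι R} :
    ξ ∈ lie Γ R ↔ ∀ f ∈ van Γ,
      ∑ p : ι × ι, ξ p.1 p.2 * evM (1 : Matrix ι ι R) (pderiv p f) = 0 := Iff.rfl

open TrivSqZeroExt in
lemma mem_lie_iff {Γ : Set (Matrix ι ι k)} (hΓ : IsSLGroup Γ) {R : Type} [CommRing R] [Algebra k R]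
    {ξ : Matrix ι ι R} : ξ ∈ lie Γ R ↔
      (1 : Matrix ι ι R).map inl + ξ.map inr ∈ pts Γ (DualNumber R) := by
  rw [mem_lie]
  apply forall₂_congr
  intro f hf
  rw [evM_dual, pts_one hΓ f hf, inl_zero, zero_add]
  constructor
  · intro h; rw [h]; rfl
  · intro h; exact inr_injective h

open TrivSqZeroExt in
lemma map_mul_dual {R : Type} [CommRing R] (a b c d : Matrix ι ι R) :
    ((a.map inl + b.map inr) * (c.map inl + d.map inr) : Matrix ι ι (DualNumber R)) =
      (a * c).map inl + (a * d + b * c).map inr := by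
  ext i j
  · simp [Matrix.mul_apply, TrivSqZeroExt.fst_sum]
  · simp [Matrix.mul_apply, TrivSqZeroExt.snd_sum, Finset.sum_add_distrib, mul_comm]

open TrivSqZeroExt in
lemma pts_inl {Γ : Set (Matrix ι ι k)} {R : Type} [CommRing R] [Algebra k R]
    {g : Matrix ι ι R} (hg : g ∈ pts Γ R) :
    g.map inl + (0 : Matrix ι ι R).map inr ∈ pts Γ (DualNumber R) := by
  have := pts_map (TrivSqZeroExt.inlAlgHom k R R) hg
  convert this using 1
  ext i j <;> simp

lemma lie_conj {Γ : Set (Matrix ι ι k)} (hΓ : IsSLGroup Γ) {R : Type} [CommRing R] [Algebra k R]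
    {g ξ : Matrix ι ι R} (hg : g ∈ pts Γ R) (hξ : ξ ∈ lie Γ R) : g * ξ * g⁻¹ ∈ lie Γ R := by
  rw [mem_lie_iff hΓ] at hξ ⊢
  have h := pts_mul hΓ (pts_mul hΓ (pts_inl hg) hξ) (pts_inl (pts_inv hΓ hg))
  rw [map_mul_dual, map_mul_dual] at h
  convert h using 3
  · rw [mul_one, Matrix.mul_nonsing_inv _ (pts_isUnit hΓ hg)]
  · simp

lemma lie_conj' {Γ : Set (Matrix ι ι k)} (hΓ : IsSLGroup Γ) {R : Type} [CommRing R] [Algebra k R]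
    {g ξ : Matrix ι ι R} (hg : g ∈ pts Γ R) (hξ : ξ ∈ lie Γ R) : g⁻¹ * ξ * g ∈ lie Γ R := by
  have := lie_conj hΓ (pts_inv hΓ hg) hξ
  rwa [Matrix.nonsing_inv_nonsing_inv _ (pts_isUnit hΓ hg)] at this

open TrivSqZeroExt in
lemma lie_log {Γ : Set (Matrix ι ι k)} (hΓ : IsSLGroup Γ) {R : Type} [CommRing R] [Algebra k R]
    (d : Derivation k R R) {g : Matrix ι ι R} (hg : g ∈ pts Γ R) : g.map d * g⁻¹ ∈ lie Γ R := by
  have h1 : g.map inl + (g.map d).map inr ∈ pts Γ (DualNumber R) := by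
    intro f hf
    rw [evM_dual, hg f hf]
    have := evM_deriv d g f
    rw [hg f hf, map_zero] at this
    simp only [Matrix.map_apply]
    rw [← this]; simp
  have h2 := pts_mul hΓ h1 (pts_inl (pts_inv hΓ hg))
  rw [map_mul_dual, Matrix.mul_nonsing_inv _ (pts_isUnit hΓ hg), mul_zero, zero_add] at h2
  exact (mem_lie_iff hΓ).2 h2

lemma lie_log' {Γ : Set (Matrix ι ι k)} (hΓ : IsSLGroup Γ) {R : Type} [CommRing R] [Algebra k R]
    (d : Derivation k R R) {g : Matrix ι ι R} (hg : g ∈ pts Γ R) : g⁻¹ * g.map d ∈ lie Γ R := by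
  have := lie_conj' hΓ hg (lie_log hΓ d hg)
  rwa [mul_assoc, mul_assoc, Matrix.nonsing_inv_mul _ (pts_isUnit hΓ hg), mul_one] at this

lemma evM_one_eq {R : Type} [CommRing R] [Algebra k R] (f : MvPolynomial (ι × ι) k) :
    evM (1 : Matrix ι ι R) f = algebraMap k R (evM 1 f) := by
  have := evM_map (Algebra.ofId k R) (1 : Matrix ι ι k) f
  rw [Matrix.map_one _ (map_zero _) (map_one _)] at this
  exact this

lemma lie_map_linear {Γ : Set (Matrix ι ι k)} {R : Type} [CommRing R] [Algebra k R]
    (φ : R →ₗ[k] k) {ξ : Matrix ι ι R} (hξ : ξ ∈ lie Γ R) : ξ.map φ ∈ lie Γ k := by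
  intro f hf
  have h := congrArg φ (hξ f hf)
  rw [map_sum, map_zero] at h
  rw [← h]
  apply Finset.sum_congr rfl
  intro p _
  rw [evM_one_eq (R := R), mul_comm (ξ p.1 p.2), ← Algebra.smul_def, map_smul, smul_eq_mul,
    mul_comm]
  rfl

lemma lie_map {Γ : Set (Matrix ι ι k)} (R : Type) [CommRing R] [Algebra k R]
    {ξ : Matrix ι ι k} (hξ : ξ ∈ lie Γ k) : ξ.map (algebraMap k R) ∈ lie Γ R := by
  intro f hf
  have h := congrArg (algebraMap k R) (hξ f hf)
  rw [map_sum, map_zero] at h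
  rw [← h]
  apply Finset.sum_congr rfl
  intro p _
  rw [evM_one_eq, map_mul]
  rfl

lemma lie_span {Γ : Set (Matrix ι ι k)} {R : Type} [CommRing R] [Algebra k R]
    {ξ : Matrix ι ι R} (hξ : ξ ∈ lie Γ R) :
    ∃ (J : Finset R) (ζ : R → Matrix ι ι k), (∀ j, ζ j ∈ lie Γ k) ∧
      ξ = ∑ j ∈ J, j • (ζ j).map (algebraMap k R) := by
  classical
  let b := Module.Basis.ofVectorSpace k R
  let J := Finset.univ.biUnion fun p : ι × ι => (b.repr (ξ p.1 p.2)).support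
  have h0 : ξ = ∑ j ∈ J, b j • (ξ.map (b.coord j)).map (algebraMap k R) := by
    ext i l
    rw [Matrix.sum_apply]
    conv_lhs => rw [← b.linearCombination_repr (ξ i l)]
    rw [Finsupp.linearCombination_apply, Finsupp.sum]
    rw [Finset.sum_subset (s₂ := J)]
    · apply Finset.sum_congr rfl
      intro j _
      simp [Algebra.smul_def, mul_comm]
    · intro j hj
      exact Finset.mem_biUnion.2 ⟨(i, l), Finset.mem_univ _, hj⟩
    · intro j _ hj
      rw [Finsupp.notMem_support_iff.1 hj, zero_smul]
  have hinj : Function.Injective b := b.injective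
  refine ⟨J.map ⟨b, hinj⟩, fun r => if h : ∃ j, b j = r then ξ.map (b.coord h.choose) else 0, ?_, ?_⟩
  · intro r
    dsimp only
    split_ifs with h
    · exact lie_map_linear _ hξ
    · exact zero_mem _
  · rw [Finset.sum_map]
    conv_lhs => rw [h0]
    apply Finset.sum_congr rfl
    intro j _
    have h : ∃ j', b j' = b j := ⟨j, rfl⟩
    simp only [Function.Embedding.coeFn_mk, dif_pos h]
    have : h.choose = j := hinj h.choose_spec
    rw [this]

open TrivSqZeroExt in
lemma lie_bracket {Γ : Set (Matrix ι ι k)} (hΓ : IsSLGroup Γ)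
    {ξ η : Matrix ι ι k} (hξ : ξ ∈ lie Γ k) (hη : η ∈ lie Γ k) : ξ * η - η * ξ ∈ lie Γ k := by
  have h1 := (mem_lie_iff hΓ).1 hξ
  have h2 := lie_conj hΓ h1 (lie_map (DualNumber k) hη)
  have h3 := lie_map_linear (TrivSqZeroExt.sndHom k k) h2
  convert h3 using 1
  have h4 : ((1 : Matrix ι ι k).map inl + ξ.map inr : Matrix ι ι (DualNumber k))⁻¹ =
      (1 : Matrix ι ι k).map inl + (-ξ).map inr := by
    apply Matrix.inv_eq_right_inv
    rw [map_mul_dual]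
    ext i j <;> simp [Matrix.one_apply] <;> split_ifs <;> simp
  have h5 : η.map (algebraMap k (DualNumber k)) = η.map inl + (0 : Matrix ι ι k).map inr := by
    ext i j <;> simp [TrivSqZeroExt.algebraMap_eq_inl']
  rw [h4, h5, map_mul_dual, map_mul_dual]
  ext i j
  simp
  ring

/-- derivation by the right-invariant vector field -/
noncomputable def Dop (ξ : Matrix ι ι k) :
    Derivation k (MvPolynomial (ι × ι) k) (MvPolynomial (ι × ι) k) :=
  mkDerivation k fun p => (ξ.map (C : k → MvPolynomial (ι × ι) k) * genM k ι) p.1 p.2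

lemma Dop_eq (ξ : Matrix ι ι k) (f : MvPolynomial (ι × ι) k) :
    Dop ξ f = ∑ p, (ξ.map (C : k → MvPolynomial (ι × ι) k) * genM k ι) p.1 p.2 * pderiv p f := by
  induction f using MvPolynomial.induction_on with
  | C a => simp [Dop]
  | add p q hp hq => simp [hp, hq, mul_add, Finset.sum_add_distrib]
  | mul_X p n hp =>
    rw [Derivation.leibniz, hp]
    simp only [Derivation.leibniz, smul_eq_mul, mul_add, Finset.sum_add_distrib, Finset.mul_sum]
    congr 1
    · rw [Finset.sum_eq_single n]
      · simp [Dop, mul_comm]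
      · intro b _ hb; simp [pderiv_X_of_ne hb.symm]
      · simp
    · apply Finset.sum_congr rfl
      intro i _; ring

lemma evM_Dop {R : Type} [CommRing R] [Algebra k R] (ξ : Matrix ι ι k) (f : MvPolynomial (ι × ι) k)
    (g : Matrix ι ι R) :
    evM g (Dop ξ f) = ∑ p, (ξ.map (algebraMap k R) * g) p.1 p.2 * evM g (pderiv p f) := by
  rw [Dop_eq, map_sum]
  apply Finset.sum_congr rfl
  intro p _
  rw [map_mul]
  congr 1
  have : ((ξ.map (C : k → MvPolynomial (ι × ι) k) * genM k ι).map (evM g)) p.1 p.2 = (ξ.map (algebraMap k R) * g) p.1 p.2 := by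
    rw [Matrix.map_mul, evM_genM, Matrix.map_map]
    have h : (⇑(evM g) ∘ (C : k → MvPolynomial (ι × ι) k)) = algebraMap k R := by
      ext x; simp [evM]
    rw [h]
  exact this

open TrivSqZeroExt in
lemma Dop_van {Γ : Set (Matrix ι ι k)} (hΓ : IsSLGroup Γ) {ξ : Matrix ι ι k} (hξ : ξ ∈ lie Γ k)
    {f : MvPolynomial (ι × ι) k} (hf : f ∈ van Γ) : Dop ξ f ∈ van Γ := by
  intro γ hγ
  rw [evM_Dop]
  have h := pts_mul hΓ ((mem_lie_iff hΓ).1 hξ) (pts_inl (subset_pts hγ)) f hf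
  rw [map_mul_dual, evM_dual, one_mul, hf γ hγ] at h
  have h2 := congrArg snd h
  simpa using h2

lemma lie_of_Dop {Γ : Set (Matrix ι ι k)} (hΓ : IsSLGroup Γ) {ξ : Matrix ι ι k}
    (h : ∀ f ∈ van Γ, Dop ξ f ∈ van Γ) : ξ ∈ lie Γ k := by
  intro f hf
  have := h f hf 1 hΓ.one_mem
  rw [evM_Dop] at this
  simpa using this

end F2
end PaperGIT


namespace PaperGIT
section F3
set_option linter.unusedSectionVars false
set_option linter.unusedVariables false

open MvPolynomial

variable {k : Type} [Field k] {ι : Type} [Fintype ι] [DecidableEq ι]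

lemma ps_dvd_of_deriv [CharZero k] {f : PowerSeries k} {n : ℕ}
    (h0 : PowerSeries.constantCoeff f = 0)
    (h : (PowerSeries.X : PowerSeries k) ^ n ∣ PowerSeries.derivative k f) :
    (PowerSeries.X : PowerSeries k) ^ (n + 1) ∣ f := by
  rw [PowerSeries.X_pow_dvd_iff] at h ⊢
  intro m hm
  cases m with
  | zero => simpa using h0
  | succ m =>
    have h1 := h m (by omega)
    rw [PowerSeries.coeff_derivative] at h1
    rcases mul_eq_zero.1 h1 with h2 | h2
    · exact h2
    · exact absurd h2 (by exact_mod_cast Nat.succ_ne_zero m)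

lemma ps_eq_zero_of_dvd {f : PowerSeries k}
    (h : ∀ n, (PowerSeries.X : PowerSeries k) ^ n ∣ f) : f = 0 := by
  ext n
  have := PowerSeries.X_pow_dvd_iff.1 (h (n + 1)) n (Nat.lt_succ_self n)
  simpa using this

/-- Solutions of `u' = ξ u` with `ξ` in the Lie algebra and `u(0) ∈ Γ` stay in `Γ`. -/
lemma ode_mem [CharZero k] {Γ : Set (Matrix ι ι k)} (hΓ : IsSLGroup Γ)
    {u ξ : Matrix ι ι (PowerSeries k)} (hξ : ξ ∈ lie Γ (PowerSeries k))
    (hu : u.map (PowerSeries.derivative k) = ξ * u)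
    (h0 : u.map PowerSeries.constantCoeff ∈ Γ) : u ∈ pts Γ (PowerSeries k) := by
  obtain ⟨J, ζ, hζ, hsum⟩ := lie_span hξ
  have key : ∀ n : ℕ, ∀ f ∈ van Γ, (PowerSeries.X : PowerSeries k) ^ n ∣ evM u f := by
    intro n
    induction n with
    | zero => intro f _; simp
    | succ n ih =>
      intro f hf
      apply ps_dvd_of_deriv
      · let φ : PowerSeries k →ₐ[k] k :=
          { (PowerSeries.constantCoeff : PowerSeries k →+* k) with
            commutes' := by intro r; simp [PowerSeries.algebraMap_apply] }
        have := evM_map φ u f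
        have h2 : evM (u.map φ) f = 0 := hf _ h0
        rw [h2] at this
        exact this.symm
      · rw [evM_deriv]
        have h1 : ∑ p : ι × ι, (PowerSeries.derivative k) (u p.1 p.2) * evM u (pderiv p f) =
            ∑ j ∈ J, j * evM u (Dop (ζ j) f) := by
          simp only [evM_Dop, Finset.mul_sum]
          rw [Finset.sum_comm]
          apply Finset.sum_congr rfl
          intro p _
          have h2 : (PowerSeries.derivative k) (u p.1 p.2) = (ξ * u) p.1 p.2 := by
            rw [← hu]; rfl
          rw [h2, hsum, Finset.sum_mul, Matrix.sum_apply, Finset.sum_mul]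
          apply Finset.sum_congr rfl
          intro j _
          rw [Matrix.smul_mul, Matrix.smul_apply, smul_eq_mul, mul_assoc]
        rw [h1]
        apply Finset.dvd_sum
        intro j _
        exact Dvd.dvd.mul_left (ih _ (Dop_van hΓ (hζ j) hf)) _
  intro f hf
  exact ps_eq_zero_of_dvd fun n => key n f hf

/-- coefficients of the solution of `u' = ξ u`, `u(0) = 1` -/
noncomputable def odeSeq (ξ : ℕ → Matrix ι ι k) : ℕ → Matrix ι ι k
  | 0 => 1
  | n + 1 => ((n : k) + 1)⁻¹ • ∑ i : Fin (n + 1), ξ (n - i) * odeSeq ξ i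

lemma ode_exists [CharZero k] (ξ : Matrix ι ι (PowerSeries k)) :
    ∃ u : Matrix ι ι (PowerSeries k), u.map (PowerSeries.derivative k) = ξ * u ∧
      u.map PowerSeries.constantCoeff = 1 := by
  let a := odeSeq (fun n => ξ.map (PowerSeries.coeff n))
  refine ⟨Matrix.of fun i j => PowerSeries.mk fun n => a n i j, ?_, ?_⟩
  · ext i j n
    rw [Matrix.map_apply, Matrix.of_apply, PowerSeries.coeff_derivative, PowerSeries.coeff_mk]
    have h1 : a (n + 1) = ((n : k) + 1)⁻¹ • ∑ i : Fin (n + 1),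
      ξ.map (PowerSeries.coeff (n - i)) * a i := by
      simp only [a]; rw [odeSeq]
    have hne : (n : k) + 1 ≠ 0 := by exact_mod_cast Nat.succ_ne_zero n
    rw [h1, Matrix.smul_apply, smul_eq_mul, mul_comm, ← mul_assoc, mul_inv_cancel₀ hne, one_mul,
      Finset.sum_range (fun m => ξ.map (PowerSeries.coeff (n - m)) * a m) |>.symm]
    rw [Matrix.mul_apply, map_sum, Matrix.sum_apply]
    simp only [Matrix.mul_apply, PowerSeries.coeff_mul, PowerSeries.coeff_mk, Matrix.map_apply, Matrix.of_apply]
    rw [Finset.sum_comm]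
    apply Finset.sum_congr rfl
    intro l _
    rw [Finset.Nat.sum_antidiagonal_eq_sum_range_succ_mk, ← Finset.sum_range_reflect]
    apply Finset.sum_congr rfl
    intro m hm
    have : m ≤ n := by simpa [Nat.lt_succ_iff] using hm
    have h2 : n + 1 - 1 - m = n - m := by omega
    have h3 : n - (n - m) = m := by omega
    rw [h2, h3]
  · ext i j
    rw [Matrix.map_apply, Matrix.of_apply, ← PowerSeries.coeff_zero_eq_constantCoeff_apply, PowerSeries.coeff_mk]
    simp only [a]; rw [odeSeq]

lemma ode_unique [CharZero k] (ξ : Matrix ι ι (PowerSeries k)) (e : ι → PowerSeries k)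
    (he : ∀ i, PowerSeries.derivative k (e i) = (ξ.mulVec e) i)
    (h0 : ∀ i, PowerSeries.constantCoeff (e i) = 0) : e = 0 := by
  have key : ∀ n : ℕ, ∀ i, (PowerSeries.X : PowerSeries k) ^ n ∣ e i := by
    intro n
    induction n with
    | zero => intro i; simp
    | succ n ih =>
      intro i
      apply ps_dvd_of_deriv (h0 i)
      rw [he i]
      exact Finset.dvd_sum fun j _ => Dvd.dvd.mul_left (ih j) _
  ext1 i
  exact ps_eq_zero_of_dvd fun n => key n i

/-- polynomial version of `ode_mem` -/
lemma ode_mem_poly [CharZero k] {Γ : Set (Matrix ι ι k)} (hΓ : IsSLGroup Γ)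
    {u : Matrix ι ι (Polynomial k)} {ξ : Matrix ι ι k} (hξ : ξ ∈ lie Γ k)
    (hu : u.map Polynomial.derivative = ξ.map Polynomial.C * u)
    (h0 : u.map (Polynomial.eval 0) = 1) : u ∈ pts Γ (Polynomial k) := by
  let φ : Polynomial k →ₐ[k] PowerSeries k := Polynomial.coeToPowerSeries.algHom k
  have hφ : ∀ p, φ p = (p : PowerSeries k) := by
    intro p
    simp [φ, Polynomial.coeToPowerSeries.algHom_apply]
  have h1 : u.map φ ∈ pts Γ (PowerSeries k) := by
    apply ode_mem hΓ (lie_map (PowerSeries k) hξ)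
    · have h2 : (u.map φ).map (PowerSeries.derivative k) = (u.map Polynomial.derivative).map φ := by
        ext1 i j
        simp only [Matrix.map_apply, hφ, PowerSeries.derivative_coe]
      rw [h2, hu, Matrix.map_mul]
      congr 1
      ext1 i j
      exact φ.commutes (ξ i j)
    · have : (u.map φ).map PowerSeries.constantCoeff = u.map (Polynomial.eval 0) := by
        ext1 i j
        simp [hφ, Polynomial.coeff_zero_eq_eval_zero]
      rw [this, h0]
      exact hΓ.one_mem
  intro f hf
  have h2 := h1 f hf
  rw [evM_map, hφ] at h2
  exact_mod_cast h2

lemma pts_eval {Γ : Set (Matrix ι ι k)} (hΓ : IsSLGroup Γ) {u : Matrix ι ι (Polynomial k)}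
    (hu : u ∈ pts Γ (Polynomial k)) (s : k) : u.map (Polynomial.eval s) ∈ Γ := by
  apply hΓ.closed
  exact pts_map (Polynomial.aeval s) hu

/-- truncated exponential -/
noncomputable def expN (N : ℕ) (ξ : Matrix ι ι k) : Matrix ι ι k :=
  ∑ i ∈ Finset.range N, ((i.factorial : k)⁻¹) • ξ ^ i

/-- The polynomial one-parameter family `exp(Xξ)`. -/
noncomputable def expP (N : ℕ) (ξ : Matrix ι ι k) : Matrix ι ι (Polynomial k) :=
  ∑ i ∈ Finset.range N, (Polynomial.C ((i.factorial : k)⁻¹) * Polynomial.X ^ i) •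
    (ξ ^ i).map Polynomial.C

lemma expP_eval (N : ℕ) (ξ : Matrix ι ι k) (s : k) :
    (expP N ξ).map (Polynomial.eval s) = expN N (s • ξ) := by
  ext i j
  simp only [expP, expN, Matrix.map_apply, Matrix.sum_apply, Polynomial.eval_finsetSum,
    Matrix.smul_apply, smul_eq_mul, Polynomial.eval_mul, Polynomial.eval_C, Polynomial.eval_pow,
    Polynomial.eval_X, smul_pow]
  apply Finset.sum_congr rfl
  intro x _
  ring

lemma expP_mem [CharZero k] {Γ : Set (Matrix ι ι k)} (hΓ : IsSLGroup Γ) {ξ : Matrix ι ι k}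
    (hξ : ξ ∈ lie Γ k) {N : ℕ} (hN : ξ ^ N = 0) : expP N ξ ∈ pts Γ (Polynomial k) := by
  rcases Nat.eq_zero_or_pos N with h | h
  · subst h
    rw [pow_zero] at hN
    have : Subsingleton (Matrix ι ι k) := subsingleton_of_zero_eq_one hN.symm
    have hi : IsEmpty ι := by
      by_contra hne
      rw [not_isEmpty_iff] at hne
      obtain ⟨i⟩ := hne
      have := congrFun (congrFun hN i) i
      simp at this
    have : expP 0 ξ = 1 := Subsingleton.elim _ _
    rw [this]
    exact pts_one hΓ
  obtain ⟨M, rfl⟩ : ∃ M, N = M + 1 := ⟨N - 1, by omega⟩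
  apply ode_mem_poly hΓ hξ
  · have h1 : ξ.map Polynomial.C * expP (M + 1) ξ = ∑ i ∈ Finset.range M,
      (Polynomial.C ((i.factorial : k)⁻¹) * Polynomial.X ^ i) • (ξ ^ (i + 1)).map Polynomial.C := by
      rw [expP, Finset.sum_range_succ, mul_add, Finset.mul_sum]
      have : ξ.map Polynomial.C * (Polynomial.C ((M.factorial : k)⁻¹) * Polynomial.X ^ M) •
        (ξ ^ M).map Polynomial.C = 0 := by
        rw [Matrix.mul_smul, ← Matrix.map_mul, ← pow_succ', hN]
        simp
      rw [this, add_zero]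
      apply Finset.sum_congr rfl
      intro i _
      rw [Matrix.mul_smul, ← Matrix.map_mul, ← pow_succ']
    rw [h1]
    ext1 i j
    rw [Matrix.map_apply, expP, Matrix.sum_apply, Polynomial.derivative_sum, Finset.sum_range_succ',
      Matrix.sum_apply]
    simp only [Matrix.smul_apply, smul_eq_mul, Matrix.map_apply]
    rw [add_eq_left.2]
    · apply Finset.sum_congr rfl
      intro l _
      have hne : ((l : k) + 1) ≠ 0 := by exact_mod_cast Nat.succ_ne_zero l
      have hne2 : (l.factorial : k) ≠ 0 := by exact_mod_cast Nat.factorial_ne_zero l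
      have h3 : (((l + 1).factorial : k)⁻¹) * ((l : k) + 1) = ((l.factorial : k)⁻¹) := by
        rw [Nat.factorial_succ]; push_cast; field_simp
      simp only [Polynomial.derivative_mul, Polynomial.derivative_C, Polynomial.derivative_X_pow,
        mul_zero, add_zero, zero_mul, zero_add]
      rw [← h3]
      push_cast
      simp only [map_mul, map_add, map_natCast, map_one, Nat.add_sub_cancel]
      ring
    · simp
  · rw [expP_eval]
    simp [expN, Finset.sum_range_succ']

lemma expN_mem [CharZero k] {Γ : Set (Matrix ι ι k)} (hΓ : IsSLGroup Γ) {ξ : Matrix ι ι k}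
    (hξ : ξ ∈ lie Γ k) {N : ℕ} (hN : ξ ^ N = 0) (s : k) : expN N (s • ξ) ∈ Γ := by
  rw [← expP_eval]
  exact pts_eval hΓ (expP_mem hΓ hξ hN) s

/-- the leading coefficient of a curve in `Γ` through `1` is in the Lie algebra -/
lemma curve_lie [CharZero k] {Γ : Set (Matrix ι ι k)} (hΓ : IsSLGroup Γ)
    {u : Matrix ι ι (Polynomial k)} (hu : u ∈ pts Γ (Polynomial k)) {a : ℕ} {c : Matrix ι ι k}
    {M : Matrix ι ι (Polynomial k)}
    (h : u = 1 + (Polynomial.X : Polynomial k) ^ (a + 1) • (c.map Polynomial.C +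
      (Polynomial.X : Polynomial k) • M)) : c ∈ lie Γ k := by
  have h1 := lie_log hΓ (Polynomial.derivative' (R := k)) hu
  have h2 := lie_map_linear (Polynomial.lcoeff k a) h1
  have hdet := pts_isUnit hΓ hu
  have h3 : u⁻¹ = 1 - (Polynomial.X : Polynomial k) ^ (a + 1) • ((c.map Polynomial.C +
      (Polynomial.X : Polynomial k) • M) * u⁻¹) := by
    have : u * u⁻¹ = 1 := Matrix.mul_nonsing_inv _ hdet
    nth_rewrite 1 [h] at this
    rw [add_mul, one_mul, Matrix.smul_mul] at this
    rw [← this]; abel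
  have h4 : (u.map (Polynomial.derivative' (R := k)) * u⁻¹).map (Polynomial.lcoeff k a) =
      ((a : k) + 1) • c := by
    rw [h3]
    ext i j
    rw [Matrix.map_apply, mul_sub, mul_one, Matrix.sub_apply, map_sub, Matrix.mul_smul]
    simp only [Matrix.smul_apply, smul_eq_mul, Polynomial.lcoeff_apply]
    rw [Polynomial.coeff_X_pow_mul', if_neg (by omega), sub_zero, h]
    simp only [Matrix.map_apply, Matrix.add_apply, Matrix.smul_apply, smul_eq_mul]
    change (Polynomial.derivative _).coeff a = _
    rw [Polynomial.coeff_derivative, Polynomial.coeff_add, Polynomial.coeff_X_pow_mul',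
      if_pos le_rfl]
    simp only [le_refl, tsub_self, Polynomial.coeff_add, Polynomial.coeff_C_zero,
      Polynomial.coeff_X_mul_zero, add_zero]
    have : (1 : Matrix ι ι (Polynomial k)) i j = Polynomial.C ((1 : Matrix ι ι k) i j) := by
      simp only [Matrix.one_apply]; split_ifs <;> simp
    rw [this, Polynomial.coeff_C_succ]
    ring
  rw [h4] at h2
  have hne : ((a : k) + 1) ≠ 0 := by exact_mod_cast Nat.succ_ne_zero a
  have := Submodule.smul_mem _ ((a : k) + 1)⁻¹ h2
  rwa [smul_smul, inv_mul_cancel₀ hne, one_smul] at this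

/-- nondegeneracy of the trace form -/
def TraceNondeg (Γ : Set (Matrix ι ι k)) : Prop :=
  ∀ ξ ∈ lie Γ k, (∀ η ∈ lie Γ k, (ξ * η).trace = 0) → ξ = 0

/-- the projection onto the Lie algebra determined by a dual pair of bases -/
noncomputable def proj {n : ℕ} (b b' : Fin n → Matrix ι ι k) (R : Type) [CommRing R] [Algebra k R] :
    Matrix ι ι R →ₗ[R] Matrix ι ι R where
  toFun M := ∑ i, (M * (b' i).map (algebraMap k R)).trace • (b i).map (algebraMap k R)
  map_add' := by intro x y; simp [add_mul, add_smul, Finset.sum_add_distrib]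
  map_smul' := by intro c x; simp [Finset.smul_sum, smul_smul]

lemma proj_apply {n : ℕ} (b b' : Fin n → Matrix ι ι k) (R : Type) [CommRing R] [Algebra k R]
    (M : Matrix ι ι R) : proj b b' R M =
      ∑ i, (M * (b' i).map (algebraMap k R)).trace • (b i).map (algebraMap k R) := rfl

/-- a dual pair of bases of the Lie algebra -/
structure DualPair (Γ : Set (Matrix ι ι k)) {n : ℕ} (b b' : Fin n → Matrix ι ι k) : Prop where
  mem : ∀ i, b i ∈ lie Γ k
  mem' : ∀ i, b' i ∈ lie Γ k
  span : ∀ ξ ∈ lie Γ k, ξ = ∑ i, (ξ * b' i).trace • b i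
  span' : ∀ ξ ∈ lie Γ k, ξ = ∑ i, (ξ * b i).trace • b' i

lemma exists_dualPair {Γ : Set (Matrix ι ι k)} (hN : TraceNondeg Γ) :
    ∃ (n : ℕ) (b b' : Fin n → Matrix ι ι k), DualPair Γ b b' := by
  let L := lie Γ k
  let B : LinearMap.BilinForm k L := LinearMap.mk₂ k (fun x y => ((x : Matrix ι ι k) * y).trace)
    (by intro x y z; simp [add_mul]) (by intro c x y; simp) (by intro x y z; simp [mul_add])
    (by intro c x y; simp)
  have hB : B.Nondegenerate := by
    have hs : B.IsSymm := ⟨fun x y => by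
      simp only [B, LinearMap.mk₂_apply]; exact Matrix.trace_mul_comm _ _⟩
    refine ⟨?_, ?_⟩
    · intro x hx
      exact Subtype.ext (hN x x.2 fun η hη => hx ⟨η, hη⟩)
    · intro x hx
      refine Subtype.ext (hN x x.2 fun η hη => ?_)
      rw [Matrix.trace_mul_comm]
      exact hx ⟨η, hη⟩
  let e := Module.finBasis k L
  let e' := LinearMap.BilinForm.dualBasis B hB e
  have hl : ∀ i j, B (e' i) (e j) = if j = i then 1 else 0 := fun i j =>
    LinearMap.BilinForm.apply_dualBasis_left hB e i j
  refine ⟨_, fun i => (e i : Matrix ι ι k), fun i => (e' i : Matrix ι ι k),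
    fun i => (e i).2, fun i => (e' i).2, ?_, ?_⟩
  · intro ξ hξ
    have h1 : ∀ i, (ξ * (e' i : Matrix ι ι k)).trace = e.repr ⟨ξ, hξ⟩ i := by
      intro i
      have h2 : B (e' i) ⟨ξ, hξ⟩ = e.repr ⟨ξ, hξ⟩ i := by
        conv_lhs => rw [← e.sum_repr ⟨ξ, hξ⟩]
        rw [map_sum]
        simp only [map_smul, smul_eq_mul, hl]
        simp
      rw [← h2, Matrix.trace_mul_comm]
      rfl
    simp only [h1]
    have h3 := congrArg (Submodule.subtype _) (e.sum_repr ⟨ξ, hξ⟩)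
    rw [map_sum] at h3
    exact h3.symm
  · intro ξ hξ
    have h1 : ∀ i, (ξ * (e i : Matrix ι ι k)).trace = e'.repr ⟨ξ, hξ⟩ i := by
      intro i
      have h2 : B ⟨ξ, hξ⟩ (e i) = e'.repr ⟨ξ, hξ⟩ i := by
        conv_lhs => rw [← e'.sum_repr ⟨ξ, hξ⟩]
        rw [map_sum, LinearMap.sum_apply]
        simp only [map_smul, smul_eq_mul, LinearMap.smul_apply, hl]
        simp
      rw [← h2]
      rfl
    simp only [h1]
    have h3 := congrArg (Submodule.subtype _) (e'.sum_repr ⟨ξ, hξ⟩)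
    rw [map_sum] at h3
    exact h3.symm

section projprops
variable {Γ : Set (Matrix ι ι k)} {n : ℕ} {b b' : Fin n → Matrix ι ι k} {R : Type} [CommRing R]
  [Algebra k R]

lemma proj_mem (hd : DualPair Γ b b') (M : Matrix ι ι R) : proj b b' R M ∈ lie Γ R := by
  rw [proj_apply]
  exact Submodule.sum_mem _ fun i _ => Submodule.smul_mem _ _ (lie_map R (hd.mem i))

lemma trace_map_alg (M : Matrix ι ι k) :
    (M.map (algebraMap k R)).trace = algebraMap k R M.trace := by
  simp [Matrix.trace]

lemma proj_of_mem (hd : DualPair Γ b b') {M : Matrix ι ι R} (hM : M ∈ lie Γ R) :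
    proj b b' R M = M := by
  obtain ⟨J, ζ, hζ, rfl⟩ := lie_span hM
  rw [map_sum]
  apply Finset.sum_congr rfl
  intro j _
  rw [map_smul]
  congr 1
  rw [proj_apply]
  conv_rhs => rw [hd.span (ζ j) (hζ j)]
  ext i l
  simp only [Matrix.sum_apply, Matrix.map_apply, map_sum, Matrix.smul_apply, smul_eq_mul, map_mul]
  apply Finset.sum_congr rfl
  intro x _
  rw [← Matrix.map_mul, trace_map_alg]

lemma DualPair.symm (hd : DualPair Γ b b') : DualPair Γ b' b :=
  ⟨hd.mem', hd.mem, hd.span', hd.span⟩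

lemma trace_proj (hd : DualPair Γ b b') (M : Matrix ι ι R) {ξ : Matrix ι ι R} (hξ : ξ ∈ lie Γ R) :
    (proj b b' R M * ξ).trace = (M * ξ).trace := by
  have h1 : ξ = ∑ i, (ξ * (b i).map (algebraMap k R)).trace •
      (b' i).map (algebraMap k R) := by
    have := proj_of_mem hd.symm hξ
    rw [proj_apply] at this
    exact this.symm
  conv_rhs => rw [h1]
  rw [proj_apply, Finset.sum_mul, Matrix.trace_sum, Finset.mul_sum, Matrix.trace_sum]
  apply Finset.sum_congr rfl
  intro i _
  rw [Matrix.smul_mul, Matrix.trace_smul, Matrix.mul_smul, Matrix.trace_smul, smul_eq_mul,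
    smul_eq_mul, Matrix.trace_mul_comm _ ξ, mul_comm]

lemma proj_conj (hΓ : IsSLGroup Γ) (hd : DualPair Γ b b') {g : Matrix ι ι R} (hg : g ∈ pts Γ R)
    (M : Matrix ι ι R) : g * proj b b' R M * g⁻¹ = proj b b' R (g * M * g⁻¹) := by
  have h1 : g * proj b b' R M * g⁻¹ ∈ lie Γ R := lie_conj hΓ hg (proj_mem hd M)
  rw [← proj_of_mem hd h1, proj_apply, proj_apply]
  apply Finset.sum_congr rfl
  intro i _
  congr 1
  have h2 : ∀ N : Matrix ι ι R, (g * N * g⁻¹ * (b' i).map (algebraMap k R)).trace =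
      (N * (g⁻¹ * (b' i).map (algebraMap k R) * g)).trace := by
    intro N
    rw [mul_assoc, mul_assoc, Matrix.trace_mul_comm]
    simp only [mul_assoc]
  rw [h2, h2]
  exact trace_proj hd M (lie_conj' hΓ hg (lie_map R (hd.mem' i)))

end projprops

end F3
end PaperGIT

namespace PaperGIT
section F4
set_option linter.unusedSectionVars false
set_option linter.unusedVariables false
open MvPolynomial
variable {k : Type} [Field k] {ι : Type} [Fintype ι] [DecidableEq ι]

lemma crt_poly {J : Type} [Finite J] (c : J → k) (hc : Function.Injective c) (φ : J → k) (N : ℕ) :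
    ∃ q : Polynomial k, ∀ j, (Polynomial.X - Polynomial.C (c j)) ^ N ∣ q - Polynomial.C (φ j) := by
  have := Ideal.exists_forall_sub_mem_ideal
    (I := fun j => Ideal.span {(Polynomial.X - Polynomial.C (c j)) ^ N}) ?_
    (fun j => Polynomial.C (φ j))
  · obtain ⟨q, hq⟩ := this
    exact ⟨q, fun j => Ideal.mem_span_singleton.1 (hq j)⟩
  · intro i j hij
    rw [Function.onFun, Ideal.isCoprime_span_singleton_iff]
    apply IsCoprime.pow
    apply Polynomial.isCoprime_X_sub_C_of_isUnit_sub
    exact (sub_ne_zero.2 fun h => hij (hc h)).isUnit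

lemma aeval_dvd_apply {A : Type} [AddCommGroup A] [Module k A] (D : Module.End k A) {c φ : k}
    {N : ℕ} {q : Polynomial k}
    (hq : (Polynomial.X - Polynomial.C c) ^ N ∣ q - Polynomial.C φ) {x : A}
    (hx : ((D - algebraMap k (Module.End k A) c) ^ N) x = 0) : Polynomial.aeval D q x = φ • x := by
  obtain ⟨r, hr⟩ := hq
  have : q = r * (Polynomial.X - Polynomial.C c) ^ N + Polynomial.C φ := by
    rw [mul_comm, ← hr]; ring
  rw [this]
  simp only [map_add, map_mul, map_pow, map_sub, Polynomial.aeval_X, Polynomial.aeval_C,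
    LinearMap.add_apply, Module.End.mul_apply, hx, map_zero, zero_add]
  rfl

/-- joint (generalised) eigenspaces -/
def Wsub {A : Type} [AddCommGroup A] [Module k A] (D Φ : Module.End k A) (c φ : k) :
    Submodule k A := D.maxGenEigenspace c ⊓ LinearMap.ker (Φ - algebraMap k (Module.End k A) φ)

lemma mem_Wsub {A : Type} [AddCommGroup A] [Module k A] {D Φ : Module.End k A} {c φ : k} {x : A} :
    x ∈ Wsub D Φ c φ ↔ (∃ n : ℕ, ((D - algebraMap k (Module.End k A) c) ^ n) x = 0) ∧
      Φ x = φ • x := by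
  rw [Wsub, Submodule.mem_inf, Module.End.mem_maxGenEigenspace, LinearMap.mem_ker,
    LinearMap.sub_apply, sub_eq_zero]
  simp only [Algebra.algebraMap_eq_smul_one]
  rfl

lemma pow_kill {A : Type} [AddCommGroup A] [Module k A] {E : Module.End k A} {n N : ℕ} (h : n ≤ N)
    {x : A} (hx : (E ^ n) x = 0) : (E ^ N) x = 0 := by
  obtain ⟨m, rfl⟩ := Nat.exists_eq_add_of_le' h
  rw [pow_add, Module.End.mul_apply, hx, map_zero]

lemma R_core {J : Type} {A : Type} [AddCommGroup A] [Module k A] (D Φ : Module.End k A)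
    (c : J → k) (hc : Function.Injective c) (φ : J → k) (I : Submodule k A)
    (hI : ∀ x ∈ I, D x ∈ I) {f : A} (hf : f ∈ ⨆ j, Wsub D Φ (c j) (φ j)) (hfI : f ∈ I) :
    Φ f ∈ I := by
  classical
  rw [Submodule.mem_iSup_iff_exists_finsupp] at hf
  obtain ⟨x, hx, rfl⟩ := hf
  choose n hn using fun j => (mem_Wsub.1 (hx j)).1
  let N := x.support.sup n
  obtain ⟨q, hq⟩ := crt_poly (J := x.support) (fun j => c j)
    (fun a b h => Subtype.ext (hc h)) (fun j => φ j) N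
  have h1 : Polynomial.aeval D q (x.sum fun _ xi => xi) = Φ (x.sum fun _ xi => xi) := by
    rw [Finsupp.sum, map_sum, map_sum]
    apply Finset.sum_congr rfl
    intro j hj
    rw [(mem_Wsub.1 (hx j)).2]
    exact aeval_dvd_apply D (hq ⟨j, hj⟩) (pow_kill (Finset.le_sup hj) (hn j))
  rw [← h1]
  have h2 : ∀ q : Polynomial k, ∀ y ∈ I, Polynomial.aeval D q y ∈ I := by
    intro q y hy
    induction q using Polynomial.induction_on with
    | C a => 
      rw [Polynomial.aeval_C]
      exact I.smul_mem a hy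
    | add p r hp hr => rw [map_add]; exact I.add_mem hp hr
    | monomial n a ih =>
      rw [pow_succ', ← mul_assoc, mul_comm _ Polynomial.X, mul_assoc, map_mul, Polynomial.aeval_X]
      exact hI _ ih
  exact h2 q _ hfI

lemma deriv_gen_mul {A : Type} [CommRing A] [Algebra k A] (D : Derivation k A A) (a b : k) :
    ∀ (n m l : ℕ), m + l = n → ∀ x y : A,
      (((D : Module.End k A) - algebraMap k (Module.End k A) a) ^ m) x = 0 →
      (((D : Module.End k A) - algebraMap k (Module.End k A) b) ^ l) y = 0 →
      (((D : Module.End k A) - algebraMap k (Module.End k A) (a + b)) ^ n) (x * y) = 0 := by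
  intro n
  induction n with
  | zero =>
    intro m l h x y hx hy
    have : m = 0 := by omega
    subst this
    have hx' : x = 0 := hx
    simp [hx']
  | succ n ih =>
    intro m l h x y hx hy
    rcases m with _ | m
    · have hx' : x = 0 := hx
      simp [hx']
    rcases l with _ | l
    · have hy' : y = 0 := hy
      simp [hy']
    have e1 : ((D : Module.End k A) - algebraMap k (Module.End k A) (a + b)) (x * y) =
      (((D : Module.End k A) - algebraMap k (Module.End k A) a) x) * y +
        x * (((D : Module.End k A) - algebraMap k (Module.End k A) b) y) := by
      simp only [LinearMap.sub_apply, Module.algebraMap_end_apply]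
      change D (x * y) - _ = (D x - _) * y + x * (D y - _)
      rw [Derivation.leibniz]
      simp only [smul_eq_mul, Algebra.smul_def, map_add]
      ring
    rw [pow_succ, Module.End.mul_apply, e1, map_add, ih m (l + 1) (by omega) _ _ _ hy,
      ih (m + 1) l (by omega) _ _ hx, add_zero]
    · rw [← Module.End.mul_apply, ← pow_succ]; exact hy
    · rw [← Module.End.mul_apply, ← pow_succ]; exact hx

/-- The span of the joint eigenspaces is everything once it contains the coordinates. -/
lemma Wsub_top {J : Type} [AddZeroClass J] {σ : Type} (D : Derivation k (MvPolynomial σ k) (MvPolynomial σ k))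
    (Φ : Module.End k (MvPolynomial σ k)) (c : J →+ k) (φ : J → k)
    (h1 : Φ 1 = φ 0 • 1)
    (hmul : ∀ a b x y, Φ x = φ a • x → Φ y = φ b • y → Φ (x * y) = φ (a + b) • (x * y))
    (hX : ∀ p, X p ∈ ⨆ j, Wsub (D : Module.End k (MvPolynomial σ k)) Φ (c j) (φ j))
    (f : MvPolynomial σ k) :
    f ∈ ⨆ j, Wsub (D : Module.End k (MvPolynomial σ k)) Φ (c j) (φ j) := by
  induction f using MvPolynomial.induction_on with
  | C a =>
    have : (C a : MvPolynomial σ k) = a • 1 := by rw [smul_eq_C_mul, mul_one]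
    rw [this]
    apply Submodule.smul_mem
    apply Submodule.mem_iSup_of_mem 0
    rw [mem_Wsub]
    refine ⟨⟨1, ?_⟩, h1⟩
    simp
  | add p q hp hq => exact Submodule.add_mem _ hp hq
  | mul_X p n hp =>
    refine Submodule.iSup_induction _ (motive := fun p => p * X n ∈
      ⨆ j, Wsub (D : Module.End k (MvPolynomial σ k)) Φ (c j) (φ j)) hp ?_ ?_ ?_
    · intro i x hx
      refine Submodule.iSup_induction _ (motive := fun y => x * y ∈
        ⨆ j, Wsub (D : Module.End k (MvPolynomial σ k)) Φ (c j) (φ j)) (hX n) ?_ ?_ ?_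
      · intro j y hy
        apply Submodule.mem_iSup_of_mem (i + j)
        rw [mem_Wsub] at hx hy ⊢
        obtain ⟨⟨m, hm⟩, hx2⟩ := hx
        obtain ⟨⟨l, hl⟩, hy2⟩ := hy
        refine ⟨⟨m + l, ?_⟩, hmul _ _ _ _ hx2 hy2⟩
        rw [map_add]
        exact deriv_gen_mul D _ _ _ m l rfl _ _ hm hl
      · simp
      · intro y z hy hz
        rw [mul_add]; exact Submodule.add_mem _ hy hz
    · simp
    · intro y z hy hz
      rw [add_mul]; exact Submodule.add_mem _ hy hz

/-- vanishing ideal as a submodule -/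
def vanS (Γ : Set (Matrix ι ι k)) : Submodule k (MvPolynomial (ι × ι) k) where
  carrier := van Γ
  zero_mem' := by intro γ _; simp
  add_mem' := by intro a b ha hb γ hγ; rw [map_add, ha γ hγ, hb γ hγ, add_zero]
  smul_mem' := by intro c a ha γ hγ; rw [map_smul, ha γ hγ, smul_zero]

/-- linear forms in the `j`th column -/
noncomputable def colF (j : ι) : (ι → k) →ₗ[k] MvPolynomial (ι × ι) k where
  toFun v := ∑ i, v i • X (i, j)
  map_add' := by intro v w; simp [add_smul, Finset.sum_add_distrib]
  map_smul' := by intro c v; simp [Finset.smul_sum, smul_smul]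

lemma Dop_X (ξ : Matrix ι ι k) (i j : ι) : Dop ξ (X (i, j)) = ∑ l, ξ i l • X (l, j) := by
  rw [Dop_eq, Finset.sum_eq_single (i, j)]
  · rw [pderiv_X_self, mul_one, Matrix.mul_apply]
    simp [genM, smul_eq_C_mul]
  · intro p _ hp
    rw [pderiv_X_of_ne hp.symm, mul_zero]
  · simp

/-- the transposed endomorphism -/
noncomputable def trT (ξ : Matrix ι ι k) : Module.End k (ι → k) :=
  Matrix.toLinAlgEquiv' ξ.transpose

lemma trT_apply (ξ : Matrix ι ι k) (v : ι → k) (l : ι) : trT ξ v l = ∑ i, ξ i l * v i := by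
  simp [trT, Matrix.toLinAlgEquiv'_apply, Matrix.mulVec, dotProduct]

lemma trT_aeval (ξ : Matrix ι ι k) (q : Polynomial k) :
    trT (Polynomial.aeval ξ q) = Polynomial.aeval (trT ξ) q := by
  have h1 : (Polynomial.aeval ξ q).transpose = Polynomial.aeval ξ.transpose q := by
    induction q using Polynomial.induction_on' with
    | add p r hp hr => simp [hp, hr]
    | monomial n a =>
      simp [Polynomial.aeval_monomial, Matrix.transpose_pow, Algebra.algebraMap_eq_smul_one]
  rw [trT, h1, trT]
  exact (Polynomial.aeval_algHom_apply (Matrix.toLinAlgEquiv' (R := k) (n := ι)).toAlgHom _ _).symm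

lemma Dop_colF (ξ : Matrix ι ι k) (j : ι) (v : ι → k) :
    Dop ξ (colF j v) = colF j (trT ξ v) := by
  change Dop ξ (∑ i, v i • X (i, j)) = ∑ l, (trT ξ v l) • X (l, j)
  simp only [map_sum, Derivation.map_smul, Dop_X, Finset.smul_sum, smul_smul, trT_apply, Finset.sum_smul]
  rw [Finset.sum_comm]
  apply Finset.sum_congr rfl
  intro x _
  apply Finset.sum_congr rfl
  intro y _
  rw [mul_comm]

lemma Dop_gen (ξ : Matrix ι ι k) (j : ι) (v : ι → k) (a : k) (n : ℕ) :
    ((((Dop ξ : Derivation k _ _) : Module.End k (MvPolynomial (ι × ι) k)) -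
      algebraMap k (Module.End k (MvPolynomial (ι × ι) k)) a) ^ n) (colF j v) =
    colF j (((trT ξ - algebraMap k (Module.End k (ι → k)) a) ^ n) v) := by
  induction n generalizing v with
  | zero => rfl
  | succ n ih =>
    rw [pow_succ, pow_succ, Module.End.mul_apply, Module.End.mul_apply, ← ih]
    congr 1
    rw [LinearMap.sub_apply, LinearMap.sub_apply, map_sub]
    congr 1
    · exact Dop_colF ξ j v
    · simp

lemma X_eq_colF (i j : ι) : (X (i, j) : MvPolynomial (ι × ι) k) = colF j (Pi.single i 1) := by
  simp [colF, Pi.single_apply]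

lemma replica_q (T : Module.End k (ι → k)) (φ : k → k) : ∃ q : Polynomial k,
      ∀ b, ∀ v ∈ T.maxGenEigenspace b, Polynomial.aeval T q v = φ b • v := by
  have hfin : Finite {b : k // T.HasEigenvalue b} := Module.End.finite_hasEigenvalue T
  obtain ⟨q, hq⟩ := crt_poly (J := {b : k // T.HasEigenvalue b}) (fun j => j.1)
    Subtype.val_injective (fun j => φ j.1) (Module.finrank k (ι → k))
  refine ⟨q, ?_⟩
  intro b v hv
  by_cases hb : T.HasEigenvalue b
  · refine aeval_dvd_apply T (hq ⟨b, hb⟩) ?_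
    rw [Module.End.maxGenEigenspace_eq_genEigenspace_finrank, Module.End.mem_genEigenspace_nat] at hv
    rw [Algebra.algebraMap_eq_smul_one]
    exact hv
  · have : T.maxGenEigenspace b = ⊥ := by
      by_contra hne
      apply hb
      rw [Module.End.maxGenEigenspace_eq_genEigenspace_finrank] at hne
      exact Module.End.hasEigenvalue_of_hasGenEigenvalue hne
    rw [this, Submodule.mem_bot] at hv
    rw [hv, map_zero, smul_zero]

/-- endomorphism underlying `Dop` -/
noncomputable def DopE (ξ : Matrix ι ι k) : Module.End k (MvPolynomial (ι × ι) k) :=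
  ((Dop ξ : Derivation k _ _) : Module.End k (MvPolynomial (ι × ι) k))

lemma DopE_apply (ξ : Matrix ι ι k) (f : MvPolynomial (ι × ι) k) : DopE ξ f = Dop ξ f := rfl

lemma replica_X [IsAlgClosed k] {ξ η : Matrix ι ι k} (φ : k → k)
    (h : ∀ b, ∀ v ∈ (trT ξ).maxGenEigenspace b, trT η v = φ b • v) (i j : ι) :
    X (i, j) ∈ ⨆ b, Wsub (DopE ξ) (DopE η) b (φ b) := by
  rw [X_eq_colF]
  have h1 : (Pi.single i 1 : ι → k) ∈ ⨆ b, (trT ξ).maxGenEigenspace b := by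
    rw [Module.End.iSup_maxGenEigenspace_eq_top]; trivial
  refine Submodule.iSup_induction _ (motive := fun v => colF j v ∈
      ⨆ b, Wsub (DopE ξ) (DopE η) b (φ b)) h1 ?_ ?_ ?_
  · intro b v hv
    apply Submodule.mem_iSup_of_mem b
    rw [mem_Wsub]
    constructor
    · obtain ⟨n, hn⟩ := (Module.End.mem_maxGenEigenspace _ _ _).1 hv
      refine ⟨n, ?_⟩
      have := Dop_gen ξ j v b n
      rw [← Algebra.algebraMap_eq_smul_one] at hn
      rw [hn, map_zero] at this
      exact this
    · rw [DopE_apply, Dop_colF, h b v hv, map_smul]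
  · rw [map_zero]; exact Submodule.zero_mem _
  · intro x y hx hy
    rw [map_add]; exact Submodule.add_mem _ hx hy

lemma replica_mem [IsAlgClosed k] {Γ : Set (Matrix ι ι k)} (hΓ : IsSLGroup Γ) {ξ η : Matrix ι ι k}
    (hξ : ξ ∈ lie Γ k) (φ : k →+ k)
    (h : ∀ b, ∀ v ∈ (trT ξ).maxGenEigenspace b, trT η v = φ b • v) : η ∈ lie Γ k := by
  apply lie_of_Dop hΓ
  intro f hf
  refine R_core (J := k) (DopE ξ) (DopE η) id Function.injective_id φ (vanS Γ)
    (fun x hx => Dop_van hΓ hξ hx) ?_ hf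
  refine Wsub_top (J := k) (Dop ξ) (DopE η) (AddMonoidHom.id k) φ ?_ ?_ ?_ f
  · rw [DopE_apply, Derivation.map_one_eq_zero, map_zero, zero_smul]
  · intro a b x y hx hy
    rw [DopE_apply] at hx hy ⊢
    rw [Derivation.leibniz, hx, hy, map_add, add_smul]
    simp only [smul_eq_mul, smul_eq_C_mul]
    ring
  · rintro ⟨i, j⟩
    exact replica_X φ h i j

/-- replicas -/
lemma replica [IsAlgClosed k] {Γ : Set (Matrix ι ι k)} (hΓ : IsSLGroup Γ) {ξ : Matrix ι ι k}
    (hξ : ξ ∈ lie Γ k) (φ : k →+ k) : ∃ q : Polynomial k, Polynomial.aeval ξ q ∈ lie Γ k ∧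
      ∀ b, ∀ v ∈ (trT ξ).maxGenEigenspace b,
        Polynomial.aeval (trT ξ) q v = φ b • v := by
  obtain ⟨q, hq⟩ := replica_q (trT ξ) φ
  refine ⟨q, ?_, hq⟩
  apply replica_mem hΓ hξ φ
  intro b v hv
  rw [trT_aeval, hq b v hv]

/-- a trace criterion for nilpotency -/
lemma nilp_of_trace [IsAlgClosed k] [CharZero k] {V : Type} [AddCommGroup V] [Module k V]
    [FiniteDimensional k V] (T : Module.End k V)
    (h : ∀ φ : k →+ k, ∀ S : Module.End k V, (∀ b, ∀ v ∈ T.maxGenEigenspace b, S v = φ b • v) →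
      (∃ q : Polynomial k, S = Polynomial.aeval T q) → LinearMap.trace k V (T * S) = 0)
    (hS : ∀ φ : k →+ k, ∃ q : Polynomial k,
      ∀ b, ∀ v ∈ T.maxGenEigenspace b, Polynomial.aeval T q v = φ b • v) :
    IsNilpotent T := by
  classical
  have hfin : {b : k | T.maxGenEigenspace b ≠ ⊥}.Finite := by
    refine (Module.End.finite_hasEigenvalue T).subset ?_
    intro b hb
    have hb' : T.maxGenEigenspace b ≠ ⊥ := hb
    rw [Module.End.maxGenEigenspace_eq_genEigenspace_finrank] at hb'
    exact Module.End.hasEigenvalue_of_hasGenEigenvalue hb'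
  have hInteg : DirectSum.IsInternal T.maxGenEigenspace := by
    rw [DirectSum.isInternal_submodule_iff_iSupIndep_and_iSup_eq_top]
    exact ⟨Module.End.independent_maxGenEigenspace T,
      Module.End.iSup_maxGenEigenspace_eq_top T⟩
  have key : ∀ f : k →ₗ[ℚ] ℚ, ∀ b, T.maxGenEigenspace b ≠ ⊥ → f b = 0 := by
    intro f
    let φ : k →+ k := (algebraMap ℚ k).toAddMonoidHom.comp f.toAddMonoidHom
    obtain ⟨q, hq⟩ := hS φ
    have h0 := h φ _ hq ⟨q, rfl⟩
    have hmt : ∀ b, Set.MapsTo (T * Polynomial.aeval T q) (T.maxGenEigenspace b)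
        (T.maxGenEigenspace b) := by
      intro b v hv
      change T (Polynomial.aeval T q v) ∈ T.maxGenEigenspace b
      rw [hq b v hv, map_smul]
      exact Submodule.smul_mem _ _ (Module.End.mapsTo_maxGenEigenspace_of_comm (Commute.refl T) b hv)
    rw [LinearMap.trace_eq_sum_trace_restrict' hInteg hfin hmt] at h0
    have h1 : ∀ b, LinearMap.trace k _ ((T * Polynomial.aeval T q).restrict (hmt b)) =
        (Module.finrank k (T.maxGenEigenspace b) : k) * b * φ b := by
      intro b
      have hT := Module.End.mapsTo_maxGenEigenspace_of_comm (Commute.refl T) b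
      have hnil := Module.End.isNilpotent_restrict_maxGenEigenspace_sub_algebraMap T b
      have h2 : (T * Polynomial.aeval T q).restrict (hmt b) =
          φ b • (T - algebraMap k (Module.End k V) b).restrict
            (Module.End.mapsTo_maxGenEigenspace_of_comm (Algebra.mul_sub_algebraMap_commutes T b) b) +
          (φ b * b) • (LinearMap.id : T.maxGenEigenspace b →ₗ[k] T.maxGenEigenspace b) := by
        ext ⟨v, hv⟩
        change T (Polynomial.aeval T q v) = φ b • (T v - algebraMap k (Module.End k V) b v) + (φ b * b) • v
        rw [hq b v hv, map_smul, Module.algebraMap_end_apply, smul_sub, smul_smul]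
        abel
      rw [h2, map_add, map_smul, (LinearMap.isNilpotent_trace_of_isNilpotent hnil).eq_zero, map_smul,
        LinearMap.trace_id]
      simp only [smul_eq_mul]; ring
    simp only [h1] at h0
    have h3 : ∑ b ∈ hfin.toFinset, (Module.finrank k (T.maxGenEigenspace b) : ℚ) * (f b) ^ 2 = 0 := by
      have h4 := congrArg f h0
      rw [map_sum, map_zero] at h4
      rw [← h4]
      apply Finset.sum_congr rfl
      intro b _
      have : (Module.finrank k (T.maxGenEigenspace b) : k) * b * φ b =
        ((Module.finrank k (T.maxGenEigenspace b) : ℚ) * f b) • b := by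
        rw [Algebra.smul_def, map_mul]
        simp only [map_natCast]
        change _ * b * algebraMap ℚ k (f b) = _
        ring
      rw [this, map_smul, smul_eq_mul]
      ring
    intro b hb
    have h5 := (Finset.sum_eq_zero_iff_of_nonneg (fun b _ => by positivity)).1 h3 b (by simpa using hb)
    have h6 : (Module.finrank k (T.maxGenEigenspace b) : ℚ) ≠ 0 := by
      rw [Nat.cast_ne_zero]
      rw [Ne, Submodule.finrank_eq_zero]
      exact hb
    have h7 := (mul_eq_zero.1 h5).resolve_left h6
    exact pow_eq_zero_iff two_ne_zero |>.1 h7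
  have hz : ∀ b, b ≠ 0 → T.maxGenEigenspace b = ⊥ := by
    intro b hb
    by_contra hne
    exact hb ((Module.forall_dual_apply_eq_zero_iff ℚ b).1 fun f => key f b hne)
  have htop : T.maxGenEigenspace 0 = ⊤ := by
    rw [← Module.End.iSup_maxGenEigenspace_eq_top T]
    apply le_antisymm (le_iSup T.maxGenEigenspace 0)
    apply iSup_le
    intro b
    by_cases hb : b = 0
    · rw [hb]
    · rw [hz b hb]; exact bot_le
  refine ⟨Module.finrank k V, ?_⟩
  ext v
  have : v ∈ T.maxGenEigenspace 0 := by rw [htop]; trivial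
  rw [Module.End.maxGenEigenspace_eq_genEigenspace_finrank, Module.End.mem_genEigenspace_nat] at this
  simpa using this

end F4
end PaperGIT

namespace PaperGIT
section F5
set_option linter.unusedSectionVars false
set_option linter.unusedVariables false
open MvPolynomial
variable {k : Type} [Field k] {ι : Type} [Fintype ι] [DecidableEq ι]

lemma evM_colF {R : Type} [CommRing R] [Algebra k R] (g : Matrix ι ι R) (j : ι) (v : ι → k) :
    evM g (colF j v) = ∑ i, v i • g i j := by
  change evM g (∑ i, v i • X (i, j)) = _
  simp [evM]

/-- left translation by a constant matrix -/
noncomputable def trans (T : Matrix ι ι k) : MvPolynomial (ι × ι) k →ₐ[k] MvPolynomial (ι × ι) k :=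
  evM (T.map (C : k → MvPolynomial (ι × ι) k) * genM k ι)

lemma evM_trans (T g : Matrix ι ι k) (f : MvPolynomial (ι × ι) k) :
    evM g (trans T f) = evM (T * g) f := by
  rw [trans, evM_comp]
  congr 2
  ext i j
  simp [Matrix.mul_apply, genM, evM]

lemma trans_colF (T : Matrix ι ι k) (j : ι) (v : ι → k) :
    trans T (colF j v) = colF j (trT T v) := by
  rw [trans, evM_colF]
  change _ = ∑ l, (trT T v l) • X (l, j)
  simp only [trT_apply, Matrix.mul_apply, genM, Matrix.map_apply, Finset.smul_sum, Finset.sum_smul,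
    Matrix.of_apply]
  rw [Finset.sum_comm]
  apply Finset.sum_congr rfl
  intro x _
  apply Finset.sum_congr rfl
  intro y _
  simp only [smul_eq_C_mul, map_mul]
  ring

lemma trT_row {c c' : Matrix ι ι k} (hc : c * c' = 1) (e : ι → k) (i : ι) :
    trT (c' * Matrix.diagonal e * c) (c i) = e i • c i := by
  ext l
  rw [trT_apply]
  have : ∑ x, (c' * Matrix.diagonal e * c) x l * c i x =
      (c * (c' * Matrix.diagonal e * c)) i l := by
    rw [Matrix.mul_apply]
    exact Finset.sum_congr rfl fun x _ => mul_comm _ _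
  rw [this, ← mul_assoc, ← mul_assoc, hc, one_mul, Matrix.diagonal_mul]
  rfl

/-- **Torus lemma** -/
lemma torus_mem [CharZero k] {Γ : Set (Matrix ι ι k)} (hΓ : IsSLGroup Γ) {c c' : Matrix ι ι k}
    (hc : c * c' = 1) (d : ι → ℤ)
    (h : c' * Matrix.diagonal (fun i => (d i : k)) * c ∈ lie Γ k) {t : k} (ht : t ≠ 0) :
    c' * Matrix.diagonal (fun i => t ^ d i) * c ∈ Γ := by
  have hc' : c' * c = 1 := mul_eq_one_comm.1 hc
  set ξ := c' * Matrix.diagonal (fun i => (d i : k)) * c with hξ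
  set T := c' * Matrix.diagonal (fun i => t ^ d i) * c with hT
  apply hΓ.closed
  intro f hf
  have h1 : (trans T).toLinearMap f ∈ vanS Γ := by
    refine R_core (J := ℤ) (DopE ξ) (trans T).toLinearMap (fun j : ℤ => (j : k)) Int.cast_injective
      (fun j => t ^ j) (vanS Γ) (fun x hx => Dop_van hΓ h hx) ?_ hf
    refine Wsub_top (J := ℤ) (Dop ξ) (trans T).toLinearMap (Int.castAddHom k) (fun j => t ^ j)
      ?_ ?_ ?_ f
    · simp
    · intro a b x y hx hy
      rw [AlgHom.toLinearMap_apply] at hx hy ⊢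
      rw [map_mul, hx, hy, zpow_add₀ ht]
      simp only [smul_eq_C_mul, map_mul]
      ring
    · rintro ⟨i, j⟩
      rw [X_eq_colF]
      have h2 : (Pi.single i 1 : ι → k) = ∑ l, c' i l • c l := by
        ext m
        rw [Finset.sum_apply]
        have : (c' * c) i m = (1 : Matrix ι ι k) i m := by rw [hc']
        rw [Matrix.mul_apply, Matrix.one_apply] at this
        rw [Pi.single_apply]
        simp only [Pi.smul_apply, smul_eq_mul, this, eq_comm]
      rw [h2, map_sum]
      apply Submodule.sum_mem
      intro l _
      rw [map_smul]
      apply Submodule.smul_mem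
      apply Submodule.mem_iSup_of_mem (d l)
      rw [mem_Wsub]
      constructor
      · refine ⟨1, ?_⟩
        have := Dop_gen ξ j (c l) (d l : k) 1
        have h4 : ((trT ξ - algebraMap k (Module.End k (ι → k)) (d l : k)) ^ 1) (c l) = 0 := by
          rw [pow_one, LinearMap.sub_apply, hξ, trT_row hc, Module.algebraMap_end_apply, sub_self]
        rw [h4, map_zero] at this
        exact this
      · rw [AlgHom.toLinearMap_apply, trans_colF, hT, trT_row hc, map_smul]
  have h3 := h1 1 hΓ.one_mem
  rw [AlgHom.toLinearMap_apply, evM_trans, mul_one] at h3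
  exact h3

end F5
end PaperGIT

namespace PaperGIT
section F6
set_option linter.unusedSectionVars false
set_option linter.unusedVariables false
open MvPolynomial
variable {k : Type} [Field k] {ι : Type} [Fintype ι] [DecidableEq ι]

/-- abelian form of no unipotent radical -/
def NoUnip (Γ : Set (Matrix ι ι k)) : Prop :=
  ∀ z : Submodule k (Matrix ι ι k), z ≤ lie Γ k → (∀ ξ ∈ z, ∀ η ∈ z, ξ * η = η * ξ) →
    (∀ ξ ∈ z, IsNilpotent ξ) → (∀ g ∈ Γ, ∀ ξ ∈ z, g * ξ * g⁻¹ ∈ z) → z = ⊥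

lemma mem_one_lie {Γ : Set (Matrix ι ι k)} {g : Matrix ι ι k} (hg : g ∈ Γ) : g ∈ pts Γ k :=
  fun f hf => hf g hg

lemma slg_inv {Γ : Set (Matrix ι ι k)} (hΓ : IsSLGroup Γ) {g : Matrix ι ι k} (hg : g ∈ Γ) :
    g * g⁻¹ = 1 ∧ g⁻¹ * g = 1 := by
  have : IsUnit g.det := by rw [hΓ.det_one g hg]; exact isUnit_one
  exact ⟨Matrix.mul_nonsing_inv _ this, Matrix.nonsing_inv_mul _ this⟩

lemma trace_nilp [IsAlgClosed k] [CharZero k] {Γ : Set (Matrix ι ι k)} (hΓ : IsSLGroup Γ)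
    {ξ : Matrix ι ι k} (hξ : ξ ∈ lie Γ k) (h : ∀ η ∈ lie Γ k, (ξ * η).trace = 0) :
    IsNilpotent ξ := by
  have hn : IsNilpotent (trT ξ) := by
    apply nilp_of_trace
    · rintro φ S hS ⟨q, rfl⟩
      have h1 : Polynomial.aeval ξ q ∈ lie Γ k := by
        apply replica_mem hΓ hξ φ
        intro b v hv
        rw [trT_aeval, hS b v hv]
      have h2 : trT ξ * Polynomial.aeval (trT ξ) q = trT (ξ * Polynomial.aeval ξ q) := by
        have e1 : ξ * Polynomial.aeval ξ q = Polynomial.aeval ξ (Polynomial.X * q) := by simp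
        rw [e1, trT_aeval]; simp
      rw [h2]
      have h3 : LinearMap.trace k (ι → k) (trT (ξ * Polynomial.aeval ξ q)) =
        (ξ * Polynomial.aeval ξ q).transpose.trace := by
        rw [trT]
        exact Matrix.trace_toLin'_eq _
      rw [h3, Matrix.trace_transpose]
      exact h _ h1
    · intro φ
      exact replica_q (trT ξ) φ
  obtain ⟨n, hn⟩ := hn
  refine ⟨n, ?_⟩
  have h4 : trT (ξ ^ n) = 0 := by
    have := trT_aeval ξ (Polynomial.X ^ n)
    simp only [map_pow, Polynomial.aeval_X] at this
    rw [this, hn]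
  rw [trT, EmbeddingLike.map_eq_zero_iff] at h4
  rw [← Matrix.transpose_transpose (ξ ^ n), h4, Matrix.transpose_zero]

/-- **Lemma N** -/
lemma traceNondeg_of_noUnip [IsAlgClosed k] [CharZero k] {Γ : Set (Matrix ι ι k)}
    (hΓ : IsSLGroup Γ) (hN : NoUnip Γ) : TraceNondeg Γ := by
  letI iL : LieRing (Matrix ι ι k) := LieRing.ofAssociativeRing
  letI iA : LieAlgebra k (Matrix ι ι k) := LieAlgebra.ofAssociativeAlgebra
  let r : LieSubalgebra k (Matrix ι ι k) :=
    { carrier := {ξ | ξ ∈ lie Γ k ∧ ∀ η ∈ lie Γ k, (ξ * η).trace = 0}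
      zero_mem' := ⟨Submodule.zero_mem _, by simp⟩
      add_mem' := by
        rintro a b ⟨ha, ha'⟩ ⟨hb, hb'⟩
        refine ⟨Submodule.add_mem _ ha hb, fun η hη => ?_⟩
        rw [add_mul, Matrix.trace_add, ha' η hη, hb' η hη, add_zero]
      smul_mem' := by
        rintro c a ⟨ha, ha'⟩
        refine ⟨Submodule.smul_mem _ c ha, fun η hη => ?_⟩
        rw [Matrix.smul_mul, Matrix.trace_smul, ha' η hη, smul_zero]
      lie_mem' := by
        rintro a b ⟨ha, ha'⟩ ⟨hb, hb'⟩
        refine ⟨lie_bracket hΓ ha hb, fun η hη => ?_⟩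
        have h1 := ha' _ (lie_bracket hΓ hb hη)
        rw [Ring.lie_def, sub_mul, Matrix.trace_sub]
        rw [mul_sub, Matrix.trace_sub] at h1
        rw [← h1, mul_assoc, ← mul_assoc a η b, Matrix.trace_mul_comm (a * η) b, mul_assoc b a η] }
  have hr : ∀ ξ, ξ ∈ r ↔ ξ ∈ lie Γ k ∧ ∀ η ∈ lie Γ k, (ξ * η).trace = 0 := fun ξ => Iff.rfl
  have hAd : ∀ g ∈ Γ, ∀ ξ ∈ r, g * ξ * g⁻¹ ∈ r := by
    rintro g hg ξ ⟨h1, h2⟩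
    refine ⟨lie_conj hΓ (mem_one_lie hg) h1, fun η hη => ?_⟩
    have := h2 _ (lie_conj' hΓ (mem_one_lie hg) hη)
    rw [mul_assoc, mul_assoc, Matrix.trace_mul_comm, ← this]
    simp only [mul_assoc]
  have hAd' : ∀ g ∈ Γ, ∀ ξ ∈ r, g⁻¹ * ξ * g ∈ r := by
    rintro g hg ξ ⟨h1, h2⟩
    refine ⟨lie_conj' hΓ (mem_one_lie hg) h1, fun η hη => ?_⟩
    have := h2 _ (lie_conj hΓ (mem_one_lie hg) hη)
    rw [mul_assoc, mul_assoc, Matrix.trace_mul_comm, ← this]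
    simp only [mul_assoc]
  have hnil : ∀ ξ ∈ r, IsNilpotent ξ := fun ξ h => trace_nilp hΓ h.1 h.2
  have hnilp : LieRing.IsNilpotent r := by
    rw [LieAlgebra.isNilpotent_iff_forall (R := k)]
    intro x
    exact LieAlgebra.isNilpotent_ad_of_isNilpotent (hnil x x.2)
  let z : Submodule k (Matrix ι ι k) :=
    { carrier := {ξ | ξ ∈ r ∧ ∀ η ∈ r, ξ * η = η * ξ}
      zero_mem' := ⟨r.zero_mem, by simp⟩
      add_mem' := by
        rintro a b ⟨ha, ha'⟩ ⟨hb, hb'⟩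
        refine ⟨r.add_mem ha hb, fun η hη => ?_⟩
        rw [add_mul, mul_add, ha' η hη, hb' η hη]
      smul_mem' := by
        rintro c a ⟨ha, ha'⟩
        refine ⟨r.smul_mem c ha, fun η hη => ?_⟩
        rw [Matrix.smul_mul, Matrix.mul_smul, ha' η hη] }
  have hz : z = ⊥ := by
    apply hN
    · intro ξ h; exact h.1.1
    · intro ξ h η h'; exact h.2 η h'.1
    · intro ξ h; exact hnil ξ h.1
    · rintro g hg ξ ⟨h1, h2⟩
      refine ⟨hAd g hg ξ h1, fun η hη => ?_⟩
      obtain ⟨i1, i2⟩ := slg_inv hΓ hg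
      have h3 := h2 _ (hAd' g hg η hη)
      have h4 := congrArg (fun M => g * M * g⁻¹) h3
      have e1 : g * (ξ * (g⁻¹ * η * g)) * g⁻¹ = g * ξ * g⁻¹ * η := by
        rw [show g * (ξ * (g⁻¹ * η * g)) * g⁻¹ = g * ξ * g⁻¹ * η * (g * g⁻¹) by noncomm_ring, i1, mul_one]
      have e2 : g * (g⁻¹ * η * g * ξ) * g⁻¹ = η * (g * ξ * g⁻¹) := by
        rw [show g * (g⁻¹ * η * g * ξ) * g⁻¹ = (g * g⁻¹) * η * (g * ξ * g⁻¹) by noncomm_ring, i1, one_mul]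
      rw [e1, e2] at h4
      exact h4
  intro ξ h1 h2
  by_contra hne
  have : Nontrivial r := ⟨⟨⟨ξ, h1, h2⟩, 0, fun h => hne (congrArg Subtype.val h)⟩⟩
  obtain ⟨m, hm⟩ := @exists_ne _ (LieModule.nontrivial_max_triv_of_isNilpotent k r r) 0
  have h3 : (m.1 : Matrix ι ι k) ∈ z := by
    refine ⟨m.1.2, fun η hη => ?_⟩
    have := congrArg Subtype.val (m.2 ⟨η, hη⟩)
    have h5 : η * (m.1 : Matrix ι ι k) - (m.1 : Matrix ι ι k) * η = 0 := this
    exact (sub_eq_zero.1 h5).symm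
  rw [hz, Submodule.mem_bot] at h3
  exact hm (Subtype.ext (Subtype.ext h3))

end F6
end PaperGIT

namespace PaperGIT
section F7
set_option linter.unusedSectionVars false
set_option linter.unusedVariables false
open MvPolynomial
variable {k : Type} [Field k] {ι : Type} [Fintype ι] [DecidableEq ι]

/-- A diagonalised one-parameter subgroup of `Γ`. -/
structure PS (Γ : Set (Matrix ι ι k)) where
  c : Matrix ι ι k
  c' : Matrix ι ι k
  d : ι → ℤ
  hc : c * c' = 1
  mem : c' * Matrix.diagonal (fun i => (d i : k)) * c ∈ lie Γ k

namespace PS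
variable {Γ : Set (Matrix ι ι k)} (l : PS Γ)

lemma hc' : l.c' * l.c = 1 := mul_eq_one_comm.1 l.hc

/-- infinitesimal generator -/
noncomputable def h : Matrix ι ι k := l.c' * Matrix.diagonal (fun i => (l.d i : k)) * l.c

/-- matrix in the eigenbasis -/
def hat (M : Matrix ι ι k) : Matrix ι ι k := l.c * M * l.c'

def vhat (v : ι → k) : ι → k := l.c.mulVec v

/-- value at `t` -/
noncomputable def at' (t : k) : Matrix ι ι k := l.c' * Matrix.diagonal (fun i => t ^ l.d i) * l.c

/-- spectral projections -/
noncomputable def E (a : ℤ) : Matrix ι ι k :=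
  l.c' * Matrix.diagonal (fun i => if l.d i = a then 1 else 0) * l.c

lemma at_mem [CharZero k] (hΓ : IsSLGroup Γ) {t : k} (ht : t ≠ 0) : l.at' t ∈ Γ :=
  torus_mem hΓ l.hc l.d l.mem ht

/-- limit exists -/
def Lam (v : ι → k) : Prop := ∀ i, l.d i < 0 → l.vhat v i = 0

/-- parabolic condition -/
def InP (g : Matrix ι ι k) : Prop := ∀ i j, l.d i < l.d j → l.hat g i j = 0

/-- Levi condition -/
def InL (g : Matrix ι ι k) : Prop := ∀ i j, l.d i ≠ l.d j → l.hat g i j = 0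

lemma hat_conj (D : Matrix ι ι k) : l.hat (l.c' * D * l.c) = D := by
  rw [hat, show l.c * (l.c' * D * l.c) * l.c' = (l.c * l.c') * D * (l.c * l.c') by noncomm_ring,
    l.hc, one_mul, mul_one]

lemma hat_mul (M N : Matrix ι ι k) : l.hat (M * N) = l.hat M * l.hat N := by
  rw [hat, hat, hat, show l.c * M * l.c' * (l.c * N * l.c') = l.c * M * (l.c' * l.c) * N * l.c' by
    noncomm_ring, l.hc', mul_one]
  noncomm_ring

lemma hat_one : l.hat 1 = 1 := by rw [hat, mul_one, l.hc]

lemma hat_add (M N : Matrix ι ι k) : l.hat (M + N) = l.hat M + l.hat N := by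
  simp [hat, mul_add, add_mul]

lemma hat_sub (M N : Matrix ι ι k) : l.hat (M - N) = l.hat M - l.hat N := by
  simp [hat, mul_sub, sub_mul]

lemma hat_smul (a : k) (M : Matrix ι ι k) : l.hat (a • M) = a • l.hat M := by
  simp [hat]

lemma hat_pow (M : Matrix ι ι k) (n : ℕ) : l.hat (M ^ n) = l.hat M ^ n := by
  induction n with
  | zero => simp [hat_one]
  | succ n ih => rw [pow_succ, pow_succ, hat_mul, ih]

lemma unhat (M : Matrix ι ι k) : l.c' * l.hat M * l.c = M := by
  rw [hat, show l.c' * (l.c * M * l.c') * l.c = (l.c' * l.c) * M * (l.c' * l.c) by noncomm_ring,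
    l.hc', one_mul, mul_one]

lemma hat_inj {M N : Matrix ι ι k} (h : l.hat M = l.hat N) : M = N := by
  rw [← l.unhat M, h, l.unhat]

lemma unvhat (v : ι → k) : l.c'.mulVec (l.vhat v) = v := by
  rw [vhat, Matrix.mulVec_mulVec, l.hc', Matrix.one_mulVec]

lemma vhat_un (v : ι → k) : l.vhat (l.c'.mulVec v) = v := by
  rw [vhat, Matrix.mulVec_mulVec, l.hc, Matrix.one_mulVec]

lemma vhat_inj {v w : ι → k} (h : l.vhat v = l.vhat w) : v = w := by
  rw [← l.unvhat v, h, l.unvhat]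

lemma vhat_mulVec (M : Matrix ι ι k) (v : ι → k) : l.vhat (M.mulVec v) = (l.hat M).mulVec (l.vhat v) := by
  rw [vhat, vhat, hat, Matrix.mulVec_mulVec, Matrix.mulVec_mulVec, mul_assoc (l.c * M), l.hc', mul_one]

lemma hat_h : l.hat l.h = Matrix.diagonal (fun i => (l.d i : k)) := l.hat_conj _
lemma hat_at (t : k) : l.hat (l.at' t) = Matrix.diagonal (fun i => t ^ l.d i) := l.hat_conj _
lemma hat_E (a : ℤ) : l.hat (l.E a) = Matrix.diagonal (fun i => if l.d i = a then 1 else 0) :=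
  l.hat_conj _

/-- homogeneous of degree `a` -/
def Hm (a : ℤ) (M : Matrix ι ι k) : Prop := ∀ i j, l.d i - l.d j ≠ a → l.hat M i j = 0

/-- homogeneous component -/
noncomputable def comp (a : ℤ) (M : Matrix ι ι k) : Matrix ι ι k :=
  l.c' * (Matrix.of fun i j => if l.d i - l.d j = a then l.hat M i j else 0) * l.c

lemma hat_comp (a : ℤ) (M : Matrix ι ι k) (i j : ι) :
    l.hat (l.comp a M) i j = if l.d i - l.d j = a then l.hat M i j else 0 := by
  rw [comp, hat_conj]; rfl

lemma comp_Hm (a : ℤ) (M : Matrix ι ι k) : l.Hm a (l.comp a M) := by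
  intro i j h
  rw [hat_comp, if_neg h]

lemma eq_sum_comp (M : Matrix ι ι k) : M = ∑ a ∈ Finset.univ.image (fun p : ι × ι => l.d p.1 - l.d p.2),
    l.comp a M := by
  apply l.hat_inj
  have : l.hat (∑ a ∈ Finset.univ.image (fun p : ι × ι => l.d p.1 - l.d p.2), l.comp a M) =
    ∑ a ∈ Finset.univ.image (fun p : ι × ι => l.d p.1 - l.d p.2), l.hat (l.comp a M) := by
    simp [hat, Finset.mul_sum, Finset.sum_mul]
  rw [this]
  ext i j
  rw [Matrix.sum_apply]
  simp only [hat_comp]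
  rw [Finset.sum_ite_eq, if_pos]
  exact Finset.mem_image.2 ⟨(i, j), Finset.mem_univ _, rfl⟩

lemma comp_mem [CharZero k] (hΓ : IsSLGroup Γ) (a : ℤ) {ξ : Matrix ι ι k} (hξ : ξ ∈ lie Γ k) :
    l.comp a ξ ∈ lie Γ k := by
  let S := Finset.univ.image (fun p : ι × ι => l.d p.1 - l.d p.2)
  obtain ⟨q, hq⟩ := crt_poly (J := S) (fun j => ((j : ℤ) : k))
    (fun x y h => Subtype.ext (Int.cast_injective h)) (fun j => if (j : ℤ) = a then 1 else 0) 1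
  let A : Module.End k (Matrix ι ι k) := LinearMap.mulLeft k l.h - LinearMap.mulRight k l.h
  have hA : ∀ M i j, l.hat (A M) i j = ((l.d i - l.d j : ℤ) : k) * l.hat M i j := by
    intro M i j
    have : A M = l.h * M - M * l.h := rfl
    rw [this, hat_sub, hat_mul, hat_mul, hat_h, Matrix.sub_apply, Matrix.diagonal_mul,
      Matrix.mul_diagonal]
    push_cast; ring
  have hqA : ∀ (q : Polynomial k) M i j, l.hat (Polynomial.aeval A q M) i j =
      q.eval ((l.d i - l.d j : ℤ) : k) * l.hat M i j := by
    intro q M i j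
    induction q using Polynomial.induction_on with
    | C b => 
      rw [Polynomial.aeval_C, Polynomial.eval_C, Module.algebraMap_end_apply, hat_smul]; rfl
    | add p r hp hr =>
      rw [map_add, LinearMap.add_apply, hat_add, Matrix.add_apply, hp, hr, Polynomial.eval_add, add_mul]
    | monomial n b ih =>
      rw [pow_succ', ← mul_assoc, mul_comm _ Polynomial.X, mul_assoc, map_mul, Polynomial.aeval_X,
        Module.End.mul_apply, hA, ih]
      simp only [Polynomial.eval_mul, Polynomial.eval_X]
      ring
  have hst : ∀ q : Polynomial k, ∀ M ∈ lie Γ k, Polynomial.aeval A q M ∈ lie Γ k := by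
    intro q M hM
    induction q using Polynomial.induction_on with
    | C b =>
      rw [Polynomial.aeval_C, Module.algebraMap_end_apply]
      exact Submodule.smul_mem _ b hM
    | add p r hp hr => rw [map_add]; exact Submodule.add_mem _ hp hr
    | monomial n b ih =>
      rw [pow_succ', ← mul_assoc, mul_comm _ Polynomial.X, mul_assoc, map_mul, Polynomial.aeval_X]
      exact lie_bracket hΓ l.mem ih
  have : l.comp a ξ = Polynomial.aeval A q ξ := by
    apply l.hat_inj
    ext i j
    rw [hat_comp, hqA]
    have h1 := hq ⟨l.d i - l.d j, Finset.mem_image.2 ⟨(i, j), Finset.mem_univ _, rfl⟩⟩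
    rw [pow_one, Polynomial.dvd_iff_isRoot] at h1
    simp only [Polynomial.IsRoot, Polynomial.eval_sub, Polynomial.eval_C, sub_eq_zero] at h1
    rw [h1]
    split_ifs <;> simp
  rw [this]
  exact hst q ξ hξ

/-- opposite one-parameter subgroup -/
def neg : PS Γ where
  c := l.c
  c' := l.c'
  d := fun i => - l.d i
  hc := l.hc
  mem := by
    have := Submodule.neg_mem _ l.mem
    rw [← neg_mul, ← mul_neg] at this
    have e : Matrix.diagonal (fun i => ((- l.d i : ℤ) : k)) = - Matrix.diagonal (fun i => (l.d i : k)) := by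
      rw [Matrix.diagonal_neg]; congr 1; ext i; simp
    rw [e]; exact this

/-- components of vectors -/
def Ev (b : ℤ) : (ι → k) →ₗ[k] (ι → k) where
  toFun w := fun i => if l.d i = b then l.vhat w i else 0
  map_add' := by
    intro v w; ext i; simp only [vhat, Matrix.mulVec_add, Pi.add_apply]; split_ifs <;> simp
  map_smul' := by
    intro a w; ext i; simp only [vhat, Matrix.mulVec_smul, Pi.smul_apply, RingHom.id_apply]
    split_ifs <;> simp

lemma Ev_apply (b : ℤ) (w : ι → k) (i : ι) : l.Ev b w i = if l.d i = b then l.vhat w i else 0 := rfl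

lemma Ev_low {a : ℤ} {ξ : Matrix ι ι k} (hξ : l.Hm a ξ) {v : ι → k} (hv : l.Lam v) {b : ℤ} (hb : b < a) :
    l.Ev b (ξ.mulVec v) = 0 := by
  ext i
  rw [Ev_apply]
  split_ifs with h
  · rw [vhat_mulVec]
    apply Finset.sum_eq_zero
    intro j _
    change l.hat ξ i j * l.vhat v j = 0
    by_cases hj : l.d i - l.d j = a
    · rw [hv j (by omega), mul_zero]
    · rw [hξ i j hj, zero_mul]
  · rfl

/-- `z` is the limit of `v` -/
def IsLim (v z : ι → k) : Prop := l.Lam v ∧ ∀ i, l.vhat z i = if l.d i = 0 then l.vhat v i else 0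

lemma Ev_top {a : ℤ} {ξ : Matrix ι ι k} (hξ : l.Hm a ξ) {v z : ι → k} (hz : l.IsLim v z) :
    l.Ev a (ξ.mulVec v) = l.vhat (ξ.mulVec z) := by
  ext i
  rw [Ev_apply, vhat_mulVec, vhat_mulVec]
  change _ = ∑ j, l.hat ξ i j * l.vhat z j
  split_ifs with h
  · apply Finset.sum_congr rfl
    intro j _
    change l.hat ξ i j * l.vhat v j = l.hat ξ i j * l.vhat z j
    by_cases hj : l.d i - l.d j = a
    · rw [hz.2 j, if_pos (by omega)]
    · rw [hξ i j hj, zero_mul, zero_mul]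
  · symm
    apply Finset.sum_eq_zero
    intro j _
    by_cases hj : l.d i - l.d j = a
    · rw [hz.2 j, if_neg (by omega), mul_zero]
    · rw [hξ i j hj, zero_mul]

end PS

/-- **Triangular lemma** -/
lemma triangular {F V W J : Type} [Field F] [AddCommGroup V] [Module F V] [AddCommGroup W] [Module F W]
    [Fintype J] (E : ℤ → V →ₗ[F] W) (f : J → V) (a : J → ℤ)
    (hlow : ∀ i b, b < a i → E b (f i) = 0)
    (hind : LinearIndependent F (fun i => E (a i) (f i))) (α : J → F) (p : ℤ)
    (h : ∀ b ≤ p, E b (∑ i, α i • f i) = 0) : ∀ i, a i ≤ p → α i = 0 := by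
  classical
  by_contra hcon
  push_neg at hcon
  obtain ⟨i₀, hi₀, hne₀⟩ := hcon
  let S := Finset.univ.filter (fun i => a i ≤ p ∧ α i ≠ 0)
  have hS : S.Nonempty := ⟨i₀, by simp [S, hi₀, hne₀]⟩
  obtain ⟨i, hi, hmin⟩ := S.exists_min_image a hS
  simp only [S, Finset.mem_filter, Finset.mem_univ, true_and] at hi hmin
  have h1 := h (a i) hi.1
  rw [map_sum] at h1
  have h2 : ∑ j, (if a j = a i then α j else 0) • E (a j) (f j) = 0 := by
    rw [← h1]
    apply Finset.sum_congr rfl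
    intro j _
    rw [map_smul]
    split_ifs with hj
    · rw [hj]
    · rw [zero_smul]
      by_cases hj2 : a i < a j
      · rw [hlow j _ hj2, smul_zero]
      · have : α j = 0 := by
          by_contra hne
          have := hmin j ⟨by omega, hne⟩
          omega
        rw [this, zero_smul]
  have h3 := (Fintype.linearIndependent_iff.1 hind) _ h2 i
  rw [if_pos rfl] at h3
  exact hi.2 h3

lemma triangular_indep {F V W J : Type} [Field F] [AddCommGroup V] [Module F V] [AddCommGroup W]
    [Module F W] [Fintype J] (E : ℤ → V →ₗ[F] W) (f : J → V) (a : J → ℤ)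
    (hlow : ∀ i b, b < a i → E b (f i) = 0)
    (hind : LinearIndependent F (fun i => E (a i) (f i))) : LinearIndependent F f := by
  rw [Fintype.linearIndependent_iff]
  intro α h i
  exact triangular E f a hlow hind α (a i) (by intro b _; rw [h, map_zero]) i le_rfl

/-- the tangent space to the orbit -/
noncomputable def orb (Γ : Set (Matrix ι ι k)) (v : ι → k) : Submodule k (ι → k) :=
  (lie Γ k).map ((Matrix.mulVecBilin k k).flip v)

lemma mem_orb {Γ : Set (Matrix ι ι k)} {v w : ι → k} : w ∈ orb Γ v ↔ ∃ ξ ∈ lie Γ k, ξ.mulVec v = w := by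
  rw [orb, Submodule.mem_map]; rfl

lemma orb_span_hom [CharZero k] {Γ : Set (Matrix ι ι k)} (hΓ : IsSLGroup Γ) (l : PS Γ) (v : ι → k) :
    orb Γ v = Submodule.span k {w | ∃ a ξ, ξ ∈ lie Γ k ∧ l.Hm a ξ ∧ w = ξ.mulVec v} := by
  apply le_antisymm
  · intro w hw
    obtain ⟨ξ, hξ, rfl⟩ := mem_orb.1 hw
    rw [l.eq_sum_comp ξ, Matrix.sum_mulVec]
    apply Submodule.sum_mem
    intro a _
    exact Submodule.subset_span ⟨a, _, l.comp_mem hΓ a hξ, l.comp_Hm a ξ, rfl⟩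
  · rw [Submodule.span_le]
    rintro w ⟨a, ξ, hξ, -, rfl⟩
    exact mem_orb.2 ⟨ξ, hξ, rfl⟩

lemma exists_hom_basis [CharZero k] {Γ : Set (Matrix ι ι k)} (hΓ : IsSLGroup Γ) (l : PS Γ) (v : ι → k) :
    ∃ (ξ : Fin (Module.finrank k (orb Γ v)) → Matrix ι ι k)
      (a : Fin (Module.finrank k (orb Γ v)) → ℤ), (∀ i, ξ i ∈ lie Γ k) ∧ (∀ i, l.Hm (a i) (ξ i)) ∧
      LinearIndependent k (fun i => (ξ i).mulVec v) := by
  rw [orb_span_hom hΓ l v]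
  obtain ⟨f, hf, -, hli⟩ := Submodule.exists_fun_fin_finrank_span_eq k
    {w | ∃ a ξ, ξ ∈ lie Γ k ∧ l.Hm a ξ ∧ w = ξ.mulVec v}
  choose a ξ h1 h2 h3 using hf
  refine ⟨ξ, a, h1, h2, ?_⟩
  have : (fun i => (ξ i).mulVec v) = f := by ext1 i; exact (h3 i).symm
  rw [this]; exact hli

/-- homogeneous elements independent on the limit stay independent. -/
lemma lim_indep {Γ : Set (Matrix ι ι k)} (l : PS Γ) {v z : ι → k} (hz : l.IsLim v z)
    {J : Type} [Fintype J] (ξ : J → Matrix ι ι k) (a : J → ℤ) (ha : ∀ i, l.Hm (a i) (ξ i))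
    (hli : LinearIndependent k (fun i => (ξ i).mulVec z)) :
    (∀ i b, b < a i → l.Ev b ((ξ i).mulVec v) = 0) ∧
    LinearIndependent k (fun i => l.Ev (a i) ((ξ i).mulVec v)) ∧
    LinearIndependent k (fun i => (ξ i).mulVec v) := by
  have h1 : ∀ i b, b < a i → l.Ev b ((ξ i).mulVec v) = 0 := fun i b hb => l.Ev_low (ha i) hz.1 hb
  have h2 : LinearIndependent k (fun i => l.Ev (a i) ((ξ i).mulVec v)) := by
    have : (fun i => l.Ev (a i) ((ξ i).mulVec v)) =
        (Matrix.mulVecLin l.c) ∘ (fun i => (ξ i).mulVec z) := by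
      ext1 i
      rw [l.Ev_top (ha i) hz]; rfl
    rw [this]
    apply hli.map'
    rw [LinearMap.ker_eq_bot]
    intro x y hxy
    exact l.vhat_inj hxy
  exact ⟨h1, h2, triangular_indep l.Ev _ a h1 h2⟩

lemma finrank_lim_le [CharZero k] {Γ : Set (Matrix ι ι k)} (hΓ : IsSLGroup Γ) (l : PS Γ) {v z : ι → k}
    (hz : l.IsLim v z) : Module.finrank k (orb Γ z) ≤ Module.finrank k (orb Γ v) := by
  obtain ⟨ξ, a, h1, h2, h3⟩ := exists_hom_basis hΓ l z
  have h4 := (lim_indep l hz ξ a h2 h3).2.2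
  have h5 : LinearIndependent k (fun i => (⟨(ξ i).mulVec v, mem_orb.2 ⟨ξ i, h1 i, rfl⟩⟩ : orb Γ v)) := by
    apply LinearIndependent.of_comp (orb Γ v).subtype
    exact h4
  simpa using h5.fintype_card_le_finrank

end F7
end PaperGIT

namespace PaperGIT
section F8
set_option linter.unusedSectionVars false
set_option linter.unusedVariables false
open MvPolynomial
variable {k : Type} [Field k] {ι : Type} [Fintype ι] [DecidableEq ι]

lemma fin_ind (d : ι → ℤ) (P : ι → Prop) (h : ∀ i, (∀ l, d l < d i → P l) → P i) : ∀ i, P i := by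
  have wf : WellFounded (fun i j : ι => d i < d j) := by
    haveI : IsTrans ι (fun i j : ι => d i < d j) := ⟨fun _ _ _ h1 h2 => lt_trans h1 h2⟩
    haveI : Std.Irrefl (fun i j : ι => d i < d j) := ⟨fun _ h1 => lt_irrefl _ h1⟩
    exact Finite.wellFounded_of_trans_of_irrefl _
  intro i
  exact wf.induction i (fun x hx => h x hx)

/-- block lower triangular -/
def Tri {R : Type} [CommRing R] (d : ι → ℤ) (M : Matrix ι ι R) : Prop := ∀ i j, d i < d j → M i j = 0

/-- strictly lower triangular -/
def STri {R : Type} [CommRing R] (d : ι → ℤ) (M : Matrix ι ι R) : Prop := ∀ i j, d i ≤ d j → M i j = 0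

lemma Tri.mul {R : Type} [CommRing R] {d : ι → ℤ} {M N : Matrix ι ι R} (hM : Tri d M) (hN : Tri d N) :
    Tri d (M * N) := by
  intro i j h
  rw [Matrix.mul_apply]
  apply Finset.sum_eq_zero
  intro l _
  by_cases h1 : d i < d l
  · rw [hM i l h1, zero_mul]
  · rw [hN l j (by omega), mul_zero]

lemma Tri.of_sub_one {R : Type} [CommRing R] {d : ι → ℤ} {M : Matrix ι ι R} (hM : STri d (M - 1)) :
    Tri d M := by
  intro i j h
  have := hM i j h.le
  rw [Matrix.sub_apply, Matrix.one_apply_ne (by rintro rfl; exact lt_irrefl _ h), sub_zero] at this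
  exact this

lemma unip [CharZero k] (d : ι → ℤ) (N : Matrix ι ι k) (hN : STri d N) :
    ∃ n n' : Matrix ι ι k, n * n' = 1 ∧ STri d (n - 1) ∧ STri d (n' - 1) ∧
      n * Matrix.diagonal (fun i => (d i : k)) = (Matrix.diagonal (fun i => (d i : k)) + N) * n := by
  set D : Matrix ι ι k := Matrix.diagonal (fun i => (d i : k)) with hD
  let L : Matrix ι ι k →ₗ[k] Matrix ι ι k :=
    { toFun := fun X => Matrix.of fun i j => if d i ≤ d j then X i j else (X * D - D * X - N * X) i j
      map_add' := by
        intro X Y; ext i j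
        simp only [Matrix.of_apply, Matrix.add_apply, mul_add, add_mul, Matrix.sub_apply]
        split_ifs <;> ring
      map_smul' := by
        intro a X; ext i j
        simp only [Matrix.of_apply, Matrix.smul_apply, Matrix.mul_smul, Matrix.smul_mul, Matrix.sub_apply,
          smul_eq_mul, RingHom.id_apply]
        split_ifs <;> ring }
  have hL : ∀ X i j, L X i j = if d i ≤ d j then X i j else (X * D - D * X - N * X) i j := fun _ _ _ => rfl
  have hinj : Function.Injective L := by
    rw [← LinearMap.ker_eq_bot, LinearMap.ker_eq_bot']
    intro X hX
    have : ∀ i, ∀ j, X i j = 0 := by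
      apply fin_ind d
      intro i ih j
      have h1 : L X i j = 0 := by rw [hX]; rfl
      rw [hL] at h1
      split_ifs at h1 with h2
      · exact h1
      · rw [Matrix.sub_apply, Matrix.sub_apply, hD, Matrix.mul_diagonal, Matrix.diagonal_mul,
          Matrix.mul_apply, Finset.sum_eq_zero, sub_zero] at h1
        · have h3 : (d j - d i : k) * X i j = 0 := by rw [← h1]; ring
          rcases mul_eq_zero.1 h3 with h4 | h4
          · exfalso
            have : ((d j - d i : ℤ) : k) = 0 := by push_cast; exact h4
            rw [Int.cast_eq_zero] at this
            omega
          · exact h4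
        · intro l _
          by_cases h5 : d i ≤ d l
          · rw [hN i l h5, zero_mul]
          · rw [ih l (by omega), mul_zero]
    ext i j; exact this i j
  obtain ⟨X, hX⟩ := LinearMap.injective_iff_surjective.1 hinj N
  have hXs : STri d X := by
    intro i j h
    have h1 : L X i j = N i j := by rw [hX]
    rw [hL, if_pos h, hN i j h] at h1
    exact h1
  have hXe : X * D - D * X - N * X = N := by
    ext i j
    by_cases h : d i ≤ d j
    · rw [hN i j h, Matrix.sub_apply, Matrix.sub_apply, hD, Matrix.mul_diagonal, Matrix.diagonal_mul,
          Matrix.mul_apply, Finset.sum_eq_zero, hXs i j h]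
      · ring
      · intro l _
        by_cases h5 : d i ≤ d l
        · rw [hN i l h5, zero_mul]
        · rw [hXs l j (by omega), mul_zero]
    · have h1 : L X i j = N i j := by rw [hX]
      rw [hL, if_neg h] at h1
      exact h1
  have hinj2 : Function.Injective (LinearMap.mulLeft k (1 + X)) := by
    rw [← LinearMap.ker_eq_bot, LinearMap.ker_eq_bot']
    intro Y hY
    have : ∀ i, ∀ j, Y i j = 0 := by
      apply fin_ind d
      intro i ih j
      have h1 : ((1 + X) * Y) i j = 0 := by
        have : (1 + X) * Y = 0 := hY
        rw [this]; rfl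
      rw [add_mul, one_mul, Matrix.add_apply, Matrix.mul_apply, Finset.sum_eq_zero, add_zero] at h1
      · exact h1
      · intro l _
        by_cases h5 : d i ≤ d l
        · rw [hXs i l h5, zero_mul]
        · rw [ih l (by omega), mul_zero]
    ext i j; exact this i j
  obtain ⟨Y, hY⟩ := LinearMap.injective_iff_surjective.1 hinj2 (-X)
  have hY' : Y + X * Y = - X := by
    rw [← hY]; change _ = (1 + X) * Y; noncomm_ring
  have hYs : STri d Y := by
    have : ∀ i, ∀ j, d i ≤ d j → Y i j = 0 := by
      apply fin_ind d
      intro i ih j hij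
      have h1 : (Y + X * Y) i j = (-X) i j := by rw [hY']
      rw [Matrix.add_apply, Matrix.mul_apply, Finset.sum_eq_zero, add_zero, Matrix.neg_apply,
        hXs i j hij, neg_zero] at h1
      · exact h1
      · intro l _
        by_cases h5 : d i ≤ d l
        · rw [hXs i l h5, zero_mul]
        · rw [ih l (by omega) j (by omega), mul_zero]
    exact this
  refine ⟨1 + X, 1 + Y, ?_, ?_, ?_, ?_⟩
  · rw [show (1 + X) * (1 + Y) = 1 + X + (Y + X * Y) by noncomm_ring, hY']; abel
  · rw [add_sub_cancel_left]; exact hXs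
  · rw [add_sub_cancel_left]; exact hYs
  · rw [show (1 + X) * D = D + (X * D - D * X - N * X) + D * X + N * X by noncomm_ring, hXe]
    noncomm_ring

/-- abstract version of `H_x`. -/
def Hs (Γ : Set (Matrix ι ι k)) (v : ι → k) : Set (Matrix ι ι k) :=
  {g | g ∈ Γ ∧ ∀ l : PS Γ, l.Lam v → l.InP g}

def ProperAt (Γ : Set (Matrix ι ι k)) (v : ι → k) : Prop :=
  ∀ l : PS Γ, (∀ g ∈ Hs Γ v, l.InP g) → l.Lam v

def CRat (Γ : Set (Matrix ι ι k)) (v : ι → k) : Prop :=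
  ∀ l : PS Γ, (∀ g ∈ Hs Γ v, l.InP g) →
    ∃ m : PS Γ, (∀ g ∈ Γ, m.InP g ↔ l.InP g) ∧ ∀ g ∈ Hs Γ v, m.InL g

def InClo (Γ : Set (Matrix ι ι k)) (v y : ι → k) : Prop :=
  ∀ f : MvPolynomial ι k, (∀ g ∈ Γ, eval (g.mulVec v) f = 0) → eval y f = 0

def OrbClosed (Γ : Set (Matrix ι ι k)) (v : ι → k) : Prop :=
  ∀ y, InClo Γ v y → ∃ g ∈ Γ, y = g.mulVec v

variable {Γ : Set (Matrix ι ι k)}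

lemma lim_exists (l : PS Γ) {v : ι → k} (hv : l.Lam v) : ∃ z, l.IsLim v z := by
  refine ⟨l.c'.mulVec (fun i => if l.d i = 0 then l.vhat v i else 0), hv, ?_⟩
  intro i
  rw [l.vhat_un]

lemma lim_inClo [CharZero k] (hΓ : IsSLGroup Γ) (l : PS Γ) {v z : ι → k} (hz : l.IsLim v z) :
    InClo Γ v z := by
  intro f hf
  let p : ι → Polynomial k := fun i => if l.d i < 0 then 0 else
    Polynomial.C (l.vhat v i) * Polynomial.X ^ (l.d i).toNat
  let P : ι → Polynomial k := (l.c'.map Polynomial.C).mulVec p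
  have hP : ∀ t, (fun i => (P i).eval t) = l.c'.mulVec (fun i => (p i).eval t) := by
    intro t; ext i
    simp only [P, Matrix.mulVec, dotProduct, Polynomial.eval_finset_sum, Polynomial.eval_mul,
      Matrix.map_apply, Polynomial.eval_C]
  have hF : ∀ t, (aeval P f).eval t = eval (fun i => (P i).eval t) f := by
    intro t
    rw [← Polynomial.coe_evalRingHom, MvPolynomial.aeval_def, MvPolynomial.hom_eval₂, 
      MvPolynomial.eval, MvPolynomial.coe_eval₂Hom]
    congr 1
    ext x; simp
  have h0 : ∀ t, t ≠ 0 → (aeval P f).eval t = 0 := by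
    intro t ht
    rw [hF, hP]
    have : l.c'.mulVec (fun i => (p i).eval t) = (l.at' t).mulVec v := by
      apply l.vhat_inj
      rw [l.vhat_un, l.vhat_mulVec, l.hat_at]
      ext i
      rw [Matrix.mulVec_diagonal]
      simp only [p]
      split_ifs with hi
      · rw [hz.1 i hi, mul_zero, Polynomial.eval_zero]
      · simp only [Polynomial.eval_mul, Polynomial.eval_C, Polynomial.eval_pow, Polynomial.eval_X]
        rw [mul_comm, ← zpow_natCast, Int.toNat_of_nonneg (by omega)]
    rw [this]
    exact hf _ (l.at_mem hΓ ht)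
  have h1 : aeval P f = 0 := by
    apply Polynomial.eq_zero_of_infinite_isRoot
    apply Set.Infinite.mono (s := {t : k | t ≠ 0}) (fun t ht => h0 t ht)
    exact (Set.finite_singleton (0 : k)).infinite_compl
  have h2 := hF 0
  rw [h1, Polynomial.eval_zero, hP] at h2
  rw [h2]
  congr 2
  apply l.vhat_inj
  rw [l.vhat_un]
  ext i
  rw [hz.2 i]
  simp only [p]
  split_ifs with h3 h4 h4
  · omega
  · simp [h3]
  · simp
  · simp only [Polynomial.eval_mul, Polynomial.eval_C, Polynomial.eval_pow, Polynomial.eval_X]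
    rw [zero_pow (by omega), mul_zero]

lemma finrank_orb_smul (hΓ : IsSLGroup Γ) {g : Matrix ι ι k} (hg : g ∈ Γ) (v : ι → k) :
    Module.finrank k (orb Γ v) ≤ Module.finrank k (orb Γ (g.mulVec v)) := by
  have h1 : orb Γ v ≤ (orb Γ (g.mulVec v)).map (Matrix.mulVecLin g⁻¹) := by
    intro w hw
    obtain ⟨ξ, hξ, rfl⟩ := mem_orb.1 hw
    refine ⟨(g * ξ * g⁻¹).mulVec (g.mulVec v), mem_orb.2 ⟨_, lie_conj hΓ (mem_one_lie hg) hξ, rfl⟩, ?_⟩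
    have h2 := (slg_inv hΓ hg).2
    rw [Matrix.mulVecLin_apply, Matrix.mulVec_mulVec, Matrix.mulVec_mulVec,
      show g⁻¹ * (g * ξ * g⁻¹) * g = (g⁻¹ * g) * ξ * (g⁻¹ * g) by noncomm_ring, h2, one_mul, mul_one]
  exact (Submodule.finrank_mono h1).trans (Submodule.finrank_map_le _ _)

lemma li_span {F V : Type} [Field F] [AddCommGroup V] [Module F V] (W : Submodule F V) [FiniteDimensional F W]
    {J : Type} [Fintype J] (f : J → V) (hf : ∀ i, f i ∈ W) (hli : LinearIndependent F f)
    (hc : Module.finrank F W ≤ Fintype.card J) {w : V} (hw : w ∈ W) : ∃ α : J → F, w = ∑ i, α i • f i := by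
  have h5 : LinearIndependent F (fun i => (⟨f i, hf i⟩ : W)) := by
    apply LinearIndependent.of_comp W.subtype
    exact hli
  have h6 := h5.span_eq_top_of_card_eq_finrank' (le_antisymm h5.fintype_card_le_finrank hc)
  have h7 : (⟨w, hw⟩ : W) ∈ Submodule.span F (Set.range (fun i => (⟨f i, hf i⟩ : W))) := by
    rw [h6]; trivial
  obtain ⟨α, hα⟩ := (Submodule.mem_span_range_iff_exists_fun F).1 h7
  refine ⟨α, ?_⟩
  have := congrArg W.subtype hα
  rw [map_sum] at this
  simpa using this.symm

lemma lam_fix (l : PS Γ) {v : ι → k} (h1 : l.Lam v) (h2 : l.neg.Lam v) : ∀ i, l.d i ≠ 0 → l.vhat v i = 0 := by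
  intro i hi
  rcases lt_or_gt_of_ne hi with h | h
  · exact h1 i h
  · exact h2 i (by change - l.d i < 0; omega)

lemma inL_of (l : PS Γ) {g : Matrix ι ι k} (h1 : l.InP g) (h2 : l.neg.InP g) : l.InL g := by
  intro i j hi
  rcases lt_or_gt_of_ne hi with h | h
  · exact h1 i j h
  · exact h2 i j (by change - l.d i < - l.d j; omega)

lemma inP_of (l : PS Γ) {g : Matrix ι ι k} (h1 : l.InL g) : l.InP g ∧ l.neg.InP g :=
  ⟨fun i j hi => h1 i j hi.ne, fun i j hi => h1 i j (by
    have : - l.d i < - l.d j := hi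
    omega)⟩

/-- The direction polystable implies completely reducible. -/
theorem cr_of_closed [CharZero k] (hΓ : IsSLGroup Γ) (v : ι → k) (hpr : ProperAt Γ v) (hcl : OrbClosed Γ v) :
    CRat Γ v := by
  intro l hl
  have hv := hpr l hl
  obtain ⟨y, hy⟩ := lim_exists l hv
  obtain ⟨g, hg, hgy⟩ := hcl y (lim_inClo hΓ l hy)
  have hdim := finrank_orb_smul hΓ hg v
  rw [← hgy] at hdim
  obtain ⟨η, a, h1, h2, h3⟩ := exists_hom_basis hΓ l y
  obtain ⟨hlow, hind, hli⟩ := lim_indep l hy η a h2 h3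
  obtain ⟨α, hα⟩ := li_span (orb Γ v) (fun i => (η i).mulVec v) (fun i => mem_orb.2 ⟨_, h1 i, rfl⟩) hli
    (by simpa using hdim) (w := l.h.mulVec v) (mem_orb.2 ⟨_, l.mem, rfl⟩)
  have hα0 : ∀ i, a i ≤ 0 → α i = 0 := by
    apply triangular l.Ev (fun i => (η i).mulVec v) a hlow hind α 0
    intro b hb
    rw [← hα]
    ext i
    rw [l.Ev_apply]
    split_ifs with hi
    · rw [l.vhat_mulVec, l.hat_h, Matrix.mulVec_diagonal]
      by_cases h0 : l.d i = 0
      · simp [h0]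
      · rw [hv i (by omega), mul_zero]; rfl
    · rfl
  let Ξ := ∑ i, α i • η i
  have hΞ : Ξ ∈ lie Γ k := Submodule.sum_mem _ (fun i _ => Submodule.smul_mem _ _ (h1 i))
  have hΞt : STri l.d (- l.hat Ξ) := by
    intro i j hij
    have : l.hat Ξ = ∑ i, α i • l.hat (η i) := by
      simp [Ξ, PS.hat, Finset.mul_sum, Finset.sum_mul]
    rw [Matrix.neg_apply, this, Matrix.sum_apply, Finset.sum_eq_zero, neg_zero]
    intro q _
    rw [Matrix.smul_apply]
    by_cases hq : a q ≤ 0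
    · rw [hα0 q hq, zero_smul]
    · rw [h2 q i j (by omega), smul_zero]
  obtain ⟨n, n', hnn, hn, hn', hnD⟩ := unip l.d _ hΞt
  have hnn' : n' * n = 1 := mul_eq_one_comm.1 hnn
  set D : Matrix ι ι k := Matrix.diagonal (fun i => (l.d i : k)) with hD
  have hDe : n * D * n' = D - l.hat Ξ := by
    rw [hnD, mul_assoc, hnn, mul_one, sub_eq_add_neg]
  have hμ : l.c' * n * D * (n' * l.c) = l.h - Ξ := by
    rw [show l.c' * n * D * (n' * l.c) = l.c' * (n * D * n') * l.c by noncomm_ring, hDe, mul_sub, sub_mul,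
      l.unhat]; rfl
  let μ : PS Γ :=
    { c := n' * l.c
      c' := l.c' * n
      d := l.d
      hc := by
        rw [show n' * l.c * (l.c' * n) = n' * (l.c * l.c') * n by noncomm_ring, l.hc, mul_one, hnn']
      mem := by
        rw [hμ]; exact Submodule.sub_mem _ l.mem hΞ }
  have hμhat : ∀ g, μ.hat g = n' * l.hat g * n := by
    intro g; simp only [PS.hat, μ]; noncomm_ring
  have hhat2 : ∀ g, l.hat g = n * μ.hat g * n' := by
    intro g
    rw [hμhat, show n * (n' * l.hat g * n) * n' = (n * n') * l.hat g * (n * n') by noncomm_ring, hnn, one_mul,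
      mul_one]
  have hfix : ∀ i, l.d i ≠ 0 → μ.vhat v i = 0 := by
    intro i hi
    have h5 : μ.h.mulVec v = 0 := by
      have : μ.h = l.h - Ξ := hμ
      rw [this, Matrix.sub_mulVec, hα]
      simp only [Ξ, Matrix.sum_mulVec, Matrix.smul_mulVec, sub_self]
    have h6 : μ.vhat (μ.h.mulVec v) i = 0 := by rw [h5, PS.vhat, Matrix.mulVec_zero]; rfl
    rw [μ.vhat_mulVec, μ.hat_h, Matrix.mulVec_diagonal] at h6
    rcases mul_eq_zero.1 h6 with h7 | h7
    · exact absurd (Int.cast_eq_zero.1 h7) hi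
    · exact h7
  refine ⟨μ, ?_, ?_⟩
  · intro g _
    constructor
    · intro h i j hij
      rw [hhat2]
      exact ((Tri.of_sub_one hn).mul (show Tri l.d (μ.hat g) from h)).mul (Tri.of_sub_one hn') i j hij
    · intro h i j hij
      rw [hμhat]
      exact ((Tri.of_sub_one hn').mul (show Tri l.d (l.hat g) from h)).mul (Tri.of_sub_one hn) i j hij
  · intro g hg
    apply inL_of
    · exact hg.2 μ (fun i hi => hfix i (by have : l.d i < 0 := hi; omega))
    · exact hg.2 μ.neg (fun i hi => hfix i (by have : - l.d i < 0 := hi; omega))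

end F8
end PaperGIT

namespace PaperGIT
section F9
set_option linter.unusedSectionVars false
set_option linter.unusedVariables false
open MvPolynomial
variable {k : Type} [Field k] {ι : Type} [Fintype ι] [DecidableEq ι]

lemma laurent_indep [Infinite k] (S : Finset ℤ) (c : ℤ → k)
    (h : ∀ t : k, t ≠ 0 → ∑ a ∈ S, t ^ a * c a = 0) : ∀ a ∈ S, c a = 0 := by
  intro a ha
  let N : ℕ := ∑ a ∈ S, a.natAbs
  have hN : ∀ a ∈ S, 0 ≤ a + N := by
    intro a ha
    have : a.natAbs ≤ N := Finset.single_le_sum (f := fun a : ℤ => a.natAbs) (fun _ _ => Nat.zero_le _) ha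
    omega
  let p : Polynomial k := ∑ a ∈ S, Polynomial.C (c a) * Polynomial.X ^ (a + N).toNat
  have hp : p = 0 := by
    apply Polynomial.eq_zero_of_infinite_isRoot
    apply Set.Infinite.mono (s := {t : k | t ≠ 0})
    · intro t ht
      change p.eval t = 0
      have h1 := h t ht
      have : p.eval t = t ^ N * ∑ a ∈ S, t ^ a * c a := by
        simp only [p, Polynomial.eval_finset_sum, Polynomial.eval_mul, Polynomial.eval_C, Polynomial.eval_pow,
          Polynomial.eval_X]
        rw [Finset.mul_sum]
        apply Finset.sum_congr rfl
        intro b hb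
        rw [← zpow_natCast, Int.toNat_of_nonneg (hN b hb), zpow_add₀ ht, zpow_natCast]
        ring
      rw [this, h1, mul_zero]
    · exact (Set.finite_singleton (0 : k)).infinite_compl
  have h2 : p.coeff (a + N).toNat = c a := by
    simp only [p, Polynomial.finset_sum_coeff, Polynomial.coeff_C_mul, Polynomial.coeff_X_pow]
    rw [Finset.sum_eq_single a]
    · simp
    · intro b hb hba
      rw [if_neg, mul_zero]
      have := hN a ha
      have := hN b hb
      omega
    · intro h; exact absurd ha h
  rw [← h2, hp, Polynomial.coeff_zero]

/-- simultaneous diagonalisation of orthogonal idempotents -/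
lemma diag_idem {J : Type} [DecidableEq J] (S : Finset J) (e : J → Matrix ι ι k)
    (he : ∀ p q, e p * e q = if p = q then e p else 0) (hs : ∑ p ∈ S, e p = 1) :
    ∃ (c c' : Matrix ι ι k) (d : ι → J), c * c' = 1 ∧
      (∀ p, e p = c' * Matrix.diagonal (fun i => if d i = p then 1 else 0) * c) ∧
      ∀ f : J → k, c' * Matrix.diagonal (fun i => f (d i)) * c = ∑ p ∈ S, f p • e p := by
  let T : Set (ι → k) := {w | ∃ p w', w = (e p).mulVec w'}
  obtain ⟨f, hf, -, hli⟩ := Submodule.exists_fun_fin_finrank_span_eq k T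
  have htop : Submodule.span k T = ⊤ := by
    rw [eq_top_iff]
    intro w _
    have : w = ∑ p ∈ S, (e p).mulVec w := by
      rw [← Matrix.sum_mulVec, hs, Matrix.one_mulVec]
    rw [this]
    exact Submodule.sum_mem _ (fun p _ => Submodule.subset_span ⟨p, w, rfl⟩)
  have hcard : Module.finrank k (Submodule.span k T) = Fintype.card ι := by
    rw [htop, finrank_top, Module.finrank_fintype_fun_eq_card]
  let σ : ι ≃ Fin (Module.finrank k (Submodule.span k T)) :=
    Fintype.equivOfCardEq (by rw [Fintype.card_fin, hcard])
  choose q w hw using hf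
  let c' : Matrix ι ι k := Matrix.of fun i j => f (σ j) i
  have hcol : ∀ j, c'.col j = f (σ j) := fun j => rfl
  have hu : IsUnit c' := by
    rw [← Matrix.linearIndependent_cols_iff_isUnit]
    exact hli.comp σ σ.injective
  have hdet := (Matrix.isUnit_iff_isUnit_det _).1 hu
  have hc : c'⁻¹ * c' = 1 := Matrix.nonsing_inv_mul _ hdet
  have hc2 : c' * c'⁻¹ = 1 := Matrix.mul_nonsing_inv _ hdet
  have h1 : ∀ p, e p * c' = c' * Matrix.diagonal (fun i => if q (σ i) = p then 1 else 0) := by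
    intro p
    ext i j
    rw [Matrix.mul_diagonal]
    have h2 : (e p * c') i j = (e p).mulVec (f (σ j)) i := rfl
    have h3 : c' i j = f (σ j) i := rfl
    rw [h2, h3, hw (σ j), Matrix.mulVec_mulVec, he]
    by_cases h4 : p = q (σ j)
    · rw [if_pos h4, if_pos h4.symm, mul_one, h4]
    · rw [if_neg h4, if_neg (Ne.symm h4), mul_zero, Matrix.zero_mulVec]; rfl
  have h5 : ∀ p, e p = c' * Matrix.diagonal (fun i => if q (σ i) = p then 1 else 0) * c'⁻¹ := by
    intro p
    rw [← h1, mul_assoc, hc2, mul_one]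
  have hS : ∀ i, q (σ i) ∈ S := by
    intro i
    by_contra hi
    have h6 : ∑ p ∈ S, Matrix.diagonal (fun i => if q (σ i) = p then (1 : k) else 0) = 1 := by
      have : ∑ p ∈ S, Matrix.diagonal (fun i => if q (σ i) = p then (1 : k) else 0) =
        c'⁻¹ * (∑ p ∈ S, e p) * c' := by
        rw [Finset.mul_sum, Finset.sum_mul]
        apply Finset.sum_congr rfl
        intro p _
        rw [mul_assoc, h1, ← mul_assoc, hc, one_mul]
      rw [this, hs, mul_one, hc]
    have h7 := congrFun (congrFun h6 i) i
    rw [Matrix.sum_apply, Matrix.one_apply_eq, Finset.sum_eq_zero] at h7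
    · exact zero_ne_one h7
    · intro p hp
      rw [Matrix.diagonal_apply_eq, if_neg]
      rintro rfl; exact hi hp
  refine ⟨c'⁻¹, c', fun i => q (σ i), hc, h5, ?_⟩
  intro g
  have h8 : Matrix.diagonal (fun i => g (q (σ i))) =
      ∑ p ∈ S, g p • Matrix.diagonal (fun i => if q (σ i) = p then (1 : k) else 0) := by
    ext i j
    rw [Matrix.sum_apply]
    simp only [Matrix.smul_apply]
    by_cases hij : i = j
    · subst hij
      simp only [Matrix.diagonal_apply_eq, smul_eq_mul, mul_ite, mul_one, mul_zero]
      rw [Finset.sum_ite_eq, if_pos (hS i)]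
    · simp [Matrix.diagonal_apply_ne _ hij]
  rw [h8, Finset.mul_sum, Finset.sum_mul]
  apply Finset.sum_congr rfl
  intro p _
  rw [Matrix.mul_smul, Matrix.smul_mul, ← h5]

namespace PS
variable {Γ : Set (Matrix ι ι k)} (l : PS Γ)

lemma E_mul (a b : ℤ) : l.E a * l.E b = if a = b then l.E a else 0 := by
  apply l.hat_inj
  rw [l.hat_mul, l.hat_E, l.hat_E, Matrix.diagonal_mul_diagonal]
  split_ifs with h
  · rw [l.hat_E, h]
    congr 1; ext i; split_ifs <;> simp
  · have : l.hat 0 = 0 := by simp [hat]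
    rw [this, ← Matrix.diagonal_zero]
    congr 1; ext i
    split_ifs with h1 h2
    · exact absurd (h1.symm.trans h2) h
    all_goals simp

lemma hat_sum {J : Type} (S : Finset J) (M : J → Matrix ι ι k) : l.hat (∑ a ∈ S, M a) = ∑ a ∈ S, l.hat (M a) := by
  simp [hat, Finset.mul_sum, Finset.sum_mul]

lemma diag_sum (f : ℤ → k) : l.c' * Matrix.diagonal (fun i => f (l.d i)) * l.c =
    ∑ a ∈ Finset.univ.image l.d, f a • l.E a := by
  apply l.hat_inj
  rw [l.hat_conj, l.hat_sum]
  simp only [l.hat_smul, l.hat_E]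
  ext i j
  rw [Matrix.sum_apply]
  simp only [Matrix.smul_apply]
  by_cases hij : i = j
  · subst hij
    simp only [Matrix.diagonal_apply_eq, smul_eq_mul, mul_ite, mul_one, mul_zero]
    rw [Finset.sum_ite_eq, if_pos (Finset.mem_image_of_mem _ (Finset.mem_univ i))]
  · simp [Matrix.diagonal_apply_ne _ hij]

lemma sum_E : ∑ a ∈ Finset.univ.image l.d, l.E a = 1 := by
  have := l.diag_sum (fun _ => 1)
  rw [Matrix.diagonal_one, mul_one, l.hc'] at this
  rw [this]; simp

lemma E_eq_zero {a : ℤ} (h : a ∉ Finset.univ.image l.d) : l.E a = 0 := by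
  have : (fun i => if l.d i = a then (1 : k) else 0) = 0 := by
    ext i
    rw [if_neg]; rfl
    rintro rfl; exact h (Finset.mem_image_of_mem _ (Finset.mem_univ i))
  rw [E, this]; 
  have h0 : Matrix.diagonal (0 : ι → k) = 0 := Matrix.diagonal_zero
  rw [h0]; simp

lemma inP_iff_E (g : Matrix ι ι k) : l.InP g ↔ ∀ a b, a < b → l.E a * g * l.E b = 0 := by
  have key : ∀ a b i j, l.hat (l.E a * g * l.E b) i j =
      (if l.d i = a then 1 else 0) * l.hat g i j * (if l.d j = b then 1 else 0) := by
    intro a b i j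
    rw [l.hat_mul, l.hat_mul, l.hat_E, l.hat_E, Matrix.mul_diagonal, Matrix.diagonal_mul]
  have h0 : l.hat 0 = 0 := by simp [hat]
  constructor
  · intro h a b hab
    apply l.hat_inj
    ext i j
    rw [key, h0]
    split_ifs with h1 h2
    · rw [h i j (by omega)]; simp
    all_goals simp
  · intro h i j hij
    have := key (l.d i) (l.d j) i j
    rw [h _ _ hij, h0] at this
    simpa using this.symm

lemma Hm_mul {a b : ℤ} {M N : Matrix ι ι k} (hM : l.Hm a M) (hN : l.Hm b N) : l.Hm (a + b) (M * N) := by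
  intro i j h
  rw [l.hat_mul, Matrix.mul_apply]
  apply Finset.sum_eq_zero
  intro q _
  by_cases h1 : l.d i - l.d q = a
  · rw [hN q j (by omega), mul_zero]
  · rw [hM i q h1, zero_mul]

lemma Hm_one : l.Hm 0 1 := by
  intro i j h
  rw [l.hat_one, Matrix.one_apply_ne]
  rintro rfl; exact h (by omega)

lemma Hm_pow {a : ℤ} {M : Matrix ι ι k} (hM : l.Hm a M) (n : ℕ) : l.Hm (n * a) (M ^ n) := by
  induction n with
  | zero => simpa using l.Hm_one
  | succ n ih =>
    rw [pow_succ]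
    have := l.Hm_mul ih hM
    rw [show ((n + 1 : ℕ) : ℤ) * a = n * a + a by push_cast; ring]
    exact this

lemma Hm_zero_iff [CharZero k] (M : Matrix ι ι k) : l.Hm 0 M ↔ M * l.h = l.h * M := by
  have key : ∀ i j, l.hat (M * l.h) i j - l.hat (l.h * M) i j = ((l.d j - l.d i : ℤ) : k) * l.hat M i j := by
    intro i j
    rw [l.hat_mul, l.hat_mul, l.hat_h, Matrix.mul_diagonal, Matrix.diagonal_mul]
    push_cast; ring
  constructor
  · intro h
    apply l.hat_inj
    ext i j
    rw [← sub_eq_zero, key]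
    by_cases h1 : l.d i - l.d j = 0
    · rw [show l.d j - l.d i = 0 by omega]; simp
    · rw [h i j h1, mul_zero]
  · intro h i j hij
    have := key i j
    rw [h, sub_self] at this
    rcases mul_eq_zero.1 this.symm with h1 | h1
    · rw [Int.cast_eq_zero] at h1; omega
    · exact h1

lemma inL_iff (M : Matrix ι ι k) : l.InL M ↔ l.Hm 0 M :=
  ⟨fun h i j hij => h i j (by omega), fun h i j hij => h i j (by omega)⟩

lemma comp0_mul {A B : Matrix ι ι k} (hA : l.InP A) (hB : l.InP B) :
    l.comp 0 (A * B) = l.comp 0 A * l.comp 0 B := by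
  apply l.hat_inj
  ext i j
  rw [l.hat_comp, l.hat_mul, l.hat_mul, Matrix.mul_apply, Matrix.mul_apply]
  simp only [l.hat_comp]
  split_ifs with h
  · apply Finset.sum_congr rfl
    intro q _
    by_cases h1 : l.d i < l.d q
    · rw [hA i q h1]; simp
    · by_cases h2 : l.d q < l.d j
      · rw [hB q j h2]; simp
      · rw [if_pos (by omega), if_pos (by omega)]
  · symm
    apply Finset.sum_eq_zero
    intro q _
    by_cases h1 : l.d i - l.d q = 0
    · rw [if_neg (show ¬ l.d q - l.d j = 0 by omega), mul_zero]
    · rw [if_neg h1, zero_mul]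

lemma comp0_of {A : Matrix ι ι k} (hA : l.Hm 0 A) : l.comp 0 A = A := by
  apply l.hat_inj
  ext i j
  rw [l.hat_comp]
  split_ifs with h
  · rfl
  · rw [hA i j h]

lemma comp_zero (a : ℤ) : l.comp a 0 = 0 := by
  apply l.hat_inj
  ext i j
  rw [l.hat_comp]
  have : l.hat 0 = 0 := by simp [hat]
  rw [this]; simp

/-- the curve `λ(t) g λ(t)⁻¹` -/
noncomputable def cur (g : Matrix ι ι k) : Matrix ι ι (Polynomial k) :=
  l.c'.map Polynomial.C * (Matrix.of fun i j => Polynomial.C (l.hat g i j) *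
    Polynomial.X ^ (l.d i - l.d j).toNat) * l.c.map Polynomial.C

lemma cur_eval (g : Matrix ι ι k) (t : k) : (l.cur g).map (Polynomial.eval t) =
    l.c' * (Matrix.of fun i j => l.hat g i j * t ^ (l.d i - l.d j).toNat) * l.c := by
  have h : ∀ M : Matrix ι ι (Polynomial k), M.map (Polynomial.eval t) = M.map (Polynomial.evalRingHom t) :=
    fun M => rfl
  rw [h, cur, Matrix.map_mul, Matrix.map_mul]
  congr 1
  · congr 1
    · ext i j; simp
    · ext i j; simp
  · ext i j; simp

lemma cur_mem [CharZero k] (hΓ : IsSLGroup Γ) {g : Matrix ι ι k} (hg : g ∈ Γ) (hp : l.InP g) :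
    l.cur g ∈ pts Γ (Polynomial k) := by
  intro f hf
  apply Polynomial.eq_zero_of_infinite_isRoot
  apply Set.Infinite.mono (s := {t : k | t ≠ 0}) _ (Set.finite_singleton (0 : k)).infinite_compl
  intro t ht
  change Polynomial.eval t (evM (l.cur g) f) = 0
  rw [← Polynomial.coe_aeval_eq_eval]
  have h2 : (Polynomial.aeval t) (evM (l.cur g) f) = evM ((l.cur g).map (Polynomial.eval t)) f :=
    evM_comp (Polynomial.aeval t) (l.cur g) f
  rw [h2]
  apply hf
  have : (l.cur g).map (Polynomial.eval t) = l.at' t * g * l.at' t⁻¹ := by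
    rw [cur_eval]
    apply l.hat_inj
    rw [l.hat_conj, l.hat_mul, l.hat_mul, l.hat_at, l.hat_at]
    ext i j
    rw [Matrix.mul_diagonal, Matrix.diagonal_mul, Matrix.of_apply]
    by_cases h1 : l.d i < l.d j
    · rw [hp i j h1]; simp
    · rw [← zpow_natCast, Int.toNat_of_nonneg (by omega), zpow_sub₀ ht, inv_zpow]
      field_simp
  rw [this]
  exact hΓ.mul_mem _ (hΓ.mul_mem _ (l.at_mem hΓ ht) _ hg) _ (l.at_mem hΓ (inv_ne_zero ht))

lemma comp0_mem [CharZero k] (hΓ : IsSLGroup Γ) {g : Matrix ι ι k} (hg : g ∈ Γ) (hp : l.InP g) :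
    l.comp 0 g ∈ Γ := by
  have h1 := pts_eval hΓ (l.cur_mem hΓ hg hp) 0
  have : l.comp 0 g = (l.cur g).map (Polynomial.eval 0) := by
    rw [cur_eval]
    apply l.hat_inj
    rw [l.hat_conj]
    ext i j
    rw [l.hat_comp, Matrix.of_apply]
    split_ifs with h
    · rw [h]; simp
    · by_cases h2 : l.d i < l.d j
      · rw [hp i j h2, zero_mul]
      · rw [zero_pow (by omega), mul_zero]
  rw [this]; exact h1

end PS

section levi
variable {Γ : Set (Matrix ι ι k)}

lemma levi_neg [CharZero k] (hΓ : IsSLGroup Γ) (l m : PS Γ)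
    (hLP : ∀ g ∈ Γ, m.InL g → l.InP g) {ξ : Matrix ι ι k} (hξ : ξ ∈ lie Γ k) (h0 : m.Hm 0 ξ) {a : ℤ}
    (ha : 0 < a) (h1 : l.Hm (-a) ξ) : ξ = 0 := by
  obtain ⟨N, hN⟩ : ∃ N : ℕ, ξ ^ N = 0 := by
    by_contra hcon
    push_neg at hcon
    have : ∀ n : ℕ, ∃ p : ι × ι, l.d p.1 - l.d p.2 = n * (-a) := by
      intro n
      by_contra hno
      push_neg at hno
      apply hcon n
      apply l.hat_inj
      ext i j
      rw [l.Hm_pow h1 n i j (hno (i, j))]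
      simp [PS.hat]
    choose f hf using this
    refine not_injective_infinite_finite f ?_
    intro n n' hnn
    have h3 := hf n
    rw [hnn, hf n'] at h3
    have h4 : (n' : ℤ) = n := mul_right_cancel₀ (by omega) h3
    exact_mod_cast h4.symm
  have hN2 : ξ ^ (N + 2) = 0 := by rw [pow_add, hN, zero_mul]
  have he := expN_mem hΓ hξ hN2 1
  rw [one_smul] at he
  have hL : m.InL (expN (N + 2) ξ) := by
    rw [m.inL_iff]
    intro i j hij
    rw [expN, m.hat_sum, Matrix.sum_apply]
    apply Finset.sum_eq_zero
    intro n _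
    have := m.Hm_pow h0 n
    rw [mul_zero] at this
    rw [m.hat_smul, Matrix.smul_apply, this i j hij, smul_zero]
  have hP := hLP _ he hL
  apply l.hat_inj
  ext i j
  have hz : l.hat 0 = 0 := by simp [PS.hat]
  rw [hz]
  by_cases hij : l.d i - l.d j = -a
  · have h5 := hP i j (by omega)
    rw [expN, l.hat_sum, Matrix.sum_apply, Finset.sum_eq_single 1] at h5
    · simpa [l.hat_smul] using h5
    · intro n _ hn
      rw [l.hat_smul, Matrix.smul_apply, l.Hm_pow h1 n i j, smul_zero]
      rw [hij]
      intro h6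
      have : ((n : ℤ) - 1) * a = 0 := by linarith
      rcases mul_eq_zero.1 this with h7 | h7 <;> omega
    · intro h; simp at h
  · exact h1 i j hij

lemma levi_pos [CharZero k] (hΓ : IsSLGroup Γ) (htr : TraceNondeg Γ) (l m : PS Γ)
    (hc : m.c = l.c) (hc' : m.c' = l.c')
    (hLP : ∀ g ∈ Γ, m.InL g → l.InP g) {ξ : Matrix ι ι k} (hξ : ξ ∈ lie Γ k) (h0 : m.Hm 0 ξ) {a : ℤ}
    (ha : 0 < a) (h1 : l.Hm a ξ) : ξ = 0 := by
  have hhat : ∀ M, m.hat M = l.hat M := by intro M; simp [PS.hat, hc, hc']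
  apply htr ξ hξ
  intro η hη
  have htrace : (ξ * η).trace = (l.hat ξ * l.hat η).trace := by
    rw [← l.hat_mul, PS.hat, Matrix.trace_mul_comm (l.c * (ξ * η)), ← mul_assoc, l.hc', one_mul]
  rw [htrace, Matrix.trace]
  apply Finset.sum_eq_zero
  intro i _
  rw [Matrix.diag_apply, Matrix.mul_apply]
  apply Finset.sum_eq_zero
  intro j _
  by_cases h3 : l.d i - l.d j = a
  · by_cases h4 : m.d i - m.d j = 0
    · have h5 : l.comp (-a) (m.comp 0 η) = 0 := by
        apply levi_neg hΓ l m hLP (l.comp_mem hΓ _ (m.comp_mem hΓ _ hη)) _ ha (l.comp_Hm _ _)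
        intro p q hpq
        rw [hhat, l.hat_comp]
        split_ifs
        · rw [← hhat]; exact m.comp_Hm _ _ p q hpq
        · rfl
      have h6 := l.hat_comp (-a) (m.comp 0 η) j i
      rw [h5, if_pos (by omega), ← hhat (m.comp 0 η), m.hat_comp, if_pos (by omega), hhat] at h6
      rw [← h6]; simp [PS.hat]
    · rw [← hhat, h0 i j h4, zero_mul]
  · rw [h1 i j h3, zero_mul]

lemma levi_central [CharZero k] (hΓ : IsSLGroup Γ) (htr : TraceNondeg Γ) (l m : PS Γ)
    (hc : m.c = l.c) (hc' : m.c' = l.c')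
    (hLP : ∀ g ∈ Γ, m.InL g → l.InP g) {g : Matrix ι ι k} (hg : g ∈ Γ) (hgm : m.InL g) : l.InL g := by
  classical
  have hhat : ∀ M, m.hat M = l.hat M := by intro M; simp [PS.hat, hc, hc']
  have hgP := hLP g hg hgm
  set g0 := l.comp 0 g with hg0
  have hg0Γ : g0 ∈ Γ := l.comp0_mem hΓ hg hgP
  have hg0l : l.Hm 0 g0 := l.comp_Hm 0 g
  have hg0m : m.Hm 0 g0 := by
    intro i j hij
    rw [hhat, hg0, l.hat_comp]
    split_ifs
    · rw [← hhat]; exact (m.inL_iff g).1 hgm i j hij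
    · rfl
  obtain ⟨hi1, hi2⟩ := slg_inv hΓ hg0Γ
  have hinvm : m.Hm 0 g0⁻¹ := by
    rw [m.Hm_zero_iff] at hg0m ⊢
    calc g0⁻¹ * m.h = g0⁻¹ * m.h * (g0 * g0⁻¹) := by rw [hi1, mul_one]
      _ = g0⁻¹ * (m.h * g0) * g0⁻¹ := by noncomm_ring
      _ = g0⁻¹ * (g0 * m.h) * g0⁻¹ := by rw [hg0m]
      _ = (g0⁻¹ * g0) * m.h * g0⁻¹ := by noncomm_ring
      _ = m.h * g0⁻¹ := by rw [hi2, one_mul]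
  set w := g0⁻¹ * g with hw
  have hwΓ : w ∈ Γ := hΓ.mul_mem _ (inv_mem' hΓ hg0Γ) _ hg
  have hwm : m.Hm 0 w := by
    have := m.Hm_mul hinvm ((m.inL_iff g).1 hgm)
    simpa using this
  have hwP : l.InP w := hLP w hwΓ ((m.inL_iff w).2 hwm)
  have hgw : g0 * w = g := by rw [hw, ← mul_assoc, hi1, one_mul]
  have hw0 : l.comp 0 w = 1 := by
    have h1 : l.comp 0 g = g0 * l.comp 0 w := by
      conv_lhs => rw [← hgw]
      rw [l.comp0_mul (fun i j hij => hg0l i j (by omega)) hwP, l.comp0_of hg0l]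
    have h2 : g0⁻¹ * g0 = g0⁻¹ * (g0 * l.comp 0 w) := by rw [← h1]
    rw [hi2, ← mul_assoc, hi2, one_mul] at h2
    exact h2.symm
  have hw1 : w = 1 := by
    by_contra hne
    let S := (Finset.univ : Finset (ι × ι)).filter (fun p => l.hat (w - 1) p.1 p.2 ≠ 0)
    have hS : S.Nonempty := by
      by_contra hS
      rw [Finset.not_nonempty_iff_eq_empty] at hS
      apply hne
      rw [← sub_eq_zero]
      apply l.hat_inj
      ext i j
      have : (i, j) ∉ S := by rw [hS]; simp
      simp only [S, Finset.mem_filter, Finset.mem_univ, true_and, not_not] at this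
      rw [this]; simp [PS.hat]
    obtain ⟨⟨i0, j0⟩, hp, hmin⟩ := S.exists_min_image (fun p => l.d p.1 - l.d p.2) hS
    simp only [S, Finset.mem_filter, Finset.mem_univ, true_and] at hp hmin
    have hblk : ∀ i j, l.d i ≤ l.d j → l.hat (w - 1) i j = 0 := by
      intro i j hij
      rw [l.hat_sub, l.hat_one, Matrix.sub_apply]
      rcases hij.lt_or_eq with h | h
      · rw [hwP i j h, Matrix.one_apply_ne (by rintro rfl; exact lt_irrefl _ h), sub_zero]
      · have h3 := l.hat_comp 0 w i j
        rw [if_pos (by omega), hw0, l.hat_one] at h3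
        rw [← h3, sub_self]
    have hpos : l.d j0 < l.d i0 := by
      by_contra h
      exact hp (hblk i0 j0 (by omega))
    obtain ⟨A, hA⟩ : ∃ A : ℕ, l.d i0 - l.d j0 = A + 1 := ⟨(l.d i0 - l.d j0 - 1).toNat, by omega⟩
    have hlt : ∀ i j, l.d i - l.d j < A + 1 → l.hat (w - 1) i j = 0 := by
      intro i j hij
      by_contra h
      have := hmin (i, j) h
      simp only at this
      omega
    let M0 : Matrix ι ι (Polynomial k) := Matrix.of fun i j => if l.d i - l.d j > A + 1 then
      Polynomial.C (l.hat w i j) * Polynomial.X ^ ((l.d i - l.d j).toNat - (A + 2)) else 0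
    have hcurve : l.cur w = 1 + (Polynomial.X : Polynomial k) ^ (A + 1) •
        ((l.comp (A + 1) w).map Polynomial.C + (Polynomial.X : Polynomial k) •
          (l.c'.map Polynomial.C * M0 * l.c.map Polynomial.C)) := by
      have h1 : (Matrix.of fun i j => Polynomial.C (l.hat w i j) * 
          (Polynomial.X : Polynomial k) ^ (l.d i - l.d j).toNat) = 
          1 + (Polynomial.X : Polynomial k) ^ (A + 1) •
        ((Matrix.of fun i j => if l.d i - l.d j = A + 1 then l.hat w i j else 0).map Polynomial.C + 
          (Polynomial.X : Polynomial k) • M0) := by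
        ext1 i j
        have h2 : l.hat w i j = (1 : Matrix ι ι k) i j + l.hat (w - 1) i j := by
          rw [l.hat_sub, l.hat_one, Matrix.sub_apply]; ring
        have hone : ∀ i j, l.d i - l.d j ≠ 0 → (1 : Matrix ι ι (Polynomial k)) i j = 0 := by
          intro i j h; rw [Matrix.one_apply_ne]; rintro rfl; exact h (by omega)
        simp only [Matrix.of_apply, Matrix.add_apply, Matrix.smul_apply, Matrix.map_apply, M0, smul_eq_mul]
        by_cases h3 : l.d i - l.d j < A + 1
        · rw [if_neg (by omega), if_neg (by omega), map_zero, mul_zero, add_zero, mul_zero, add_zero, h2,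
            hlt i j h3, add_zero]
          by_cases h4 : i = j
          · subst h4; simp
          · rw [Matrix.one_apply_ne h4, Matrix.one_apply_ne h4]; simp
        · by_cases h5 : l.d i - l.d j = A + 1
          · rw [if_pos h5, if_neg (by omega), hone i j (by omega), h5]
            have : ((A : ℤ) + 1).toNat = A + 1 := by omega
            rw [this]; ring
          · rw [if_neg h5, if_pos (by omega), hone i j (by omega), map_zero, zero_add, zero_add]
            have : (l.d i - l.d j).toNat = (A + 1) + 1 + ((l.d i - l.d j).toNat - (A + 2)) := by omega
            conv_lhs => rw [this, pow_add, pow_add]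
            ring
      have hC1 : l.c'.map Polynomial.C * l.c.map Polynomial.C = 1 := by
        rw [← Matrix.map_mul, l.hc']; simp
      rw [PS.cur, h1, PS.comp, Matrix.map_mul, Matrix.map_mul]
      simp only [mul_add, add_mul, mul_one, hC1, Matrix.mul_smul, Matrix.smul_mul, smul_add]
    have hζ := curve_lie hΓ (l.cur_mem hΓ hwΓ hwP) hcurve
    have hz := levi_pos hΓ htr l m hc hc' hLP hζ (by
      intro i j hij
      rw [hhat, l.hat_comp]
      split_ifs
      · rw [← hhat]; exact hwm i j hij
      · rfl) (by omega) (l.comp_Hm _ w)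
    have h7 := l.hat_comp (A + 1) w i0 j0
    rw [hz, if_pos hA] at h7
    apply hp
    rw [l.hat_sub, l.hat_one, Matrix.sub_apply, ← h7, Matrix.one_apply_ne (by
      rintro rfl; exact lt_irrefl _ hpos)]
    simp [PS.hat]
  rw [hw1, mul_one] at hgw
  rw [l.inL_iff, ← hgw]
  exact hg0l

end levi
end F9
end PaperGIT

namespace PaperGIT
section F10
set_option linter.unusedSectionVars false
set_option linter.unusedVariables false
open MvPolynomial
variable {k : Type} [Field k] {ι : Type} [Fintype ι] [DecidableEq ι]
variable {Γ : Set (Matrix ι ι k)}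

lemma E_tri [CharZero k] (hΓ : IsSLGroup Γ) (l m : PS Γ) (hml : ∀ g ∈ Γ, m.InP g ↔ l.InP g) (a : ℤ) :
    m.InP (l.E a) := by
  by_cases ha : a ∈ Finset.univ.image l.d
  · intro i j hij
    revert ha
    refine laurent_indep (k := k) (Finset.univ.image l.d) (fun a => m.hat (l.E a) i j) ?_ a
    intro t ht
    have h1 : l.at' t = ∑ a ∈ Finset.univ.image l.d, t ^ a • l.E a := l.diag_sum (fun a => t ^ a)
    have h2 : l.InP (l.at' t) := by
      intro i j hij
      rw [l.hat_at, Matrix.diagonal_apply_ne]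
      rintro rfl; exact lt_irrefl _ hij
    have h3 := (hml _ (l.at_mem hΓ ht)).2 h2 i j hij
    rw [h1, m.hat_sum, Matrix.sum_apply] at h3
    simpa only [m.hat_smul, Matrix.smul_apply, smul_eq_mul] using h3
  · rw [l.E_eq_zero ha]
    intro i j _
    simp [PS.hat]

lemma smul_cancel_h [CharZero k] {l : PS Γ} {v : ι → k} (h : ∀ i, l.d i ≠ 0 → l.vhat v i = 0) :
    (l.E 0).mulVec v = v := by
  apply l.vhat_inj
  rw [l.vhat_mulVec, l.hat_E]
  ext i
  rw [Matrix.mulVec_diagonal]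
  split_ifs with h1
  · rw [one_mul]
  · rw [zero_mul, h i h1]

lemma inL_congr [CharZero k] {l m : PS Γ} (h : l.h = m.h) (g : Matrix ι ι k) : l.InL g ↔ m.InL g := by
  rw [l.inL_iff, m.inL_iff, l.Hm_zero_iff, m.Hm_zero_iff, h]

theorem lim_dim_le [CharZero k] (hΓ : IsSLGroup Γ) (htr : TraceNondeg Γ) {v : ι → k} (hpr : ProperAt Γ v)
    (hcr : CRat Γ v) (l : PS Γ) {z : ι → k} (hz : l.IsLim v z) :
    Module.finrank k (orb Γ v) ≤ Module.finrank k (orb Γ z) := by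
  obtain ⟨m, hml, hHL⟩ := hcr l (fun g hg => hg.2 l hz.1)
  have hfix := lam_fix m (hpr m (fun g hg => (inP_of m (hHL g hg)).1))
    (hpr m.neg (fun g hg => (inP_of m (hHL g hg)).2))
  have hEP : ∀ a, m.InP (l.E a) := E_tri hΓ l m hml
  -- block diagonal parts
  let E' : ℤ → Matrix ι ι k := fun a => m.comp 0 (l.E a)
  have hE'mul : ∀ a b, E' a * E' b = if a = b then E' a else 0 := by
    intro a b
    simp only [E']
    rw [← m.comp0_mul (hEP a) (hEP b), l.E_mul]
    split_ifs
    · rfl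
    · exact m.comp_zero 0
  have hcomp_sum : ∀ (S : Finset ℤ) (M : ℤ → Matrix ι ι k), m.comp 0 (∑ a ∈ S, M a) = ∑ a ∈ S, m.comp 0 (M a) := by
    intro S M
    apply m.hat_inj
    ext i j
    rw [m.hat_comp, m.hat_sum, m.hat_sum, Matrix.sum_apply, Matrix.sum_apply]
    simp only [m.hat_comp]
    split_ifs
    · rfl
    · simp
  have hcomp_smul : ∀ (a : k) (M : Matrix ι ι k), m.comp 0 (a • M) = a • m.comp 0 M := by
    intro a M
    apply m.hat_inj
    ext i j
    rw [m.hat_comp, m.hat_smul, m.hat_smul, Matrix.smul_apply, Matrix.smul_apply, m.hat_comp]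
    split_ifs
    · rfl
    · simp
  have hone : m.comp 0 1 = 1 := m.comp0_of m.Hm_one
  have hE'sum : ∑ a ∈ Finset.univ.image l.d, E' a = 1 := by
    simp only [E']
    rw [← hcomp_sum, l.sum_E, hone]
  have hcomm : ∀ a b, E' a * m.E b = m.E b * E' a := by
    intro a b
    apply m.hat_inj
    rw [m.hat_mul, m.hat_mul, m.hat_E]
    ext i j
    rw [Matrix.mul_diagonal, Matrix.diagonal_mul]
    simp only [E', m.hat_comp]
    by_cases h1 : m.d i - m.d j = 0
    · rw [show m.d i = m.d j by omega, mul_comm]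
    · rw [if_neg h1]; simp
  let e : ℤ × ℤ → Matrix ι ι k := fun p => E' p.1 * m.E p.2
  let S := (Finset.univ.image l.d) ×ˢ (Finset.univ.image m.d)
  have he : ∀ p q, e p * e q = if p = q then e p else 0 := by
    intro p q
    simp only [e]
    rw [show E' p.1 * m.E p.2 * (E' q.1 * m.E q.2) = E' p.1 * (m.E p.2 * E' q.1) * m.E q.2 by noncomm_ring,
      ← hcomm, show E' p.1 * (E' q.1 * m.E p.2) * m.E q.2 = (E' p.1 * E' q.1) * (m.E p.2 * m.E q.2) by
      noncomm_ring, hE'mul, m.E_mul]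
    by_cases h1 : p.1 = q.1
    · by_cases h2 : p.2 = q.2
      · rw [if_pos h1, if_pos h2, if_pos (Prod.ext h1 h2)]
      · rw [if_neg h2, mul_zero, if_neg (fun h => h2 (congrArg Prod.snd h))]
    · rw [if_neg h1, zero_mul, if_neg (fun h => h1 (congrArg Prod.fst h))]
  have hS : ∀ f g : ℤ → k, ∑ p ∈ S, (f p.1 * g p.2) • e p =
      (∑ a ∈ Finset.univ.image l.d, f a • E' a) * (∑ b ∈ Finset.univ.image m.d, g b • m.E b) := by
    intro f g
    rw [Finset.sum_mul_sum, Finset.sum_product]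
    apply Finset.sum_congr rfl; intro a _
    apply Finset.sum_congr rfl; intro b _
    simp only [e, Matrix.smul_mul, Matrix.mul_smul, smul_smul, mul_comm]
  have hs : ∑ p ∈ S, e p = 1 := by
    have := hS (fun _ => 1) (fun _ => 1)
    simp only [one_smul, mul_one] at this
    rw [this, hE'sum, m.sum_E, one_mul]
  obtain ⟨c, c', d, hcc, hce, hcf⟩ := diag_idem S e he hs
  have hm2 : c' * Matrix.diagonal (fun i => ((d i).2 : k)) * c = m.h := by
    have h1 := hcf (fun p => (p.2 : k))
    have h2 := hS (fun _ => 1) (fun b => (b : k))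
    simp only [one_smul, one_mul] at h2
    rw [h1, h2, hE'sum, one_mul, ← m.diag_sum (fun b => (b : k))]; rfl
  have hl2 : c' * Matrix.diagonal (fun i => ((d i).1 : k)) * c = m.comp 0 l.h := by
    have h1 := hcf (fun p => (p.1 : k))
    have h2 := hS (fun b => (b : k)) (fun _ => 1)
    simp only [one_smul, mul_one] at h2
    have h3 : l.h = ∑ a ∈ Finset.univ.image l.d, (a : k) • l.E a := l.diag_sum (fun b => (b : k))
    rw [h1, h2, m.sum_E, mul_one, h3, hcomp_sum]
    simp only [hcomp_smul, E']
  let m2 : PS Γ := ⟨c, c', fun i => (d i).2, hcc, by rw [hm2]; exact m.mem⟩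
  let l2 : PS Γ := ⟨c, c', fun i => (d i).1, hcc, by rw [hl2]; exact m.comp_mem hΓ 0 l.mem⟩
  have hm2h : m2.h = m.h := hm2
  have hl2E : ∀ a, l2.E a = E' a := by
    intro a
    have h1 := hcf (fun p => if p.1 = a then 1 else 0)
    have h2 := hS (fun b => if b = a then 1 else 0) (fun _ => 1)
    simp only [one_smul, mul_one] at h2
    rw [m.sum_E, mul_one] at h2
    have h3 : l2.E a = ∑ x ∈ Finset.univ.image l.d, (if x = a then (1 : k) else 0) • E' x := by
      rw [← h2, ← h1]; rfl
    rw [h3]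
    simp only [ite_smul, one_smul, zero_smul]
    rw [Finset.sum_ite_eq']
    split_ifs with h4
    · rfl
    · simp only [E']; rw [l.E_eq_zero h4, m.comp_zero]
  have hLP : ∀ g ∈ Γ, m2.InL g → l2.InP g := by
    intro g hg hgL
    rw [inL_congr hm2h] at hgL
    have hgP := (inP_of m hgL).1
    have h1 := (l.inP_iff_E g).1 ((hml g hg).1 hgP)
    rw [l2.inP_iff_E]
    intro a b hab
    rw [hl2E, hl2E]
    have h2 := m.comp_zero 0
    have h3 : m.InP (l.E a * g) := by
      have : Tri m.d (m.hat (l.E a) * m.hat g) := Tri.mul (hEP a) hgP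
      rw [← m.hat_mul] at this
      exact this
    rw [← h1 a b hab, m.comp0_mul h3 (hEP b), m.comp0_mul (hEP a) hgP, m.comp0_of ((m.inL_iff g).1 hgL)] at h2
    rw [h2, h1 a b hab]
  have hcentral : ∀ g ∈ Hs Γ v, l2.InL g := by
    intro g hg
    exact levi_central hΓ htr l2 m2 rfl rfl hLP hg.1 ((inL_congr hm2h g).2 (hHL g hg))
  have hfix2 := lam_fix l2 (hpr l2 (fun g hg => (inP_of l2 (hcentral g hg)).1))
    (hpr l2.neg (fun g hg => (inP_of l2 (hcentral g hg)).2))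
  have hv1 : (E' 0).mulVec v = v := by rw [← hl2E]; exact smul_cancel_h hfix2
  have hzE : z = (l.E 0).mulVec v := by
    apply l.vhat_inj
    rw [l.vhat_mulVec, l.hat_E]
    ext i
    rw [Matrix.mulVec_diagonal, hz.2 i]
    split_ifs <;> simp
  have hmz : ∀ i, m.vhat z i = ∑ j, m.hat (l.E 0) i j * m.vhat v j := by
    intro i; rw [hzE, m.vhat_mulVec]; rfl
  have hmv : ∀ i, m.vhat v i = ∑ j, m.hat (E' 0) i j * m.vhat v j := by
    intro i
    conv_lhs => rw [← hv1, m.vhat_mulVec]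
    rfl
  refine finrank_lim_le hΓ m (v := z) (z := v) ⟨?_, ?_⟩
  · intro i hi
    rw [hmz]
    apply Finset.sum_eq_zero
    intro j _
    by_cases hj : m.d j = 0
    · rw [hEP 0 i j (by omega), zero_mul]
    · rw [hfix j hj, mul_zero]
  · intro i
    split_ifs with hi
    · rw [hmv, hmz]
      apply Finset.sum_congr rfl
      intro j _
      by_cases hj : m.d j = 0
      · simp only [E']
        rw [m.hat_comp, if_pos (by omega)]
      · rw [hfix j hj, mul_zero, mul_zero]
    · exact hfix i hi

end F10
end PaperGIT

namespace PaperGIT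
section F11
set_option linter.unusedSectionVars false
set_option linter.unusedVariables false
open MvPolynomial
variable {k : Type} [Field k] {ι : Type} [Fintype ι] [DecidableEq ι]

abbrev KK (k : Type) [Field k] : Type := FractionRing (PowerSeries k)

noncomputable def psi (k : Type) [Field k] : PowerSeries k →ₐ[k] KK k :=
  IsScalarTower.toAlgHom k (PowerSeries k) (KK k)

lemma psi_inj : Function.Injective (psi k) := IsFractionRing.injective (PowerSeries k) (KK k)

noncomputable def TT (k : Type) [Field k] : KK k := psi k PowerSeries.X

lemma TT_ne : TT k ≠ 0 := by
  intro h
  exact PowerSeries.X_ne_zero (psi_inj (h.trans (map_zero _).symm))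

lemma psi_ne {f : PowerSeries k} (h : f ≠ 0) : psi k f ≠ 0 := fun h' => h (psi_inj (h'.trans (map_zero _).symm))

lemma ps_eq (f : PowerSeries k) (hf : f ≠ 0) : ∃ (n : ℕ) (u : PowerSeries k), IsUnit u ∧ f = PowerSeries.X ^ n * u := by
  obtain ⟨n, u, h⟩ := IsDiscreteValuationRing.eq_unit_mul_pow_irreducible hf (PowerSeries.X_prime (R := k)).irreducible
  exact ⟨n, u, u.isUnit, by rw [h, mul_comm]⟩

lemma kk_eq (x : KK k) (hx : x ≠ 0) : ∃ (n : ℤ) (u : PowerSeries k), IsUnit u ∧ x = TT k ^ n * psi k u := by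
  obtain ⟨a, b, hb, rfl⟩ := IsFractionRing.div_surjective (A := PowerSeries k) x
  have hb0 : b ≠ 0 := nonZeroDivisors.ne_zero hb
  have ha0 : a ≠ 0 := by rintro rfl; simp at hx
  obtain ⟨n, u, hu, rfl⟩ := ps_eq a ha0
  obtain ⟨m, w, hw, rfl⟩ := ps_eq b hb0
  obtain ⟨w', hw'⟩ := hw.exists_right_inv
  refine ⟨(n : ℤ) - m, u * w', hu.mul ⟨⟨w', w, by rw [mul_comm, hw'], hw'⟩, rfl⟩, ?_⟩
  change psi k _ / psi k _ = _
  have h1 : psi k w * psi k w' = 1 := by rw [← map_mul, hw', map_one]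
  have hT := TT_ne (k := k)
  have hw0 : psi k w ≠ 0 := left_ne_zero_of_mul_eq_one h1
  rw [map_mul, map_mul, map_mul, map_pow, map_pow, zpow_sub₀ hT, zpow_natCast, zpow_natCast]
  change TT k ^ n * _ / (TT k ^ m * _) = _
  field_simp
  rw [mul_assoc, h1, mul_one]

/-- integrality -/
def Int' (x : KK k) : Prop := ∃ f, x = psi k f

lemma zpow_psi {n : ℤ} (hn : 0 ≤ n) : TT k ^ n = psi k (PowerSeries.X ^ n.toNat) := by
  rw [map_pow]
  change _ = TT k ^ n.toNat
  rw [← zpow_natCast, Int.toNat_of_nonneg hn]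

lemma const_pos {d : ℤ} (hd : 0 < d) {f s : PowerSeries k} (h : TT k ^ d * psi k f = psi k s) :
    PowerSeries.constantCoeff s = 0 := by
  rw [zpow_psi hd.le, ← map_mul] at h
  rw [← psi_inj h]
  have : d.toNat ≠ 0 := by omega
  simp [this]

lemma const_neg {d : ℤ} (hd : d < 0) {f s : PowerSeries k} (h : TT k ^ d * psi k f = psi k s) :
    PowerSeries.constantCoeff f = 0 := by
  refine const_pos (d := -d) (by omega) (f := s) ?_
  rw [← h, ← mul_assoc, ← zpow_add₀ TT_ne]; simp

lemma const_zero {f s : PowerSeries k} (h : TT k ^ (0 : ℤ) * psi k f = psi k s) : f = s := by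
  rw [zpow_zero, one_mul] at h; exact psi_inj h

lemma prim {σ : Type} [Fintype σ] (α : σ → KK k) (h : α ≠ 0) :
    ∃ (n : ℤ) (β : σ → PowerSeries k), (∀ i, α i = TT k ^ n * psi k (β i)) ∧
      ∃ i, PowerSeries.constantCoeff (β i) ≠ 0 := by
  classical
  have key : ∀ i, ∃ (n : ℤ) (u : PowerSeries k), (α i ≠ 0 → IsUnit u ∧ α i = TT k ^ n * psi k u) := by
    intro i
    by_cases h : α i = 0
    · exact ⟨0, 0, fun h' => absurd h h'⟩
    · obtain ⟨n, u, hu⟩ := kk_eq _ h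
      exact ⟨n, u, fun _ => hu⟩
  choose n u hu using key
  let S := Finset.univ.filter (fun i => α i ≠ 0)
  have hS : S.Nonempty := by
    by_contra hS
    apply h; funext i
    by_contra hi
    exact hS ⟨i, by simp [S]; exact hi⟩
  obtain ⟨i0, hi0, hmin⟩ := S.exists_min_image n hS
  refine ⟨n i0, fun i => if α i = 0 then 0 else PowerSeries.X ^ (n i - n i0).toNat * u i, ?_, i0, ?_⟩
  · intro i
    by_cases hi : α i = 0
    · simp [hi]
    · simp only [hi, if_false]
      have := hmin i (by simp [S]; exact hi)
      conv_lhs => rw [(hu i hi).2]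
      rw [map_mul, ← zpow_psi (by omega), ← mul_assoc, ← zpow_add₀ TT_ne]
      congr 2; omega
  · have h0 : α i0 ≠ 0 := by simpa [S] using hi0
    simp only [h0, if_false]
    have := (hu i0 h0).1
    simpa using (PowerSeries.isUnit_iff_constantCoeff.1 this).ne_zero

/-- the derivation -/
noncomputable def dHom (k : Type) [Field k] : PowerSeries k →+* DualNumber (KK k) where
  toFun f := TrivSqZeroExt.inl (psi k f) + TrivSqZeroExt.inr (psi k (PowerSeries.derivative k f))
  map_one' := by simp
  map_zero' := by simp
  map_add' := by
    intro x y
    ext <;> simp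
  map_mul' := by
    intro x y
    ext <;> simp [Derivation.leibniz]
    ring

lemma dHom_unit (y : nonZeroDivisors (PowerSeries k)) : IsUnit (dHom k y) := by
  rw [TrivSqZeroExt.isUnit_iff_isUnit_fst]
  simp only [dHom]
  simpa using (psi_ne (nonZeroDivisors.ne_zero y.2))

noncomputable def dLift (k : Type) [Field k] : KK k →+* DualNumber (KK k) :=
  IsLocalization.lift (M := nonZeroDivisors (PowerSeries k)) (dHom_unit)

lemma dLift_psi (f : PowerSeries k) : dLift k (psi k f) = dHom k f :=
  IsLocalization.lift_eq (M := nonZeroDivisors (PowerSeries k)) _ f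

lemma dLift_fst (x : KK k) : (dLift k x).fst = x := by
  have : ((TrivSqZeroExt.fstHom (KK k) (KK k) (KK k)).toRingHom.comp (dLift k)) = RingHom.id _ := by
    apply IsLocalization.ringHom_ext (M := nonZeroDivisors (PowerSeries k))
    ext f
    change (dLift k (psi k f)).fst = psi k f
    rw [dLift_psi]; simp [dHom]
  exact RingHom.congr_fun this x

noncomputable def DK (k : Type) [Field k] : Derivation k (KK k) (KK k) :=
  Derivation.mk' 
    { toFun := fun x => (dLift k x).snd
      map_add' := by intro x y; simp
      map_smul' := by
        intro c x
        have h1 : c • x = psi k (PowerSeries.C c) * x := by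
          rw [Algebra.smul_def]; congr 1
        rw [h1, map_mul, dLift_psi, Algebra.smul_def]
        have h2 : psi k (PowerSeries.C c) = algebraMap k (KK k) c := (psi k).commutes c
        have h3 : PowerSeries.derivative k (PowerSeries.C c) = 0 := by
          simp
        simp [dHom, h2, h3] }
    (by
      intro x y
      change (dLift k (x * y)).snd = _
      rw [map_mul, TrivSqZeroExt.snd_mul, dLift_fst, dLift_fst]
      simp [mul_comm])

lemma DK_psi (f : PowerSeries k) : DK k (psi k f) = psi k (PowerSeries.derivative k f) := by
  change (dLift k (psi k f)).snd = _
  rw [dLift_psi]; simp [dHom]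

lemma DK_T : DK k (TT k) = 1 := by
  rw [TT, DK_psi]
  have : PowerSeries.derivative k (PowerSeries.X : PowerSeries k) = 1 := by
    simp
  rw [this, map_one]

lemma T_DK_zpow (n : ℤ) : TT k * DK k (TT k ^ n) = (n : KK k) * TT k ^ n := by
  have hT := TT_ne (k := k)
  have hnat : ∀ n : ℕ, TT k * DK k (TT k ^ n) = (n : KK k) * TT k ^ n := by
    intro n
    rw [Derivation.leibniz_pow, DK_T]
    cases n with
    | zero => simp
    | succ n => simp [pow_succ]; ring
  obtain ⟨m, rfl | rfl⟩ := n.eq_nat_or_neg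
  · simpa using hnat m
  · rw [zpow_neg, zpow_natCast, Derivation.leibniz_inv]
    have h := hnat m
    simp only [smul_eq_mul]
    have h2 : TT k * (-(TT k ^ m)⁻¹ ^ 2 * DK k (TT k ^ m)) = -(TT k ^ m)⁻¹ ^ 2 * (TT k * DK k (TT k ^ m)) := by ring
    rw [h2, h]
    field_simp
    push_cast; ring

end F11
end PaperGIT

namespace PaperGIT
section F12
set_option linter.unusedSectionVars false
set_option linter.unusedVariables false
open MvPolynomial
variable {k : Type} [Field k] {ι : Type} [Fintype ι] [DecidableEq ι]

lemma smith0 (G : Matrix ι ι (PowerSeries k)) (hG : G.det ≠ 0) :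
    ∃ (a a' b b' : Matrix ι ι (PowerSeries k)) (d : ι → ℕ), a * a' = 1 ∧ b * b' = 1 ∧
      G = a * Matrix.diagonal (fun i => PowerSeries.X ^ d i) * b := by
  have hinj : Function.Injective G.mulVecLin := by
    rw [← LinearMap.ker_eq_bot, LinearMap.ker_eq_bot']
    intro m hm
    exact Matrix.eq_zero_of_mulVec_eq_zero hG hm
  let e := LinearEquiv.ofInjective G.mulVecLin hinj
  have hr : Module.finrank (PowerSeries k) (LinearMap.range G.mulVecLin) = Module.finrank (PowerSeries k) (ι → PowerSeries k) :=
    (LinearEquiv.finrank_eq e).symm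
  obtain ⟨b', A, ab', h⟩ := Submodule.exists_smith_normal_form_of_rank_eq (Pi.basisFun (PowerSeries k) ι) hr
  let P := ab'.map e.symm
  have hP : ∀ i, G.mulVec (P i) = A i • b' i := by
    intro i
    rw [← h i]
    have : e (P i) = ab' i := by simp [P]
    rw [← this]; rfl
  have hA : ∀ i, A i ≠ 0 := by
    intro i hi
    have h1 := h i
    rw [hi, zero_smul] at h1
    exact ab'.ne_zero i (Subtype.ext h1)
  choose n u hu hn using fun i => ps_eq (A i) (hA i)
  choose w hw using fun i => (hu i).exists_right_inv
  let s := Pi.basisFun (PowerSeries k) ι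
  let Pm := s.toMatrix P
  let Pm' := P.toMatrix s
  let B := s.toMatrix b'
  let B' := b'.toMatrix s
  have e1 : Pm * Pm' = 1 := s.toMatrix_mul_toMatrix_flip P
  have e2 : Pm' * Pm = 1 := P.toMatrix_mul_toMatrix_flip s
  have e3 : B * B' = 1 := s.toMatrix_mul_toMatrix_flip b'
  have e4 : G * Pm = B * Matrix.diagonal A := by
    ext i j
    rw [Matrix.mul_diagonal]
    have := congrFun (hP j) i
    have h2 : (G * Pm) i j = G.mulVec (P j) i := by
      simp [Matrix.mul_apply, Matrix.mulVec, dotProduct, Pm, s, Module.Basis.toMatrix_apply]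
    rw [h2, this]
    simp [B, s, Module.Basis.toMatrix_apply, mul_comm]
  refine ⟨B, B', Matrix.diagonal u * Pm', Pm * Matrix.diagonal w, n, e3, ?_, ?_⟩
  · have : Matrix.diagonal u * Matrix.diagonal w = 1 := by
      rw [Matrix.diagonal_mul_diagonal]; simp [hw]
    rw [show Matrix.diagonal u * Pm' * (Pm * Matrix.diagonal w) = Matrix.diagonal u * (Pm' * Pm) * Matrix.diagonal w by
      simp only [Matrix.mul_assoc], e2, Matrix.mul_one, this]
  · have h5 : Matrix.diagonal A = Matrix.diagonal (fun i => (PowerSeries.X : PowerSeries k) ^ n i) * Matrix.diagonal u := by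
      rw [Matrix.diagonal_mul_diagonal]; congr 1; funext i; exact hn i
    calc G = G * Pm * Pm' := by rw [Matrix.mul_assoc, e1, Matrix.mul_one]
      _ = _ := by rw [e4, h5]; simp only [Matrix.mul_assoc]

lemma smith (g : Matrix ι ι (KK k)) (hg : g.det ≠ 0) :
    ∃ (a a' b b' : Matrix ι ι (PowerSeries k)) (d : ι → ℤ), a * a' = 1 ∧ b * b' = 1 ∧
      g = a.map (psi k) * Matrix.diagonal (fun i => TT k ^ d i) * b.map (psi k) := by
  have h1 : ∃ (n : ℤ) (G : Matrix ι ι (PowerSeries k)), g = TT k ^ n • G.map (psi k) := by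
    by_cases h : (fun p : ι × ι => g p.1 p.2) = 0
    · refine ⟨0, 0, ?_⟩
      ext i j
      simpa using congrFun h (i, j)
    · obtain ⟨n, β, hβ, -⟩ := prim _ h
      refine ⟨n, Matrix.of fun i j => β (i, j), ?_⟩
      ext i j
      simpa using hβ (i, j)
  obtain ⟨n, G, rfl⟩ := h1
  have hG : G.det ≠ 0 := by
    intro h0
    apply hg
    rw [Matrix.det_smul]
    have : (G.map (psi k)).det = psi k G.det := ((psi k).toRingHom.map_det G).symm
    rw [this, h0, map_zero, mul_zero]
  obtain ⟨a, a', b, b', d, ha, hb, h⟩ := smith0 G hG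
  refine ⟨a, a', b, b', fun i => n + d i, ha, hb, ?_⟩
  conv_lhs => rw [h]
  rw [Matrix.map_mul, Matrix.map_mul, Matrix.diagonal_map (map_zero _)]
  have : Matrix.diagonal (fun i => TT k ^ (n + (d i : ℤ))) = TT k ^ n • Matrix.diagonal (fun i => psi k (PowerSeries.X ^ d i)) := by
    rw [← Matrix.diagonal_smul]
    congr 1; funext i
    simp only [Pi.smul_apply, smul_eq_mul]
    rw [zpow_add₀ TT_ne, zpow_natCast, map_pow]; rfl
  rw [this]
  simp
end F12
end PaperGIT

namespace PaperGIT
section F13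
set_option linter.unusedSectionVars false
set_option linter.unusedVariables false
open MvPolynomial
variable {k : Type} [Field k] {ι : Type} [Fintype ι] [DecidableEq ι]
variable {Γ : Set (Matrix ι ι k)}

noncomputable def Phi (k ι : Type) [Field k] [Fintype ι] [DecidableEq ι] :
    Matrix ι ι (PowerSeries k) →ₐ[k] Matrix ι ι (KK k) := (psi k).mapMatrix

noncomputable def kap (k ι : Type) [Field k] [Fintype ι] [DecidableEq ι] :
    Matrix ι ι (PowerSeries k) →+* Matrix ι ι k := (PowerSeries.constantCoeff (R := k)).mapMatrix

noncomputable def Jo (k ι : Type) [Field k] [Fintype ι] [DecidableEq ι] :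
    Matrix ι ι k →+* Matrix ι ι (PowerSeries k) := (algebraMap k (PowerSeries k)).mapMatrix

lemma Phi_apply (M : Matrix ι ι (PowerSeries k)) : Phi k ι M = M.map (psi k) := rfl
lemma kap_apply (M : Matrix ι ι (PowerSeries k)) : kap k ι M = M.map PowerSeries.constantCoeff := rfl
lemma Jo_apply (M : Matrix ι ι k) : Jo k ι M = M.map (algebraMap k (PowerSeries k)) := rfl

lemma Phi_inj : Function.Injective (Phi k ι) := by
  intro M N h
  ext1 i j
  exact psi_inj (congrFun (congrFun h i) j)

lemma kap_Jo (M : Matrix ι ι k) : kap k ι (Jo k ι M) = M := by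
  ext i j
  rw [kap_apply, Jo_apply]
  simp [PowerSeries.algebraMap_apply]

lemma Phi_Jo (M : Matrix ι ι k) : Phi k ι (Jo k ι M) = M.map (algebraMap k (KK k)) := by
  ext i j
  exact (psi k).commutes _

lemma Phi_X (M : Matrix ι ι (PowerSeries k)) : Phi k ι ((PowerSeries.X : PowerSeries k) • M) = TT k • Phi k ι M := by
  ext i j
  exact map_mul (psi k) _ _

lemma kap_X (M : Matrix ι ι (PowerSeries k)) : kap k ι ((PowerSeries.X : PowerSeries k) • M) = 0 := by
  ext i j
  rw [kap_apply]
  simp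

lemma exists_shift (M : Matrix ι ι (PowerSeries k)) : ∃ B, M = Jo k ι (kap k ι M) + (PowerSeries.X : PowerSeries k) • B := by
  refine ⟨Matrix.of fun i j => PowerSeries.mk fun p => PowerSeries.coeff (p + 1) (M i j), ?_⟩
  ext1 i j
  rw [Matrix.add_apply, Matrix.smul_apply, Jo_apply, kap_apply, Matrix.map_apply, Matrix.map_apply, Matrix.of_apply]
  rw [smul_eq_mul]
  have := PowerSeries.eq_X_mul_shift_add_const (M i j)
  rw [add_comm]
  exact this

lemma map_mul_der {R : Type} [CommRing R] [Algebra k R] (D : Derivation k R R) (M N : Matrix ι ι R) :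
    (M * N).map D = M.map D * N + M * N.map D := by
  ext i j
  simp only [Matrix.map_apply, Matrix.mul_apply, Matrix.add_apply, map_sum, Derivation.leibniz, smul_eq_mul]
  rw [← Finset.sum_add_distrib]
  apply Finset.sum_congr rfl
  intro x _; ring

lemma proj_map {n : ℕ} (b b' : Fin n → Matrix ι ι k) {R S : Type} [CommRing R] [Algebra k R] [CommRing S] [Algebra k S]
    (φ : R →ₐ[k] S) (M : Matrix ι ι R) : (proj b b' R M).map φ = proj b b' S (M.map φ) := by
  rw [proj_apply, proj_apply]
  have h0 : ∀ N : Matrix ι ι k, (N.map (algebraMap k R)).map φ = N.map (algebraMap k S) := by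
    intro N; ext i j; simp
  have h1 : ∀ i, (M.map φ * (b' i).map (algebraMap k S)).trace = φ (M * (b' i).map (algebraMap k R)).trace := by
    intro i
    rw [← h0, ← Matrix.map_mul]
    simp only [Matrix.trace, Matrix.diag_apply, Matrix.map_apply, map_sum]
  simp only [h1]
  ext i j
  simp [Matrix.sum_apply]

lemma proj_Phi {n : ℕ} (b b' : Fin n → Matrix ι ι k) (M : Matrix ι ι (PowerSeries k)) :
    Phi k ι (proj b b' _ M) = proj b b' _ (Phi k ι M) := proj_map b b' (psi k) M

lemma proj_Jo {n : ℕ} (b b' : Fin n → Matrix ι ι k) (M : Matrix ι ι k) :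
    Jo k ι (proj b b' _ M) = proj b b' _ (Jo k ι M) := proj_map b b' (Algebra.ofId k (PowerSeries k)) M

lemma proj_kap {n : ℕ} (b b' : Fin n → Matrix ι ι k) (M : Matrix ι ι (PowerSeries k)) :
    kap k ι (proj b b' _ M) = proj b b' _ (kap k ι M) := 
  proj_map b b' (⟨PowerSeries.constantCoeff, by intro r; simp [PowerSeries.algebraMap_apply]⟩ : PowerSeries k →ₐ[k] k) M

/-- the data of a Smith decomposition -/
structure Sm (g : Matrix ι ι (KK k)) (a a' b b' : Matrix ι ι (PowerSeries k)) (d : ι → ℤ) : Prop where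
  ha : a * a' = 1
  hb : b * b' = 1
  hg : g = Phi k ι a * Matrix.diagonal (fun i => TT k ^ d i) * Phi k ι b

namespace Sm
variable {g : Matrix ι ι (KK k)} {a a' b b' : Matrix ι ι (PowerSeries k)} {d : ι → ℤ}

lemma ha' (h : Sm g a a' b b' d) : a' * a = 1 := mul_eq_one_comm.1 h.ha
lemma hb' (h : Sm g a a' b b' d) : b' * b = 1 := mul_eq_one_comm.1 h.hb

lemma del (d : ι → ℤ) : (Matrix.diagonal (fun i => TT k ^ d i) : Matrix ι ι (KK k)) * Matrix.diagonal (fun i => TT k ^ (- d i)) = 1 := by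
  rw [Matrix.diagonal_mul_diagonal]
  have : ∀ i, TT k ^ d i * TT k ^ (- d i) = 1 := by
    intro i; rw [← zpow_add₀ TT_ne]; simp
  simp only [this]
  exact Matrix.diagonal_one

lemma inv (h : Sm g a a' b b' d) : g⁻¹ = Phi k ι b' * Matrix.diagonal (fun i => TT k ^ (- d i)) * Phi k ι a' := by
  apply Matrix.inv_eq_right_inv
  rw [h.hg]
  calc _ = Phi k ι a * (Matrix.diagonal (fun i => TT k ^ d i) * (Phi k ι b * Phi k ι b') * Matrix.diagonal (fun i => TT k ^ (- d i))) * Phi k ι a' := by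
        noncomm_ring
    _ = 1 := by rw [← map_mul, h.hb, map_one, mul_one, del, mul_one, ← map_mul, h.ha, map_one]

lemma omega [CharZero k] (h : Sm g a a' b b' d) : TT k • (g⁻¹ * g.map (DK k)) =
    TT k • (g⁻¹ * Phi k ι (a.map (PowerSeries.derivative k) * a') * g)
      + Phi k ι (b' * Jo k ι (Matrix.diagonal fun i => (d i : k)) * b)
      + TT k • Phi k ι (b' * b.map (PowerSeries.derivative k)) := by
  have hΦ : ∀ M : Matrix ι ι (PowerSeries k), (Phi k ι M).map (DK k) = Phi k ι (M.map (PowerSeries.derivative k)) := by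
    intro M; ext i j; exact DK_psi _
  set Δ : Matrix ι ι (KK k) := Matrix.diagonal (fun i => TT k ^ d i) with hΔ
  set Δ' : Matrix ι ι (KK k) := Matrix.diagonal (fun i => TT k ^ (-d i)) with hΔ'
  have h1 : TT k • Δ.map (DK k) = Δ * Phi k ι (Jo k ι (Matrix.diagonal fun i => (d i : k))) := by
    rw [Phi_Jo, Matrix.diagonal_map (map_zero _), hΔ, Matrix.diagonal_map (map_zero _), Matrix.diagonal_mul_diagonal,
      ← Matrix.diagonal_smul]
    congr 1; funext i
    have := T_DK_zpow (k := k) (d i)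
    simp only [Pi.smul_apply, smul_eq_mul, this]
    simp [mul_comm]
  have h2 : g.map (DK k) = Phi k ι (a.map (PowerSeries.derivative k)) * Δ * Phi k ι b + Phi k ι a * Δ.map (DK k) * Phi k ι b
      + Phi k ι a * Δ * Phi k ι (b.map (PowerSeries.derivative k)) := by
    rw [h.hg, map_mul_der, map_mul_der, hΦ, hΦ]
    noncomm_ring
  have hda : Δ' * Δ = 1 := mul_eq_one_comm.1 (del d)
  have e1 : Phi k ι a' * Phi k ι a = 1 := by rw [← map_mul, h.ha', map_one]
  have e2 : g⁻¹ * (Phi k ι a * Δ) = Phi k ι b' := by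
    rw [h.inv]
    calc _ = Phi k ι b' * (Δ' * (Phi k ι a' * Phi k ι a) * Δ) := by noncomm_ring
      _ = _ := by rw [e1, mul_one, hda, mul_one]
  have e3 : Phi k ι (a.map (PowerSeries.derivative k)) * Δ * Phi k ι b = Phi k ι (a.map (PowerSeries.derivative k) * a') * g := by
    rw [h.hg, map_mul]
    calc _ = Phi k ι (a.map (PowerSeries.derivative k)) * 1 * Δ * Phi k ι b := by rw [mul_one]
      _ = _ := by rw [← e1]; noncomm_ring
  rw [h2, e3, mul_add, mul_add, smul_add, smul_add, ← mul_assoc, ← mul_assoc g⁻¹ (Phi k ι a * Δ), e2, map_mul (Phi k ι) b']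
  congr 2
  calc TT k • (g⁻¹ * (Phi k ι a * Δ.map (DK k) * Phi k ι b)) = g⁻¹ * (Phi k ι a * (TT k • Δ.map (DK k)) * Phi k ι b) := by
        simp
    _ = (g⁻¹ * (Phi k ι a * Δ)) * Phi k ι (Jo k ι (Matrix.diagonal fun i => (d i : k))) * Phi k ι b := by
        rw [h1]; noncomm_ring
    _ = _ := by rw [e2, map_mul, map_mul]

/-- entrywise valuation argument -/
lemma entry (d : ι → ℤ) {M m q : Matrix ι ι (PowerSeries k)}
    (h : Phi k ι M = TT k • (Matrix.diagonal (fun i => TT k ^ (- d i)) * Phi k ι m * Matrix.diagonal (fun i => TT k ^ d i))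
      + TT k • Phi k ι q) : STri d (kap k ι M) := by
  intro i j hij
  have h1 := congrFun (congrFun h i) j
  rw [Matrix.add_apply, Matrix.smul_apply, Matrix.smul_apply, Matrix.mul_diagonal, Matrix.diagonal_mul, Phi_apply, Phi_apply,
    Phi_apply, Matrix.map_apply, Matrix.map_apply, Matrix.map_apply, smul_eq_mul, smul_eq_mul] at h1
  have h2 : TT k ^ (1 - d i + d j) * psi k (m i j) = psi k (M i j - PowerSeries.X * q i j) := by
    rw [map_sub, h1, map_mul, zpow_add₀ TT_ne, sub_eq_add_neg, zpow_add₀ TT_ne, zpow_one]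
    change _ = _ - TT k * _
    ring
  have h3 := const_pos (by omega) h2
  rw [map_sub, map_mul, PowerSeries.constantCoeff_X, zero_mul, sub_zero] at h3
  exact h3

lemma alg1 {R : Type} [Ring R] (b b' D' a' A a D : R) (h : b * b' = 1) :
    b * (b' * D' * a' * A * (a * D * b)) * b' = D' * (a' * A * a) * D := by
  calc _ = (b * b') * D' * a' * A * a * D * (b * b') := by noncomm_ring
      _ = _ := by rw [h, mul_one, one_mul]; noncomm_ring

lemma cur_N [CharZero k] (hΓ : IsSLGroup Γ) {n : ℕ} {β β' : Fin n → Matrix ι ι k} (hd : DualPair Γ β β')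
    (hgm : g ∈ pts Γ (KK k)) (h : Sm g a a' b b' d) :
    STri d (kap k ι b * proj β β' k (kap k ι b' * Matrix.diagonal (fun i => (d i : k)) * kap k ι b) * kap k ι b'
      - Matrix.diagonal (fun i => (d i : k))) := by
  set D0 : Matrix ι ι k := Matrix.diagonal (fun i => (d i : k)) with hD0
  set H := kap k ι b' * D0 * kap k ι b with hH
  obtain ⟨B2, hB2⟩ := exists_shift (b' * Jo k ι D0 * b)
  have hk : kap k ι (b' * Jo k ι D0 * b) = H := by rw [map_mul, map_mul, kap_Jo]
  rw [hk] at hB2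
  set A := a.map (PowerSeries.derivative k) * a' with hA
  set B3 := B2 + b' * b.map (PowerSeries.derivative k) with hB3
  have hgu := pts_isUnit hΓ hgm
  have om : TT k • (g⁻¹ * g.map (DK k)) = TT k • (g⁻¹ * Phi k ι A * g) + Phi k ι (Jo k ι H) + TT k • Phi k ι B3 := by
    rw [h.omega, hB2, hB3, map_add, map_add, Phi_X, smul_add]
    abel
  have om2 : TT k • (g⁻¹ * g.map (DK k)) = TT k • (g⁻¹ * Phi k ι (proj β β' _ A) * g) + Phi k ι (Jo k ι (proj β β' _ H))
      + TT k • Phi k ι (proj β β' _ B3) := by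
    have hm : TT k • (g⁻¹ * g.map (DK k)) ∈ lie Γ (KK k) := Submodule.smul_mem _ _ (lie_log' hΓ _ hgm)
    rw [← proj_of_mem hd hm, om, map_add, map_add, map_smul, map_smul]
    have hc := proj_conj hΓ hd (pts_inv hΓ hgm) (Phi k ι A)
    rw [Matrix.nonsing_inv_nonsing_inv _ hgu] at hc
    rw [← hc, proj_Phi, proj_Jo, proj_Phi, proj_Phi]
  have key : Phi k ι (Jo k ι (proj β β' _ H) - Jo k ι H) = TT k • (g⁻¹ * Phi k ι (A - proj β β' _ A) * g)
      + TT k • Phi k ι (B3 - proj β β' _ B3) := by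
    have := om.symm.trans om2
    rw [map_sub, map_sub, map_sub, mul_sub, sub_mul, smul_sub, smul_sub]
    rw [← sub_eq_zero] at this ⊢
    rw [← neg_eq_zero, ← this]
    abel
  have hbb : Phi k ι b * Phi k ι b' = 1 := by rw [← map_mul, h.hb, map_one]
  have key2 : Phi k ι (b * (Jo k ι (proj β β' _ H) - Jo k ι H) * b') =
      TT k • (Matrix.diagonal (fun i => TT k ^ (- d i)) * Phi k ι (a' * (A - proj β β' _ A) * a) * Matrix.diagonal (fun i => TT k ^ d i))
      + TT k • Phi k ι (b * (B3 - proj β β' _ B3) * b') := by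
    rw [map_mul, map_mul, key, mul_add, add_mul, Matrix.mul_smul, Matrix.mul_smul, Matrix.smul_mul, Matrix.smul_mul,
      map_mul _ (b * _), map_mul _ b]
    congr 2
    rw [h.inv]
    conv_lhs => rw [h.hg]
    rw [map_mul (Phi k ι) _ a, map_mul (Phi k ι) a']
    exact alg1 _ _ _ _ _ _ _ hbb
  have hst := entry d key2
  rw [map_mul, map_mul, map_sub, kap_Jo, kap_Jo] at hst
  have hkb : kap k ι b * kap k ι b' = 1 := by rw [← map_mul, h.hb, map_one]
  have : kap k ι b * H * kap k ι b' = D0 := by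
    rw [hH]
    calc _ = (kap k ι b * kap k ι b') * D0 * (kap k ι b * kap k ι b') := by noncomm_ring
      _ = _ := by rw [hkb, mul_one, one_mul]
  rw [mul_sub, sub_mul, this] at hst
  exact hst
end Sm
end F13
end PaperGIT

namespace PaperGIT
section F14
set_option linter.unusedSectionVars false
set_option linter.unusedVariables false
open MvPolynomial
variable {k : Type} [Field k] {ι : Type} [Fintype ι] [DecidableEq ι]
variable {Γ : Set (Matrix ι ι k)}

namespace Sm
variable {g : Matrix ι ι (KK k)} {a a' b b' : Matrix ι ι (PowerSeries k)} {d : ι → ℤ}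

/-- conjugating a triangular matrix by the diagonal gives an integral matrix -/
lemma tri_int (d : ι → ℤ) {n : Matrix ι ι k} (hn : STri d (n - 1)) : ∃ m : Matrix ι ι (PowerSeries k),
    Phi k ι m = Matrix.diagonal (fun i => TT k ^ d i) * Phi k ι (Jo k ι n) * Matrix.diagonal (fun i => TT k ^ (- d i)) := by
  refine ⟨Matrix.of fun i j => if d j ≤ d i then PowerSeries.X ^ (d i - d j).toNat * algebraMap k _ (n i j) else 0, ?_⟩
  ext1 i j
  rw [Matrix.mul_diagonal, Matrix.diagonal_mul, Phi_apply, Phi_apply, Matrix.map_apply, Matrix.map_apply, Jo_apply,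
    Matrix.map_apply, Matrix.of_apply]
  split_ifs with h
  · rw [map_mul, ← zpow_psi (by omega), sub_eq_add_neg, zpow_add₀ TT_ne]; ring
  · rw [Tri.of_sub_one hn i j (by omega)]; simp

lemma alg2 {R : Type} [Ring R] {D D' n n' : R} (h1 : D' * D = 1) (h2 : n * n' = 1) (h3 : D * D' = 1) :
    (D * n * D') * (D * n' * D') = 1 := by
  calc _ = D * n * (D' * D) * n' * D' := by noncomm_ring
    _ = D * (n * n') * D' := by rw [h1]; noncomm_ring
    _ = 1 := by rw [h2, mul_one, h3]

lemma alg3 {R : Type} [Ring R] {D D' n n' a b : R} (h1 : D' * D = 1) (h2 : n * n' = 1) :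
    a * (D * n * D') * D * (n' * b) = a * D * b := by
  calc _ = a * D * n * (D' * D) * n' * b := by noncomm_ring
    _ = a * D * (n * n') * b := by rw [h1]; noncomm_ring
    _ = _ := by rw [h2, mul_one]

lemma nice [CharZero k] (hΓ : IsSLGroup Γ) (htr : TraceNondeg Γ)
    (hgm : g ∈ pts Γ (KK k)) : ∃ (a a' b b' : Matrix ι ι (PowerSeries k)) (l : PS Γ), Sm g a a' b b' l.d ∧
      l.c = kap k ι b ∧ l.c' = kap k ι b' := by
  obtain ⟨nn, β, β', hd⟩ := exists_dualPair htr
  obtain ⟨a, a', b, b', d, ha, hb, hg⟩ := smith g (pts_isUnit hΓ hgm).ne_zero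
  have hS : Sm g a a' b b' d := ⟨ha, hb, hg⟩
  have hN := hS.cur_N hΓ hd hgm
  set D0 : Matrix ι ι k := Matrix.diagonal (fun i => (d i : k)) with hD0
  set h := proj β β' k (kap k ι b' * D0 * kap k ι b) with hh
  obtain ⟨n, n', hnn, hn1, hn1', hn⟩ := unip d _ hN
  rw [← hD0, add_sub_cancel] at hn
  have hn'n : n' * n = 1 := mul_eq_one_comm.1 hnn
  have hkb : kap k ι b * kap k ι b' = 1 := by rw [← map_mul, hS.hb, map_one]
  have hkb' : kap k ι b' * kap k ι b = 1 := by rw [← map_mul, hS.hb', map_one]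
  have hmem : (kap k ι b' * n) * D0 * (n' * kap k ι b) = h := by
    calc _ = kap k ι b' * (n * D0) * n' * kap k ι b := by noncomm_ring
      _ = (kap k ι b' * kap k ι b) * h * kap k ι b' * (n * n') * kap k ι b := by rw [hn]; noncomm_ring
      _ = h * (kap k ι b' * kap k ι b) := by rw [hnn, hkb', one_mul, mul_one, mul_assoc, hkb']
      _ = h := by rw [hkb', mul_one]
  obtain ⟨m, hm⟩ := tri_int d hn1
  obtain ⟨m', hm'⟩ := tri_int d hn1'
  have hd1 := del (k := k) d
  have hd2 := mul_eq_one_comm.1 hd1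
  have hJ : Phi k ι (Jo k ι n) * Phi k ι (Jo k ι n') = 1 := by rw [← map_mul, ← map_mul, hnn, map_one, map_one]
  have hJ' : Jo k ι n' * Jo k ι n = 1 := by rw [← map_mul, hn'n, map_one]
  have hmm : m * m' = 1 := by
    apply Phi_inj
    rw [map_mul, hm, hm', map_one]
    exact alg2 hd2 hJ hd1
  refine ⟨a * m, m' * a', Jo k ι n' * b, b' * Jo k ι n, ⟨n' * kap k ι b, kap k ι b' * n, d, ?_, ?_⟩, ⟨?_, ?_, ?_⟩, ?_, ?_⟩
  · calc _ = n' * (kap k ι b * kap k ι b') * n := by noncomm_ring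
      _ = 1 := by rw [hkb, mul_one, hn'n]
  · rw [hmem]; exact proj_mem hd _
  · calc _ = a * (m * m') * a' := by noncomm_ring
      _ = 1 := by rw [hmm, mul_one, ha]
  · calc _ = Jo k ι n' * (b * b') * Jo k ι n := by noncomm_ring
      _ = 1 := by rw [hb, mul_one, hJ']
  · rw [hS.hg, map_mul, map_mul, hm]
    exact (alg3 hd2 hJ).symm
  · simp only [map_mul, kap_Jo]
  · simp only [map_mul, kap_Jo]

lemma Phi_mulVec (M : Matrix ι ι (PowerSeries k)) (u : ι → PowerSeries k) :
    (Phi k ι M).mulVec (fun i => psi k (u i)) = fun i => psi k (M.mulVec u i) := by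
  funext i
  change ∑ j, psi k (M i j) * psi k (u j) = psi k (∑ j, M i j * u j)
  simp

lemma kap_mulVec (M : Matrix ι ι (PowerSeries k)) (u : ι → PowerSeries k) :
    (kap k ι M).mulVec (fun i => PowerSeries.constantCoeff (u i)) = fun i => PowerSeries.constantCoeff (M.mulVec u i) := by
  funext i
  change ∑ j, PowerSeries.constantCoeff (M i j) * PowerSeries.constantCoeff (u j) = PowerSeries.constantCoeff (∑ j, M i j * u j)
  simp

lemma act (h : Sm g a a' b b' d) (w : ι → PowerSeries k) : (Phi k ι a').mulVec (g.mulVec (fun i => psi k (w i))) =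
    fun j => TT k ^ d j * psi k (b.mulVec w j) := by
  rw [h.hg, ← Matrix.mulVec_mulVec, Phi_mulVec, ← Matrix.mulVec_mulVec, Matrix.mulVec_mulVec, ← map_mul, h.ha', map_one,
    Matrix.one_mulVec]
  funext j
  rw [Matrix.mulVec_diagonal]

lemma lam [CharZero k] {l : PS Γ} (h : Sm g a a' b b' l.d) (hc : l.c = kap k ι b) {v : ι → k} {C : ι → PowerSeries k}
    (hC : g.mulVec (fun i => psi k (algebraMap k _ (v i))) = fun i => psi k (C i)) : l.Lam v := by
  intro i hi
  have h1 := h.act (fun i => algebraMap k _ (v i))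
  rw [hC, Phi_mulVec] at h1
  have h2 := const_neg hi (congrFun h1 i).symm
  have h3 := congrFun (kap_mulVec b (fun i => algebraMap k (PowerSeries k) (v i))) i
  rw [h2] at h3
  rw [PS.vhat, hc]
  simpa [PowerSeries.algebraMap_apply] using h3

lemma dim_ge [CharZero k] (hΓ : IsSLGroup Γ) (htr : TraceNondeg Γ) (hgm : g ∈ pts Γ (KK k))
    {l : PS Γ} (h : Sm g a a' b b' l.d) (hc : l.c = kap k ι b) (hc' : l.c' = kap k ι b') {v z : ι → k} {C : ι → PowerSeries k}
    (hC : g.mulVec (fun i => psi k (algebraMap k _ (v i))) = fun i => psi k (C i)) (hz : l.IsLim v z) :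
    Module.finrank k (orb Γ z) ≤ Module.finrank k (orb Γ (fun i => PowerSeries.constantCoeff (C i))) := by
  obtain ⟨ξ, e, h1, h2, h3⟩ := exists_hom_basis hΓ l z
  obtain ⟨nn, β, β', hd⟩ := exists_dualPair htr
  have h4 := (lim_indep l hz ξ e h2 h3).2.1
  let x := fun i => Jo k ι (l.hat (ξ i))
  let ξt := fun i => proj β β' _ (b' * x i * b)
  let η := fun i => proj β β' _ (a * x i * a')
  have hgu := pts_isUnit hΓ hgm
  have hbb : Phi k ι b * Phi k ι b' = 1 := by rw [← map_mul, h.hb, map_one]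
  have hconj : ∀ i, g * Phi k ι (b' * x i * b) * g⁻¹ = TT k ^ e i • Phi k ι (a * x i * a') := by
    intro i
    rw [h.inv]
    conv_lhs => rw [h.hg]
    set Δ : Matrix ι ι (KK k) := Matrix.diagonal (fun i => TT k ^ l.d i) with hΔ
    set Δ' : Matrix ι ι (KK k) := Matrix.diagonal (fun i => TT k ^ (-l.d i)) with hΔ'
    have hx : Δ * Phi k ι (x i) * Δ' = TT k ^ e i • Phi k ι (x i) := by
      ext1 p q
      rw [Matrix.mul_diagonal, Matrix.diagonal_mul, Matrix.smul_apply, smul_eq_mul]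
      by_cases hpq : l.d p - l.d q = e i
      · rw [← hpq, sub_eq_add_neg, zpow_add₀ TT_ne]; ring
      · have : Phi k ι (x i) p q = 0 := by
          simp only [x]
          rw [Phi_Jo, Matrix.map_apply, h2 i p q hpq, map_zero]
        rw [this]; simp
    rw [map_mul, map_mul, map_mul, map_mul, ← Matrix.smul_mul, ← Matrix.mul_smul, ← hx]
    calc _ = Phi k ι a * Δ * (Phi k ι b * Phi k ι b') * Phi k ι (x i) * (Phi k ι b * Phi k ι b') * Δ' * Phi k ι a' := by
          noncomm_ring
      _ = _ := by rw [hbb]; noncomm_ring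
  have hη : ∀ i, g * Phi k ι (ξt i) = TT k ^ e i • (Phi k ι (η i) * g) := by
    intro i
    have h5 := proj_conj hΓ hd hgm (Phi k ι (b' * x i * b))
    rw [hconj, map_smul, ← proj_Phi, ← proj_Phi] at h5
    rw [← Matrix.smul_mul, ← h5, mul_assoc, Matrix.nonsing_inv_mul _ hgu, mul_one]
  have hent : ∀ i j, TT k ^ (l.d j - e i) * psi k (b.mulVec ((ξt i).mulVec (fun i => algebraMap k _ (v i))) j) =
      psi k (a'.mulVec ((η i).mulVec C) j) := by
    intro i j
    have h5 := h.act ((ξt i).mulVec (fun i => algebraMap k _ (v i)))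
    rw [← Phi_mulVec, Matrix.mulVec_mulVec _ g, hη, Matrix.smul_mulVec, ← Matrix.mulVec_mulVec, hC, Phi_mulVec, Matrix.mulVec_smul,
      Phi_mulVec] at h5
    have h6 := congrFun h5 j
    rw [Pi.smul_apply, smul_eq_mul] at h6
    rw [sub_eq_neg_add, zpow_add₀ TT_ne, mul_assoc, ← h6, ← mul_assoc, ← zpow_add₀ TT_ne]
    simp
  have hkξ : ∀ i, kap k ι (ξt i) = ξ i := by
    intro i
    simp only [ξt]
    rw [proj_kap, map_mul (kap k ι), map_mul (kap k ι), kap_Jo, ← hc, ← hc', l.unhat]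
    exact proj_of_mem hd (h1 i)
  have hbv : ∀ i j, PowerSeries.constantCoeff (b.mulVec ((ξt i).mulVec (fun i => algebraMap k _ (v i))) j) =
      l.vhat ((ξ i).mulVec v) j := by
    intro i j
    rw [← hkξ, PS.vhat, hc]
    have := kap_mulVec (ξt i) (fun i => algebraMap k (PowerSeries k) (v i))
    have h0 : (fun i => PowerSeries.constantCoeff ((algebraMap k (PowerSeries k)) (v i))) = v := by
      funext i; simp [PowerSeries.algebraMap_apply]
    rw [h0] at this
    rw [this, kap_mulVec]
  set y : ι → k := fun i => PowerSeries.constantCoeff (C i) with hy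
  have hw : ∀ i j, PowerSeries.constantCoeff (a'.mulVec ((η i).mulVec C) j) = ((kap k ι a').mulVec ((kap k ι (η i)).mulVec y)) j := by
    intro i j
    rw [hy, kap_mulVec, kap_mulVec]
  let E' : ℤ → (ι → k) →ₗ[k] (ι → k) := fun b =>
    { toFun := fun w j => if l.d j = - b then w j else 0
      map_add' := by intro v w; ext j; simp only [Pi.add_apply]; split_ifs <;> simp
      map_smul' := by intro c v; ext j; simp only [Pi.smul_apply, RingHom.id_apply]; split_ifs <;> simp }
  have hli : LinearIndependent k (fun i => (kap k ι a').mulVec ((kap k ι (η i)).mulVec y)) := by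
    apply triangular_indep E' _ (fun i => - e i)
    · intro i b hb
      ext j
      change (if l.d j = - b then _ else _) = _
      split_ifs with hj
      · rw [← hw]
        exact const_pos (by omega) (hent i j)
      · rfl
    · have h4' : (fun i => E' (- e i) ((kap k ι a').mulVec ((kap k ι (η i)).mulVec y))) = (fun i => l.Ev (e i) ((ξ i).mulVec v)) := by
        funext i
        ext j
        rw [PS.Ev_apply]
        change (if l.d j = - - e i then _ else _) = _
        rw [neg_neg]
        split_ifs with hj
        · rw [← hw, ← hbv]
          have := hent i j
          rw [hj, sub_self] at this
          rw [const_zero this]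
        · rfl
      rw [h4']; exact h4
  have hli2 : LinearIndependent k (fun i => (kap k ι (η i)).mulVec y) := by
    apply LinearIndependent.of_comp (Matrix.mulVecLin (kap k ι a'))
    exact hli
  have hηm : ∀ i, kap k ι (η i) ∈ lie Γ k := by
    intro i
    simp only [η]
    rw [proj_kap]; exact proj_mem hd _
  have h5 : LinearIndependent k (fun i => (⟨(kap k ι (η i)).mulVec y, mem_orb.2 ⟨_, hηm i, rfl⟩⟩ : orb Γ y)) := by
    apply LinearIndependent.of_comp (orb Γ y).subtype
    exact hli2
  simpa using h5.fintype_card_le_finrank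
end Sm

/-- C6 -/
theorem curve_dim [CharZero k] (hΓ : IsSLGroup Γ) (htr : TraceNondeg Γ) {v : ι → k} (hpr : ProperAt Γ v)
    (hcr : CRat Γ v) {g : Matrix ι ι (KK k)} (hgm : g ∈ pts Γ (KK k)) {C : ι → PowerSeries k}
    (hC : g.mulVec (fun i => psi k (algebraMap k _ (v i))) = fun i => psi k (C i)) :
    Module.finrank k (orb Γ v) ≤ Module.finrank k (orb Γ (fun i => PowerSeries.constantCoeff (C i))) := by
  obtain ⟨a, a', b, b', l, h, hc, hc'⟩ := Sm.nice hΓ htr hgm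
  obtain ⟨z, hz⟩ := lim_exists l (h.lam hc hC)
  exact (lim_dim_le hΓ htr hpr hcr l hz).trans (h.dim_ge hΓ htr hgm hc hc' hC hz)
end F14
end PaperGIT

namespace PaperGIT
section F15
set_option linter.unusedSectionVars false
set_option linter.unusedVariables false
open MvPolynomial
variable {k : Type} [Field k] {ι : Type} [Fintype ι] [DecidableEq ι]
variable {Γ : Set (Matrix ι ι k)}

lemma null_point [IsAlgClosed k] (hΓ : IsSLGroup Γ) {R : Type} [CommRing R] [Algebra k R] [Nontrivial R]
    {p : Matrix ι ι R} (hp : p ∈ pts Γ R) {v y : ι → k}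
    (h : p.mulVec (fun i => algebraMap k R (v i)) = fun i => algebraMap k R (y i)) : ∃ γ ∈ Γ, y = γ.mulVec v := by
  let q : ι → MvPolynomial (ι × ι) k := fun i => ∑ j, X (i, j) * C (v j) - C (y i)
  let I : Ideal (MvPolynomial (ι × ι) k) := Ideal.span (van Γ ∪ Set.range q)
  have hI : I ≤ RingHom.ker (evM p : MvPolynomial (ι × ι) k →ₐ[k] R) := by
    rw [Ideal.span_le]
    rintro f (hf | ⟨i, rfl⟩)
    · exact hp f hf
    · change evM p (q i) = 0
      have := congrFun h i
      change ∑ j, p i j * algebraMap k R (v j) = _ at this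
      simp only [q]
      rw [map_sub, map_sum, sub_eq_zero]
      simpa [evM] using this
  have hne : I ≠ ⊤ := by
    intro h
    rw [h, top_le_iff] at hI
    exact RingHom.ker_ne_top _ hI
  obtain ⟨m, hm, hIm⟩ := Ideal.exists_le_maximal I hne
  obtain ⟨x, hx⟩ := (isMaximal_iff_eq_vanishingIdeal_singleton (K := k)).1 hm
  have hx' : ∀ f ∈ I, eval x f = 0 := by
    intro f hf
    have := hIm hf
    rw [hx, mem_vanishingIdeal_iff] at this
    simpa [aeval_eq_eval] using this x rfl
  let γ : Matrix ι ι k := Matrix.of fun i j => x (i, j)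
  have hev : ∀ f, evM γ f = eval x f := by
    intro f
    rfl
  refine ⟨γ, hΓ.closed γ ?_, ?_⟩
  · intro f hf
    rw [hev]; exact hx' f (Ideal.subset_span (Or.inl hf))
  · funext i
    have := hx' (q i) (Ideal.subset_span (Or.inr ⟨i, rfl⟩))
    simp only [q] at this
    rw [map_sub, sub_eq_zero, map_sum] at this
    change y i = ∑ j, x (i, j) * v j
    simpa using this.symm

/-- constants in K -/
noncomputable def cK (v : ι → k) : ι → KK k := fun i => psi k (algebraMap k _ (v i))

lemma cK_eq (v : ι → k) : cK v = fun i => algebraMap k (KK k) (v i) := by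
  funext i; exact (psi k).commutes _

noncomputable def orbK (Γ : Set (Matrix ι ι k)) (v : ι → k) : Submodule (KK k) (ι → KK k) :=
  (lie Γ (KK k)).map ((Matrix.mulVecBilin (KK k) (KK k)).flip (cK v))

lemma mem_orbK {v : ι → k} {w : ι → KK k} : w ∈ orbK Γ v ↔ ∃ ξ ∈ lie Γ (KK k), ξ.mulVec (cK v) = w := by
  rw [orbK, Submodule.mem_map]; rfl

lemma map_cK (M : Matrix ι ι k) (v : ι → k) : (M.map (algebraMap k (KK k))).mulVec (cK v) = cK (M.mulVec v) := by
  rw [cK_eq, cK_eq]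
  funext i
  change ∑ j, algebraMap k (KK k) (M i j) * algebraMap k (KK k) (v j) = algebraMap k (KK k) (∑ j, M i j * v j)
  simp

lemma cK_add (v w : ι → k) : cK (v + w) = cK v + cK w := by
  funext i; simp [cK]
lemma cK_smul (c : k) (w : ι → k) : cK (c • w) = algebraMap k (KK k) c • cK w := by
  rw [cK_eq, cK_eq]; funext i; simp

lemma finrank_orbK (v : ι → k) : Module.finrank (KK k) (orbK Γ v) ≤ Module.finrank k (orb Γ v) := by
  let B := Module.finBasis k (orb Γ v)
  have hle : orbK Γ v ≤ Submodule.span (KK k) (Set.range fun i => cK (B i : ι → k)) := by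
    intro w hw
    obtain ⟨ξ, hξ, rfl⟩ := mem_orbK.1 hw
    obtain ⟨J, ζ, hζ, rfl⟩ := lie_span hξ
    rw [Matrix.sum_mulVec]
    refine Submodule.sum_mem _ fun j _ => ?_
    rw [Matrix.smul_mulVec, map_cK]
    refine Submodule.smul_mem _ _ ?_
    have h1 := B.sum_repr ⟨(ζ j).mulVec v, mem_orb.2 ⟨_, hζ j, rfl⟩⟩
    have h2 := congrArg Subtype.val h1
    simp only [Submodule.coe_sum, Submodule.coe_smul] at h2
    rw [← h2]
    have h3 : ∀ (s : Finset (Fin (Module.finrank k (orb Γ v)))) (c : Fin (Module.finrank k (orb Γ v)) → k),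
        cK (∑ i ∈ s, c i • (B i : ι → k)) ∈ Submodule.span (KK k) (Set.range fun i => cK (B i : ι → k)) := by
      intro s c
      induction s using Finset.cons_induction with
      | empty =>
        have : cK (0 : ι → k) = 0 := by funext i; simp [cK]
        simp [this]
      | cons i s hi ih =>
        rw [Finset.sum_cons, cK_add, cK_smul]
        exact Submodule.add_mem _ (Submodule.smul_mem _ _ (Submodule.subset_span ⟨i, rfl⟩)) ih
    exact h3 _ _
  refine (Submodule.finrank_mono hle).trans ?_
  refine (finrank_range_le_card _).trans ?_
  simp

theorem curve_orbit [CharZero k] [IsAlgClosed k] (hΓ : IsSLGroup Γ) {v : ι → k} 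
    {g : Matrix ι ι (KK k)} (hgm : g ∈ pts Γ (KK k)) {C : ι → PowerSeries k}
    (hC : g.mulVec (cK v) = fun i => psi k (C i))
    (hdim : Module.finrank k (orb Γ v) ≤ Module.finrank k (orb Γ (fun i => PowerSeries.constantCoeff (C i)))) :
    ∃ γ ∈ Γ, (fun i => PowerSeries.constantCoeff (C i)) = γ.mulVec v := by
  set y : ι → k := fun i => PowerSeries.constantCoeff (C i) with hy
  let B := Module.finBasis k (orb Γ y)
  choose η hη hηy using fun i => mem_orb.1 (B i).2
  have hli : LinearIndependent k (fun i => (η i).mulVec y) := by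
    simp only [hηy]
    exact B.linearIndependent.map' (orb Γ y).subtype (Submodule.ker_subtype _)
  have hgu := pts_isUnit hΓ hgm
  -- constant term of combination
  let Z : (Fin (Module.finrank k (orb Γ y)) → PowerSeries k) → ι → PowerSeries k := fun β => ∑ i, β i • (Jo k ι (η i)).mulVec C
  have hZ0 : ∀ β, (∀ j, PowerSeries.constantCoeff (Z β j) = 0) → ∀ i, PowerSeries.constantCoeff (β i) = 0 := by
    intro β h
    refine Fintype.linearIndependent_iff.1 hli (fun i => PowerSeries.constantCoeff (β i)) ?_
    funext j
    rw [Pi.zero_apply, ← h j]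
    simp only [Z, Finset.sum_apply, Pi.smul_apply, smul_eq_mul, map_sum, map_mul]
    apply Finset.sum_congr rfl
    intro i _
    have := congrFun (Sm.kap_mulVec (Jo k ι (η i)) C) j
    rw [kap_Jo] at this
    rw [← this]
  let f := fun i => ((η i).map (algebraMap k (KK k))).mulVec (fun i => psi k (C i))
  have hf : ∀ i, f i = fun j => psi k ((Jo k ι (η i)).mulVec C j) := by
    intro i
    simp only [f]
    rw [← Phi_Jo, Sm.Phi_mulVec]
  have hcomb : ∀ (n : ℤ) (α : Fin (Module.finrank k (orb Γ y)) → KK k) (β : Fin (Module.finrank k (orb Γ y)) → PowerSeries k), (∀ i, α i = TT k ^ n * psi k (β i)) →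
      ∑ i, α i • f i = fun j => TT k ^ n * psi k (Z β j) := by
    intro n α β h
    funext j
    simp only [Z, Finset.sum_apply, Pi.smul_apply, smul_eq_mul, map_sum, map_mul, Finset.mul_sum, hf, h]
    apply Finset.sum_congr rfl
    intro i _; ring
  have hfli : LinearIndependent (KK k) f := by
    rw [Fintype.linearIndependent_iff]
    intro α h i
    by_contra hi
    have hα : α ≠ 0 := by intro h0; exact hi (congrFun h0 i)
    obtain ⟨n, β, hβ, i0, hi0⟩ := prim α hα
    rw [hcomb n α β hβ] at h
    apply hi0
    apply hZ0
    intro j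
    have := congrFun h j
    have hT : TT k ^ n ≠ 0 := zpow_ne_zero _ TT_ne
    have h2 : psi k (Z β j) = 0 := by
      rcases mul_eq_zero.1 this with h | h
      · exact absurd h hT
      · exact h
    rw [psi_inj (h2.trans (map_zero _).symm), map_zero]
  have hgC : ∀ M : Matrix ι ι (KK k), g⁻¹.mulVec (M.mulVec (fun i => psi k (C i))) = (g⁻¹ * M * g).mulVec (cK v) := by
    intro M
    rw [← hC, Matrix.mulVec_mulVec, Matrix.mulVec_mulVec]
  have hmem : ∀ i, g⁻¹.mulVec (f i) ∈ orbK Γ v := by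
    intro i
    rw [mem_orbK]
    exact ⟨_, lie_conj' hΓ hgm (lie_map _ (hη i)), (hgC _).symm⟩
  have hli2 : LinearIndependent (KK k) (fun i => g⁻¹.mulVec (f i)) := by
    apply LinearIndependent.of_comp (Matrix.mulVecLin g)
    have h9 : (⇑(Matrix.mulVecLin g) ∘ fun i => g⁻¹.mulVec (f i)) = f := by
      funext i
      change g.mulVec (g⁻¹.mulVec (f i)) = f i
      rw [Matrix.mulVec_mulVec, Matrix.mul_nonsing_inv _ hgu, Matrix.one_mulVec]
    rw [h9]; exact hfli
  let DC : ι → PowerSeries k := fun i => PowerSeries.derivative k (C i)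
  have hDC : (fun i => psi k (DC i)) = (g.map (DK k)).mulVec (cK v) := by
    funext i
    have := congrArg (DK k) (congrFun hC i)
    rw [DK_psi] at this
    rw [← this]
    change DK k (∑ j, g i j * cK v j) = ∑ j, DK k (g i j) * cK v j
    rw [map_sum]
    apply Finset.sum_congr rfl
    intro j _
    rw [Derivation.leibniz]
    have h0 : DK k (cK v j) = 0 := by
      rw [cK_eq]; exact Derivation.map_algebraMap _ _
    rw [h0]; simp [mul_comm]
  have hw : g⁻¹.mulVec (fun i => psi k (DC i)) ∈ orbK Γ v := by
    rw [mem_orbK]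
    refine ⟨_, lie_log' hΓ (DK k) hgm, ?_⟩
    rw [hDC, Matrix.mulVec_mulVec]
  obtain ⟨α, hα⟩ := li_span (orbK Γ v) _ hmem hli2 (by
    rw [Fintype.card_fin]; exact (finrank_orbK v).trans hdim) hw
  have hα2 : (fun i => psi k (DC i)) = ∑ i, α i • f i := by
    have := congrArg (fun w => g.mulVec w) hα
    simp only [Matrix.mulVec_sum, Matrix.mulVec_smul, Matrix.mulVec_mulVec, Matrix.mul_nonsing_inv _ hgu, Matrix.one_mulVec] at this
    exact this
  have hInteg : ∃ A : Fin (Module.finrank k (orb Γ y)) → PowerSeries k, ∀ i, α i = TT k ^ (0 : ℤ) * psi k (A i) := by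
    by_cases h0 : α = 0
    · exact ⟨0, by intro i; simp [h0]⟩
    obtain ⟨n, β, hβ, i0, hi0⟩ := prim α h0
    by_cases hn : 0 ≤ n
    · refine ⟨fun i => PowerSeries.X ^ n.toNat * β i, fun i => ?_⟩
      rw [hβ, map_mul, ← zpow_psi hn]; simp
    · exfalso
      apply hi0
      apply hZ0
      intro j
      rw [hcomb n α β hβ] at hα2
      exact const_neg (by omega) (congrFun hα2 j).symm
  obtain ⟨A, hA⟩ := hInteg
  rw [hcomb 0 α A hA] at hα2
  let ξ : Matrix ι ι (PowerSeries k) := ∑ i, A i • Jo k ι (η i)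
  have hξ : ξ ∈ lie Γ (PowerSeries k) := Submodule.sum_mem _ fun i _ => Submodule.smul_mem _ _ (lie_map _ (hη i))
  have hode : ∀ j, PowerSeries.derivative k (C j) = ξ.mulVec C j := by
    intro j
    have h1 := congrFun hα2 j
    rw [zpow_zero, one_mul] at h1
    have h2 : DC j = Z A j := psi_inj h1
    have h3 : ξ.mulVec C = Z A := by
      simp only [ξ, Z, Matrix.sum_mulVec, Matrix.smul_mulVec]
    rw [h3]; exact h2
  obtain ⟨u, hu, hu0⟩ := ode_exists ξ
  have hup := ode_mem hΓ hξ hu (by rw [hu0]; exact hΓ.one_mem)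
  let yO : ι → PowerSeries k := fun i => algebraMap k _ (y i)
  have hCu : C - u.mulVec yO = 0 := by
    apply ode_unique ξ
    · intro i
      have h1 : PowerSeries.derivative k (u.mulVec yO i) = (u.map (PowerSeries.derivative k)).mulVec yO i := by
        change PowerSeries.derivative k (∑ j, u i j * yO j) = ∑ j, PowerSeries.derivative k (u i j) * yO j
        rw [map_sum]
        apply Finset.sum_congr rfl
        intro j _
        rw [Derivation.leibniz]
        have h0 : PowerSeries.derivative k (yO j) = 0 := Derivation.map_algebraMap _ _
        rw [h0]; simp [mul_comm]
      rw [Pi.sub_apply, map_sub, hode, h1, hu, ← Matrix.mulVec_mulVec, Matrix.mulVec_sub, Pi.sub_apply]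
    · intro i
      have h1 := congrFun (Sm.kap_mulVec u yO) i
      have h2 : (fun i => PowerSeries.constantCoeff (yO i)) = y := by
        funext i; simp [yO, PowerSeries.algebraMap_apply]
      rw [h2, kap_apply, hu0, Matrix.one_mulVec] at h1
      rw [Pi.sub_apply, map_sub, ← h1, sub_self]
  have hCu2 : C = u.mulVec yO := sub_eq_zero.1 hCu
  have huK : Phi k ι u ∈ pts Γ (KK k) := pts_map (psi k) hup
  refine null_point hΓ (pts_mul hΓ (pts_inv hΓ huK) hgm) (v := v) (y := y) ?_
  rw [← cK_eq, ← cK_eq, ← Matrix.mulVec_mulVec, hC]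
  have h5 : (fun i => psi k (C i)) = (Phi k ι u).mulVec (cK y) := by
    have h6 := Sm.Phi_mulVec u yO
    rw [← hCu2] at h6
    exact h6.symm
  rw [h5, Matrix.mulVec_mulVec, Matrix.nonsing_inv_mul _ (pts_isUnit hΓ huK), Matrix.one_mulVec]
end F15
end PaperGIT

namespace PaperGIT
section F16
set_option linter.unusedSectionVars false
set_option linter.unusedVariables false
open MvPolynomial
variable {k : Type} [Field k]

/-- Taylor expansion along a uniformizer. -/
theorem emb {R : Type} [CommRing R] [IsDomain R] [Algebra k R] (t : R) (ht : t ≠ 0) (π : R →ₐ[k] k)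
    (hπt : π t = 0) (hdiv : ∀ a, π a = 0 → t ∣ a) (hsep : ∀ a, (∀ n : ℕ, t ^ n ∣ a) → a = 0) :
    ∃ φ : R →ₐ[k] PowerSeries k, Function.Injective φ ∧ ∀ a, PowerSeries.constantCoeff (φ a) = π a := by
  have h1 : ∀ a : R, ∃ b, a - algebraMap k R (π a) = t * b := by
    intro a
    apply hdiv
    rw [map_sub, AlgHom.commutes, Algebra.algebraMap_self_apply, sub_self]
  choose δ hδ using h1
  have huniq : ∀ a b c, a = algebraMap k R c + t * b → π a = c ∧ δ a = b := by
    intro a b c h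
    have h2 : π a = c := by rw [h, map_add, map_mul, hπt, AlgHom.commutes]; simp
    refine ⟨h2, ?_⟩
    have h3 := hδ a
    rw [h2] at h3
    apply mul_left_cancel₀ ht
    rw [← h3, h]; ring
  have hd : ∀ a, a = algebraMap k R (π a) + t * δ a := fun a => by rw [← hδ]; ring
  have hadd : ∀ a b, δ (a + b) = δ a + δ b := fun a b => by
    refine (huniq (a+b) (δ a + δ b) (π a + π b) ?_).2
    conv_lhs => rw [hd a, hd b]
    rw [map_add]; ring
  have hmul : ∀ a b, δ (a * b) = algebraMap k R (π a) * δ b + δ a * b := fun a b => by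
    refine (huniq (a*b) _ (π a * π b) ?_).2
    have : a * b = algebraMap k R (π a) * b + t * δ a * b := by
      rw [← add_mul, ← hd a]
    rw [this]
    have h5 : algebraMap k R (π a) * b = algebraMap k R (π a) * (algebraMap k R (π b) + t * δ b) := by
      rw [← hd b]
    rw [h5, map_mul]; ring
  have hcst : ∀ c : k, δ (algebraMap k R c) = 0 := fun c => (huniq _ 0 c (by ring)).2
  have h0 : δ 0 = 0 := by simpa using hcst 0
  let Φ : R → PowerSeries k := fun a => PowerSeries.mk fun n => π (δ^[n] a)
  have hΦ : ∀ a, Φ a = algebraMap k _ (π a) + PowerSeries.X * Φ (δ a) := by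
    intro a
    ext n
    cases n with
    | zero => simp [Φ, PowerSeries.algebraMap_apply]
    | succ n =>
      rw [map_add, PowerSeries.coeff_succ_X_mul]
      simp [Φ, PowerSeries.algebraMap_apply, PowerSeries.coeff_C]
  have hΦadd : ∀ a b, Φ (a + b) = Φ a + Φ b := by
    intro a b
    ext n
    simp only [Φ, map_add, PowerSeries.coeff_mk]
    have : δ^[n] (a + b) = δ^[n] a + δ^[n] b := by
      induction n with
      | zero => rfl
      | succ n ih => rw [Function.iterate_succ_apply', ih, hadd, ← Function.iterate_succ_apply' δ, ← Function.iterate_succ_apply' δ]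
    rw [this, map_add]
  have hΦc : ∀ c, Φ (algebraMap k R c) = algebraMap k _ c := by
    intro c
    rw [hΦ, hcst]
    have : Φ 0 = 0 := by
      have := hΦadd 0 0
      rw [add_zero] at this
      exact left_eq_add.1 this
    rw [this, AlgHom.commutes]; simp
  have hcc : ∀ a, PowerSeries.coeff 0 (Φ a) = π a := fun a => by simp [Φ]
  have hcs : ∀ a n, PowerSeries.coeff (n+1) (Φ a) = PowerSeries.coeff n (Φ (δ a)) := fun a n => by
    simp [Φ]
  have hsm : ∀ c a, Φ (algebraMap k R c * a) = algebraMap k _ c * Φ a := by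
    intro c a
    ext n
    induction n generalizing a with
    | zero => rw [hcc]; simp [hcc, PowerSeries.algebraMap_apply]
    | succ n ih =>
      rw [hcs, hmul, hcst, zero_mul, add_zero, AlgHom.commutes, Algebra.algebraMap_self_apply, ih]
      simp [PowerSeries.algebraMap_apply, hcs]
  have hΦmul : ∀ a b, Φ (a * b) = Φ a * Φ b := by
    intro a b
    ext n
    induction n generalizing a b with
    | zero => rw [hcc, map_mul, ← hcc a, ← hcc b]; simp
    | succ n ih =>
      rw [hcs, hmul, hΦadd, map_add, hsm, ih, hΦ a, add_mul, map_add]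
      congr 1
      · simp [PowerSeries.algebraMap_apply, hcs]
      · rw [mul_assoc, PowerSeries.coeff_succ_X_mul]
  let φ : R →ₐ[k] PowerSeries k :=
    { toFun := Φ
      map_one' := by simpa using hΦc 1
      map_mul' := hΦmul
      map_zero' := by simpa using hΦc 0
      map_add' := hΦadd
      commutes' := hΦc }
  refine ⟨φ, ?_, fun a => by rw [← PowerSeries.coeff_zero_eq_constantCoeff_apply]; exact hcc a⟩
  rw [injective_iff_map_eq_zero]
  intro a ha
  have ha' : Φ a = 0 := ha
  apply hsep
  intro n
  have : ∀ n : ℕ, ∀ a, Φ a = 0 → t ^ n ∣ a := by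
    intro n
    induction n with
    | zero => intro a _; simp
    | succ n ih =>
      intro a ha
      have h4 : π a = 0 := by rw [← hcc, ha]; simp
      have h5 : Φ (δ a) = 0 := by
        ext m; rw [← hcs, ha]; simp
      rw [hd a, h4, map_zero, zero_add, pow_succ']
      exact mul_dvd_mul_left _ (ih _ h5)
  exact this n a ha'
end F16
end PaperGIT

namespace PaperGIT
section F17
set_option linter.unusedSectionVars false
set_option linter.unusedVariables false
open MvPolynomial
variable {k : Type} [Field k]

theorem dim1a {E : Type} [CommRing E] [IsDomain E] [IsDedekindDomain E] [Algebra k E] (ε : E →ₐ[k] k) :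
    ∃ φ : E →ₐ[k] PowerSeries k, Function.Injective φ ∧ ∀ a, PowerSeries.constantCoeff (φ a) = ε a := by
  by_cases hP : RingHom.ker ε = ⊥
  · refine ⟨(Algebra.ofId k (PowerSeries k)).comp ε, ?_, fun a => by
      simp [Algebra.ofId_apply, PowerSeries.algebraMap_apply]⟩
    rw [AlgHom.coe_comp]
    refine Function.Injective.comp ?_ ?_
    · exact (algebraMap k (PowerSeries k)).injective
    · exact (RingHom.injective_iff_ker_eq_bot ε.toRingHom).2 hP
  let P : Ideal E := RingHom.ker ε
  haveI : P.IsPrime := RingHom.ker_isPrime ε.toRingHom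
  let A := Localization.AtPrime P
  haveI : IsDiscreteValuationRing A :=
    IsLocalization.AtPrime.isDiscreteValuationRing_of_dedekind_domain E hP A
  let π : A →ₐ[k] k := IsLocalization.liftAlgHom (M := P.primeCompl) (f := ε) (fun y => by
    have hy := y.2
    exact (isUnit_iff_ne_zero).2 (fun h => hy h))
  have hπ : ∀ a, π (algebraMap E A a) = ε a := fun a => IsLocalization.lift_eq _ _
  have hsurj : Function.Surjective π := fun c => ⟨algebraMap k A c, by simp⟩
  have hker : RingHom.ker π = IsLocalRing.maximalIdeal A := by
    haveI : (RingHom.ker π).IsMaximal := RingHom.ker_isMaximal_of_surjective π.toRingHom hsurj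
    exact IsLocalRing.eq_maximalIdeal this
  obtain ⟨t, ht⟩ := IsDiscreteValuationRing.exists_irreducible A
  have htm := ht.maximalIdeal_eq
  have hmem : ∀ a, π a = 0 ↔ t ∣ a := by
    intro a
    rw [← RingHom.mem_ker, hker, htm, Ideal.mem_span_singleton]
  obtain ⟨φ, hφ, hφ2⟩ := emb t ht.ne_zero π ((hmem t).2 dvd_rfl) (fun a => (hmem a).1) (by
    intro a ha
    have h1 := Ideal.iInf_pow_eq_bot_of_isDomain (IsLocalRing.maximalIdeal A) (IsLocalRing.maximalIdeal.isMaximal A).ne_top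
    have h2 : a ∈ (⨅ i : ℕ, IsLocalRing.maximalIdeal A ^ i) := by
      rw [Ideal.mem_iInf]
      intro i
      rw [htm, Ideal.span_singleton_pow, Ideal.mem_span_singleton]
      exact ha i
    rw [h1] at h2
    simpa using h2)
  refine ⟨φ.comp (IsScalarTower.toAlgHom k E A), ?_, ?_⟩
  · rw [AlgHom.coe_comp]
    exact hφ.comp (IsLocalization.injective A P.primeCompl_le_nonZeroDivisors)
  · intro a
    simp [hφ2, hπ]
end F17
end PaperGIT

namespace PaperGIT
section F18
set_option linter.unusedSectionVars false
set_option linter.unusedVariables false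
open MvPolynomial
variable {k : Type} [Field k]

theorem ext_point [IsAlgClosed k] {D E : Type} [CommRing D] [CommRing E] [Algebra k D] [Algebra k E]
    (j : D →ₐ[k] E) (hj : Function.Injective j) (hInteg : j.toRingHom.IsIntegral) (ε : D →ₐ[k] k) :
    ∃ ε' : E →ₐ[k] k, ∀ a, ε' (j a) = ε a := by
  letI : Algebra D E := j.toRingHom.toAlgebra
  haveI : Algebra.IsIntegral D E := ⟨hInteg⟩
  have hsurj : Function.Surjective ε := fun c => ⟨algebraMap k D c, by simp⟩
  haveI : (RingHom.ker ε).IsMaximal := RingHom.ker_isMaximal_of_surjective ε.toRingHom hsurj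
  obtain ⟨Q, hQ, hQ2⟩ := Ideal.exists_ideal_over_maximal_of_isIntegral (R := D) (S := E) (RingHom.ker ε) (by
    have : RingHom.ker (algebraMap D E) = ⊥ := (RingHom.injective_iff_ker_eq_bot _).1 hj
    rw [this]; exact bot_le)
  let mk := Ideal.Quotient.mkₐ k Q
  have hcomp : ∀ a : D, mk (j a) = algebraMap k (E ⧸ Q) (ε a) := by
    intro a
    have h1 : a - algebraMap k D (ε a) ∈ RingHom.ker ε := by
      rw [RingHom.mem_ker, map_sub, AlgHom.commutes]; simp
    rw [← hQ2] at h1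
    have h2 : mk (j (a - algebraMap k D (ε a))) = 0 := Ideal.Quotient.eq_zero_iff_mem.2 h1
    rw [map_sub, map_sub, AlgHom.commutes, AlgHom.commutes] at h2
    exact sub_eq_zero.1 h2
  haveI : Algebra.IsIntegral k (E ⧸ Q) := by
    constructor
    intro x
    obtain ⟨e, rfl⟩ := Ideal.Quotient.mk_surjective x
    obtain ⟨p, hp, hp2⟩ := hInteg e
    refine ⟨p.map ε.toRingHom, hp.map _, ?_⟩
    rw [Polynomial.eval₂_map]
    have h3 : (algebraMap k (E ⧸ Q)).comp ε.toRingHom = (Ideal.Quotient.mk Q).comp j.toRingHom := by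
      ext a; exact (hcomp a).symm
    rw [h3, ← Polynomial.hom_eval₂, hp2, map_zero]
  have hbij : Function.Bijective (algebraMap k (E ⧸ Q)) := IsAlgClosed.algebraMap_bijective_of_isIntegral
  let e := (AlgEquiv.ofBijective (Algebra.ofId k (E ⧸ Q)) hbij)
  refine ⟨(e.symm : (E ⧸ Q) →ₐ[k] k).comp mk, ?_⟩
  intro a
  change e.symm (mk (j a)) = ε a
  rw [hcomp, AlgEquiv.symm_apply_eq]; rfl

open Polynomial in
theorem dim1 [IsAlgClosed k] [CharZero k] {D : Type} [CommRing D] [IsDomain D] [Algebra k D] [Algebra k[X] D]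
    [IsScalarTower k k[X] D] [Module.Finite k[X] D] [FaithfulSMul k[X] D] (ε : D →ₐ[k] k) :
    ∃ φ : D →ₐ[k] PowerSeries k, Function.Injective φ ∧ ∀ a, PowerSeries.constantCoeff (φ a) = ε a := by
  let L := FractionRing D
  letI : Algebra (FractionRing k[X]) L := FractionRing.liftAlgebra _ _
  haveI : IsScalarTower k[X] (FractionRing k[X]) L := FractionRing.isScalarTower_liftAlgebra _ _
  haveI : FiniteDimensional (FractionRing k[X]) L := inferInstance
  haveI : CharZero (FractionRing k[X]) := charZero_of_injective_algebraMap (R := k) (algebraMap k _).injective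
  let E := integralClosure k[X] L
  haveI : IsDedekindDomain E := integralClosure.isDedekindDomain_fractionRing k[X] L
  letI : Algebra k E := ((algebraMap k[X] E).comp (algebraMap k k[X])).toAlgebra
  haveI : IsScalarTower k k[X] E := IsScalarTower.of_algebraMap_eq (fun _ => rfl)
  let j0 : D →+* E := (algebraMap D L).codRestrict E (fun a =>
    (Algebra.IsIntegral.isIntegral (R := k[X]) a).algebraMap)
  let j : D →ₐ[k] E := { j0 with
    commutes' := by
      intro c
      apply Subtype.ext
      change algebraMap D L (algebraMap k D c) = algebraMap k[X] L (algebraMap k k[X] c)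
      rw [IsScalarTower.algebraMap_apply k k[X] D, ← IsScalarTower.algebraMap_apply k[X] D L] }
  have hj : Function.Injective j := by
    intro a b h
    exact IsFractionRing.injective D L (congrArg Subtype.val h)
  have hInteg : j.toRingHom.IsIntegral := by
    refine RingHom.IsIntegral.tower_top (algebraMap k[X] D) j.toRingHom ?_
    have h1 : j.toRingHom.comp (algebraMap k[X] D) = algebraMap k[X] E := by
      apply RingHom.ext
      intro a
      apply Subtype.ext
      change algebraMap D L (algebraMap k[X] D a) = algebraMap k[X] L a
      rw [← IsScalarTower.algebraMap_apply k[X] D L]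
    rw [h1]
    exact fun x => Algebra.IsIntegral.isIntegral x
  obtain ⟨ε', hε⟩ := ext_point j hj hInteg ε
  obtain ⟨φ, hφ, hφ2⟩ := dim1a ε'
  exact ⟨φ.comp j, by rw [AlgHom.coe_comp]; exact hφ.comp hj, fun a => by simp [hφ2, hε]⟩
end F18
end PaperGIT

namespace PaperGIT
section F19
set_option linter.unusedSectionVars false
set_option linter.unusedVariables false
open MvPolynomial
variable {k : Type} [Field k]

theorem curve1 [IsAlgClosed k] [CharZero k] {D : Type} [CommRing D] [IsDomain D] [Algebra k D]
    [Algebra.FiniteType k D] (ε : D →ₐ[k] k) (f : D) (hf : f ≠ 0) :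
    ∃ χ : D →ₐ[k] PowerSeries k, (∀ a, PowerSeries.constantCoeff (χ a) = ε a) ∧ χ f ≠ 0 := by
  by_cases hεf : ε f ≠ 0
  · refine ⟨(Algebra.ofId k (PowerSeries k)).comp ε, fun a => by
      simp [Algebra.ofId_apply, PowerSeries.algebraMap_apply], ?_⟩
    change algebraMap k (PowerSeries k) (ε f) ≠ 0
    rw [Ne, map_eq_zero_iff _ (algebraMap k (PowerSeries k)).injective]; exact hεf
  push Not at hεf
  obtain ⟨s, g, hginj, hgfin⟩ := exists_finite_inj_algHom_of_fg k D
  letI : Algebra (MvPolynomial (Fin s) k) D := g.toRingHom.toAlgebra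
  have hgA : ∀ a, algebraMap (MvPolynomial (Fin s) k) D a = g a := fun _ => rfl
  haveI : IsScalarTower k (MvPolynomial (Fin s) k) D := IsScalarTower.of_algebraMap_eq (fun c => by
    rw [hgA, ← AlgHom.commutes g])
  haveI : Module.Finite (MvPolynomial (Fin s) k) D := hgfin
  haveI : FaithfulSMul (MvPolynomial (Fin s) k) D := (faithfulSMul_iff_algebraMap_injective _ _).2 hginj
  have hN : ∃ N : MvPolynomial (Fin s) k, N ≠ 0 ∧ f ∣ g N := by
    have h1 := Ideal.comap_ne_bot_of_integral_mem (R := MvPolynomial (Fin s) k) (I := Ideal.span {f}) hf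
      (Ideal.mem_span_singleton_self f) (Algebra.IsIntegral.isIntegral f)
    obtain ⟨N, hN, hN0⟩ := Submodule.exists_mem_ne_zero_of_ne_bot h1
    exact ⟨N, hN0, Ideal.mem_span_singleton.1 hN⟩
  obtain ⟨N, hN0, hNf⟩ := hN
  let c : Fin s → k := fun i => ε (g (X i))
  have hc : ∀ a, ε (g a) = MvPolynomial.eval c a := by
    have : ε.comp g = MvPolynomial.aeval c := by
      apply MvPolynomial.algHom_ext; intro i; simp [c]
    intro a
    rw [← MvPolynomial.coe_aeval_eq_eval]
    exact DFunLike.congr_fun this a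
  have he : ∃ e : Fin s → k, MvPolynomial.eval e N ≠ 0 := by
    by_contra h
    push Not at h
    exact hN0 (MvPolynomial.funext (fun e => by rw [h e]; simp))
  obtain ⟨e, he⟩ := he
  have hNc : MvPolynomial.eval c N = 0 := by
    obtain ⟨b, hb⟩ := hNf
    rw [← hc, hb, map_mul, hεf, zero_mul]
  let w : Fin s → k := fun i => e i - c i
  have hw : ∃ i, w i ≠ 0 := by
    by_contra h
    push Not at h
    apply he
    have : e = c := by funext i; exact sub_eq_zero.1 (h i)
    rw [this, hNc]
  obtain ⟨i0, hi0⟩ := hw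
  let ℓ : MvPolynomial (Fin s) k →ₐ[k] Polynomial k :=
    MvPolynomial.aeval (fun i => Polynomial.C (c i) + Polynomial.C (w i) * Polynomial.X)
  have hℓe : ∀ (u : k) a, Polynomial.eval u (ℓ a) = MvPolynomial.eval (fun i => c i + w i * u) a := by
    intro u a
    have : (Polynomial.aeval u : Polynomial k →ₐ[k] k).comp ℓ = MvPolynomial.aeval (fun i => c i + w i * u) := by
      apply MvPolynomial.algHom_ext; intro i; simp [ℓ]
    rw [← MvPolynomial.coe_aeval_eq_eval, ← Polynomial.coe_aeval_eq_eval]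
    exact DFunLike.congr_fun this a
  have hℓN : ℓ N ≠ 0 := by
    intro h
    apply he
    have := hℓe 1 N
    rw [h, Polynomial.eval_zero] at this
    rw [this]
    congr 2
    funext i; simp [w]
  have hℓs : Function.Surjective ℓ := by
    have hX : ℓ (MvPolynomial.C (w i0)⁻¹ * (X i0 - MvPolynomial.C (c i0))) = Polynomial.X := by
      simp only [ℓ, map_mul, map_sub, aeval_X, MvPolynomial.algHom_C, Polynomial.algebraMap_eq]
      rw [add_sub_cancel_left, ← mul_assoc, ← Polynomial.C_mul, inv_mul_cancel₀ hi0]; simp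
    intro p
    refine ⟨Polynomial.aeval (MvPolynomial.C (w i0)⁻¹ * (X i0 - MvPolynomial.C (c i0))) p, ?_⟩
    rw [← Polynomial.aeval_algHom_apply, hX, Polynomial.aeval_X_left_apply]
  haveI hLp : (RingHom.ker ℓ).IsPrime := RingHom.ker_isPrime ℓ.toRingHom
  haveI hQp : (RingHom.ker ε).IsPrime := RingHom.ker_isPrime ε.toRingHom
  have hle : RingHom.ker ℓ ≤ (RingHom.ker ε).under (MvPolynomial (Fin s) k) := by
    intro a ha
    change ε (g a) = 0
    rw [hc]
    have := hℓe 0 a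
    rw [(RingHom.mem_ker).1 ha] at this
    simpa using this.symm
  obtain ⟨P, hPQ, hPp, hPL⟩ := Ideal.exists_ideal_le_liesOver_of_le (R := MvPolynomial (Fin s) k)
    (p := RingHom.ker ℓ) (q := (RingHom.ker ε).under (MvPolynomial (Fin s) k)) (RingHom.ker ε) hle
  have hover : ∀ a, g a ∈ P ↔ ℓ a = 0 := by
    intro a
    have h1 := hPL.over
    rw [← RingHom.mem_ker, h1]; rfl
  let m : MvPolynomial (Fin s) k →ₐ[k] D ⧸ P := (Ideal.Quotient.mkₐ k P).comp g
  have hm : ∀ a, a ∈ RingHom.ker ℓ → m a = 0 := fun a ha => Ideal.Quotient.eq_zero_iff_mem.2 ((hover a).2 ha)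
  let r : Polynomial k →ₐ[k] D ⧸ P :=
    (Ideal.Quotient.liftₐ (RingHom.ker ℓ) m hm).comp
      (Ideal.quotientKerAlgEquivOfSurjective hℓs).symm
  have hr : ∀ a, r (ℓ a) = Ideal.Quotient.mk P (g a) := by
    intro a
    have h1 : (Ideal.quotientKerAlgEquivOfSurjective hℓs).symm (ℓ a) = Ideal.Quotient.mk _ a := by
      rw [AlgEquiv.symm_apply_eq]; rfl
    change (Ideal.Quotient.liftₐ (RingHom.ker ℓ) m hm) ((Ideal.quotientKerAlgEquivOfSurjective hℓs).symm (ℓ a)) = _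
    rw [h1]; rfl
  have hrinj : Function.Injective r := by
    rw [injective_iff_map_eq_zero]
    intro p hp
    obtain ⟨a, rfl⟩ := hℓs p
    rw [hr, Ideal.Quotient.eq_zero_iff_mem, hover] at hp
    exact hp
  have hrfin : r.toRingHom.Finite := by
    have h1 : (r.toRingHom.comp ℓ.toRingHom).Finite := by
      have h2 : r.toRingHom.comp ℓ.toRingHom = (Ideal.Quotient.mk P).comp g.toRingHom := by
        apply RingHom.ext; intro a; exact hr a
      rw [h2]
      exact RingHom.Finite.comp (RingHom.Finite.of_surjective _ Ideal.Quotient.mk_surjective) hgfin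
    exact RingHom.Finite.of_comp_finite h1
  letI : Algebra (Polynomial k) (D ⧸ P) := r.toRingHom.toAlgebra
  haveI : IsScalarTower k (Polynomial k) (D ⧸ P) := IsScalarTower.of_algebraMap_eq (fun c => by
    change _ = r _
    rw [← AlgHom.commutes r])
  haveI : Module.Finite (Polynomial k) (D ⧸ P) := hrfin
  haveI : FaithfulSMul (Polynomial k) (D ⧸ P) := (faithfulSMul_iff_algebraMap_injective _ _).2 hrinj
  let ε' : D ⧸ P →ₐ[k] k := Ideal.Quotient.liftₐ P ε (fun a ha => hPQ ha)
  obtain ⟨φ, hφ, hφ2⟩ := dim1 ε'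
  refine ⟨φ.comp (Ideal.Quotient.mkₐ k P), fun a => ?_, ?_⟩
  · change PowerSeries.constantCoeff (φ _) = _
    rw [hφ2]; rfl
  · change φ (Ideal.Quotient.mk P f) ≠ 0
    intro h
    rw [map_eq_zero_iff _ hφ, Ideal.Quotient.eq_zero_iff_mem] at h
    apply hℓN
    rw [← hover]
    obtain ⟨b, hb⟩ := hNf
    rw [hb]
    exact P.mul_mem_right _ h
end F19
end PaperGIT

namespace PaperGIT
section F20
set_option linter.unusedSectionVars false
set_option linter.unusedVariables false
open MvPolynomial
variable {k : Type} [Field k] {ι : Type} [Fintype ι] [DecidableEq ι]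

theorem null_ext [IsAlgClosed k] {D : Type} [CommRing D] [Algebra k D] [Algebra.FiniteType k D] (J : Ideal D)
    (hJ : J ≠ ⊤) : ∃ ε : D →ₐ[k] k, ∀ a ∈ J, ε a = 0 := by
  obtain ⟨M, hM, hJM⟩ := Ideal.exists_le_maximal J hJ
  letI : Field (D ⧸ M) := Ideal.Quotient.field M
  haveI : Module.Finite k (D ⧸ M) := finite_of_finite_type_of_isJacobsonRing k (D ⧸ M)
  have hbij : Function.Bijective (algebraMap k (D ⧸ M)) := IsAlgClosed.algebraMap_bijective_of_isIntegral
  let e := (AlgEquiv.ofBijective (Algebra.ofId k (D ⧸ M)) hbij)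
  refine ⟨(e.symm : (D ⧸ M) →ₐ[k] k).comp (Ideal.Quotient.mkₐ k M), fun a ha => ?_⟩
  change e.symm (Ideal.Quotient.mk M a) = 0
  rw [Ideal.Quotient.eq_zero_iff_mem.2 (hJM ha), map_zero]

theorem loc_transfer {F K : Type} [Field F] [Field K] [Algebra k F] [Algebra k K] (D : Subalgebra k F)
    (χ : D →ₐ[k] K) : ∃ (R : Type) (_ : CommRing R) (_ : Algebra k R) (a : R →ₐ[k] F) (b : R →ₐ[k] K)
      (j : D →ₐ[k] R), Function.Injective a ∧ (∀ d, a (j d) = d) ∧ (∀ d, b (j d) = χ d) ∧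
      ∀ n e : D, χ e ≠ 0 → ∃ ξ : R, a ξ = (n : F) / (e : F) ∧ b ξ = χ n / χ e := by
  let q : Ideal D := RingHom.ker χ
  haveI : q.IsPrime := RingHom.ker_isPrime χ.toRingHom
  let R := Localization.AtPrime q
  have h1 : ∀ y : q.primeCompl, IsUnit (D.val y) := by
    intro y
    apply isUnit_iff_ne_zero.2
    intro h
    apply y.2
    have : (y : D) = 0 := Subtype.ext h
    rw [this]; exact q.zero_mem
  have h2 : ∀ y : q.primeCompl, IsUnit (χ y) := fun y => isUnit_iff_ne_zero.2 (fun h => y.2 h)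
  let a : R →ₐ[k] F := IsLocalization.liftAlgHom (M := q.primeCompl) (f := D.val) h1
  let b : R →ₐ[k] K := IsLocalization.liftAlgHom (M := q.primeCompl) (f := χ) h2
  have ha : ∀ d, a (algebraMap D R d) = d := fun d => IsLocalization.lift_eq _ _
  have hb : ∀ d, b (algebraMap D R d) = χ d := fun d => IsLocalization.lift_eq _ _
  refine ⟨R, inferInstance, inferInstance, a, b, IsScalarTower.toAlgHom k D R, ?_, ha, hb, ?_⟩
  · rw [injective_iff_map_eq_zero]
    intro r hr
    obtain ⟨n, e, rfl⟩ := IsLocalization.exists_mk'_eq q.primeCompl r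
    have h3 : a (algebraMap D R n) = 0 := by
      rw [← IsLocalization.mk'_spec R n e, map_mul, hr, zero_mul]
    rw [ha] at h3
    have h4 : n = 0 := Subtype.ext h3
    rw [h4, IsLocalization.mk'_zero]
  · intro n e he
    have he' : e ∈ q.primeCompl := he
    have hs := IsLocalization.mk'_spec R n ⟨e, he'⟩
    refine ⟨IsLocalization.mk' R n ⟨e, he'⟩, ?_, ?_⟩
    · rw [eq_div_iff, ← ha, ← ha, ← map_mul, hs]
      intro h
      have : e = 0 := Subtype.ext h
      rw [this, map_zero] at he; exact he rfl
    · rw [eq_div_iff he, ← hb, ← hb, ← map_mul, hs]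

variable {Γ : Set (Matrix ι ι k)}

theorem curve_exists [CharZero k] [IsAlgClosed k] {v y : ι → k} (hy : InClo Γ v y) :
    ∃ g ∈ pts Γ (KK k), ∃ C : ι → PowerSeries k, g.mulVec (cK v) = (fun i => psi k (C i)) ∧
      (fun i => PowerSeries.constantCoeff (C i)) = y := by
  classical
  let θ : MvPolynomial ι k →ₐ[k] MvPolynomial (ι × ι) k :=
    aeval (fun i => ∑ j, X (i, j) * MvPolynomial.C (v j))
  have hθ : ∀ γ : Matrix ι ι k, ∀ f, evM γ (θ f) = eval (γ.mulVec v) f := by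
    intro γ f
    have : (evM γ).comp θ = aeval (γ.mulVec v) := by
      apply MvPolynomial.algHom_ext; intro i
      simp [θ, evM, Matrix.mulVec, dotProduct]
    rw [← MvPolynomial.coe_aeval_eq_eval]
    exact DFunLike.congr_fun this f
  let I0 : Ideal (MvPolynomial (ι × ι) k) := ⨅ γ ∈ Γ, RingHom.ker (evM γ)
  have hI0 : ∀ f, f ∈ I0 ↔ f ∈ van Γ := by
    intro f; simp only [I0, Ideal.mem_iInf, RingHom.mem_ker]; rfl
  haveI : (RingHom.ker (MvPolynomial.eval y)).IsPrime := RingHom.ker_isPrime _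
  let S0 : Submonoid (MvPolynomial ι k) := (RingHom.ker (MvPolynomial.eval y)).primeCompl
  obtain ⟨P, hPp, hIP, hPS⟩ := Ideal.exists_le_prime_disjoint I0 (S0.map θ) (by
    rw [Set.disjoint_left]
    rintro _ hf ⟨f, hf2, rfl⟩
    apply hf2
    apply hy
    intro γ hγ
    rw [← hθ]
    exact (hI0 _).1 hf γ hγ)
  have hPy : ∀ f, θ f ∈ P → eval y f = 0 := by
    intro f hf
    by_contra h
    exact (Set.disjoint_left.1 hPS hf) ⟨f, h, rfl⟩
  let F := FractionRing (MvPolynomial (ι × ι) k ⧸ P)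
  let r : MvPolynomial (ι × ι) k →ₐ[k] F :=
    (IsScalarTower.toAlgHom k (MvPolynomial (ι × ι) k ⧸ P) F).comp (Ideal.Quotient.mkₐ k P)
  have hr : ∀ f, r f = 0 ↔ f ∈ P := by
    intro f
    change algebraMap (MvPolynomial (ι × ι) k ⧸ P) F (Ideal.Quotient.mk P f) = 0 ↔ _
    rw [map_eq_zero_iff _ (IsFractionRing.injective _ F), Ideal.Quotient.eq_zero_iff_mem]
  let x : Matrix ι ι F := Matrix.of fun i j => r (X (i, j))
  have hrx : ∀ f, r f = evM x f := by
    have : r = evM x := by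
      apply MvPolynomial.algHom_ext; intro p; simp [evM, x]
    intro f; rw [this]
  let h : MvPolynomial ι k →ₐ[k] F := r.comp θ
  have hX : ∀ i, h (X i) = ∑ j, x i j * algebraMap k F (v j) := by
    intro i
    change r (θ (X i)) = _
    simp only [θ, aeval_X, map_sum, map_mul, MvPolynomial.algHom_C]
    rfl
  let A0 : Subring F := h.toRingHom.range
  let hh : MvPolynomial ι k →+* A0 := h.toRingHom.rangeRestrict
  let I : Ideal A0 := (RingHom.ker (MvPolynomial.eval y)).map hh
  have hIt : I ≠ ⊤ := by
    rw [Ne, Ideal.eq_top_iff_one]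
    intro h1
    obtain ⟨f, hf, hf1⟩ := (Ideal.mem_map_iff_of_surjective hh (RingHom.rangeRestrict_surjective _)).1 h1
    have h2 : h (f - 1) = 0 := by
      rw [map_sub, map_one, sub_eq_zero]
      exact congrArg Subtype.val hf1
    have h3 := hPy _ ((hr _).1 h2)
    rw [map_sub, (RingHom.mem_ker).1 hf] at h3
    simp at h3
  obtain ⟨V, hAV, hIV⟩ := Ideal.image_subset_nonunits_valuationSubring I hIt
  have hhV : ∀ f, h f ∈ V := fun f => hAV ⟨f, rfl⟩
  have hhI : ∀ f, eval y f = 0 → h f ∈ V.nonunits := by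
    intro f hf
    apply hIV
    exact ⟨hh f, Ideal.mem_map_of_mem _ hf, rfl⟩
  let z : ι × ι → F := fun p => if x p.1 p.2 ∈ V then x p.1 p.2 else (x p.1 p.2)⁻¹
  have hzV : ∀ p, z p ∈ V := by
    intro p
    simp only [z]
    split_ifs with h1
    · exact h1
    · exact (V.mem_or_inv_mem _).resolve_left h1
  let T : Set F := Set.range z ∪ Set.range (fun i => h (X i))
  let D : Subalgebra k F := Algebra.adjoin k T
  have hT : T.Finite := (Set.finite_range _).union (Set.finite_range _)
  haveI : Algebra.FiniteType k D := by
    rw [← Subalgebra.fg_iff_finiteType]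
    exact ⟨hT.toFinset, by simp [D]⟩
  have hDV : ∀ d ∈ D, d ∈ V := by
    intro d hd
    induction hd using Algebra.adjoin_induction with
    | mem d hd =>
      rcases hd with ⟨p, rfl⟩ | ⟨i, rfl⟩
      · exact hzV p
      · exact hhV _
    | algebraMap c => rw [← AlgHom.commutes h]; exact hhV _
    | add a b _ _ ha hb => exact V.add_mem _ _ ha hb
    | mul a b _ _ ha hb => exact V.mul_mem _ _ ha hb
  let zD : ι × ι → D := fun p => ⟨z p, Algebra.subset_adjoin (Or.inl ⟨p, rfl⟩)⟩
  let hD : ι → D := fun i => ⟨h (X i), Algebra.subset_adjoin (Or.inr ⟨i, rfl⟩)⟩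
  let J : Ideal D := 
    { carrier := {d | (d : F) ∈ V.nonunits}
      add_mem' := by
        intro a b ha hb
        simp only [Set.mem_setOf_eq, ValuationSubring.mem_nonunits_iff] at *
        exact V.valuation.map_add_lt ha hb
      zero_mem' := by
        simp [ValuationSubring.mem_nonunits_iff]
      smul_mem' := by
        intro a b hb
        simp only [Set.mem_setOf_eq, ValuationSubring.mem_nonunits_iff] at *
        have h1 := (V.valuation_le_one_iff _).2 (hDV a a.2)
        change V.valuation ((a : F) * (b : F)) < 1
        rw [map_mul]
        exact lt_of_le_of_lt (mul_le_of_le_one_left' h1) hb }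
  have hJ : J ≠ ⊤ := by
    rw [Ne, Ideal.eq_top_iff_one]
    intro h1
    have h2 : (1 : F) ∈ V.nonunits := h1
    rw [ValuationSubring.mem_nonunits_iff, map_one] at h2
    exact lt_irrefl _ h2
  obtain ⟨ε, hε⟩ := null_ext (k := k) J hJ
  have hεy : ∀ i, ε (hD i) = y i := by
    intro i
    have h1 : hD i - algebraMap k D (y i) ∈ J := by
      have h2 := hhI (X i - MvPolynomial.C (y i)) (by simp)
      rw [map_sub, MvPolynomial.algHom_C] at h2
      exact h2
    have h3 := hε _ h1
    rw [map_sub, AlgHom.commutes, sub_eq_zero] at h3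
    exact h3
  let e : ι × ι → D := fun p => if x p.1 p.2 ∈ V then 1 else zD p
  let n : ι × ι → D := fun p => if x p.1 p.2 ∈ V then zD p else 1
  have he0 : ∀ p, e p ≠ 0 := by
    intro p
    simp only [e]
    split_ifs with h1
    · exact one_ne_zero
    · intro h2
      have h3 : z p = 0 := congrArg Subtype.val h2
      simp only [z, if_neg h1] at h3
      rw [inv_eq_zero] at h3
      rw [h3] at h1
      exact h1 V.zero_mem
  have hxne : ∀ p : ι × ι, x p.1 p.2 = (n p : F) / (e p : F) := by
    intro p
    simp only [e, n]
    split_ifs with h1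
    · simp [zD, z, if_pos h1]
    · simp [zD, z, if_neg h1]
  obtain ⟨χ, hχ, hχf⟩ := curve1 ε (∏ p, e p) (Finset.prod_ne_zero_iff.2 fun p _ => he0 p)
  have hχe : ∀ p, psi k (χ (e p)) ≠ 0 := by
    intro p
    apply psi_ne
    rw [map_prod, Finset.prod_ne_zero_iff] at hχf
    exact hχf p (Finset.mem_univ _)
  obtain ⟨R, iR, aR, a, b, j, hainj, haj, hbj, hab⟩ := loc_transfer D ((psi k).comp χ)
  choose ξ hξa hξb using fun p => hab (n p) (e p) (hχe p)
  let Ξ : Matrix ι ι R := Matrix.of fun i j => ξ (i, j)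
  have hΞa : Ξ.map a = x := by
    ext i j
    rw [hxne (i, j)]
    exact hξa (i, j)
  refine ⟨Ξ.map b, ?_, fun i => χ (hD i), ?_, ?_⟩
  · intro f hf
    rw [evM_map]
    have h1 : a (evM Ξ f) = 0 := by
      rw [← evM_map, hΞa, ← hrx, hr]
      exact hIP ((hI0 f).2 hf)
    rw [(map_eq_zero_iff a hainj).1 h1, map_zero]
  · funext i
    rw [cK_eq]
    change ∑ l, b (Ξ i l) * algebraMap k (KK k) (v l) = _
    have h1 : ∑ l, Ξ i l * algebraMap k R (v l) = j (hD i) := by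
      apply hainj
      rw [haj, map_sum]
      change _ = h (X i)
      rw [hX, ← hΞa]
      simp [Matrix.map_apply]
    have h2 := congrArg b h1
    rw [hbj, map_sum] at h2
    simp only [map_mul, AlgHom.commutes] at h2
    exact h2
  · funext i
    rw [hχ, hεy]

theorem abstract_main [CharZero k] [IsAlgClosed k] (hΓ : IsSLGroup Γ) (hN : NoUnip Γ) {v : ι → k}
    (hpr : ProperAt Γ v) : OrbClosed Γ v ↔ CRat Γ v := by
  refine ⟨cr_of_closed hΓ v hpr, fun hcr y hy => ?_⟩
  obtain ⟨g, hg, C, hC, rfl⟩ := curve_exists hy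
  exact curve_orbit hΓ hg hC (curve_dim hΓ (traceNondeg_of_noUnip hΓ hN) hpr hcr hg hC)
end F20
end PaperGIT

namespace PaperGIT
section F21
set_option linter.unusedSectionVars false
set_option linter.unusedVariables false
open MvPolynomial
variable {k : Type} [Field k]

/-- coordinates of a group element used in regular functions -/
def gpt {n : ℕ} (g : GL (Fin n) k) : (Fin n × Fin n) ⊕ Unit → k :=
  Sum.elim (mat2pt (g : Matrix (Fin n) (Fin n) k))
    (fun _ => ((g⁻¹ : GL (Fin n) k) : Matrix (Fin n) (Fin n) k).det)

/-- A faithful linearization of a `G`-variety inside some special linear group. -/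
structure LinRep (G : AlgGroup k) {m : ℕ} (X : GVariety G m) (J : Type) [Fintype J] [DecidableEq J] where
  σ : GL (Fin G.n) k → Matrix J J k
  map_one : σ 1 = 1
  map_mul : ∀ g ∈ G.toSubgroup, ∀ h ∈ G.toSubgroup, σ (g * h) = σ g * σ h
  det_one : ∀ g ∈ G.toSubgroup, (σ g).det = 1
  e1 : Fin G.n → J
  e2 : Fin G.n → J
  e1_inj : Function.Injective e1
  he1 : ∀ g ∈ G.toSubgroup, ∀ a b, σ g (e1 a) (e1 b) = (g : Matrix (Fin G.n) (Fin G.n) k) a b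
  he1' : ∀ g ∈ G.toSubgroup, ∀ a q, (∀ b, q ≠ e1 b) → σ g (e1 a) q = 0
  he2 : ∀ g ∈ G.toSubgroup, ∀ a b, σ g (e2 a) (e2 b) = ((g⁻¹ : GL (Fin G.n) k) : Matrix (Fin G.n) (Fin G.n) k) b a
  P : J → J → MvPolynomial ((Fin G.n × Fin G.n) ⊕ Unit) k
  reg : ∀ g ∈ G.toSubgroup, ∀ i j, σ g i j = eval (gpt g) (P i j)
  wp : J → MvPolynomial (Fin m) k
  hw : ∀ g ∈ G.toSubgroup, ∀ x ∈ X.carrier,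
    (fun j => eval (X.act g x) (wp j)) = (σ g).mulVec (fun j => eval x (wp j))
  lc : Matrix (Fin m) J k
  hlc : ∀ x ∈ X.carrier, lc.mulVec (fun j => eval x (wp j)) = x

namespace LinRep
variable {G : AlgGroup k} {m : ℕ} {Y : GVariety G m} {J : Type} [Fintype J] [DecidableEq J] (L : LinRep G Y J)

/-- the linearized group -/
def Γ : Set (Matrix J J k) := {A | ∃ g ∈ G.toSubgroup, L.σ g = A}

/-- the linearized point -/
noncomputable def w (x : Fin m → k) : J → k := fun j => eval x (L.wp j)

lemma w_act {g : GL (Fin G.n) k} (hg : g ∈ G.toSubgroup) {x : Fin m → k} (hx : x ∈ Y.carrier) :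
    L.w (Y.act g x) = (L.σ g).mulVec (L.w x) := L.hw g hg x hx

lemma lc_w {x : Fin m → k} (hx : x ∈ Y.carrier) : L.lc.mulVec (L.w x) = x := L.hlc x hx

lemma σ_inj {g h : GL (Fin G.n) k} (hg : g ∈ G.toSubgroup) (hh : h ∈ G.toSubgroup) (e : L.σ g = L.σ h) : g = h := by
  apply Units.ext
  ext a b
  rw [← L.he1 g hg, ← L.he1 h hh, e]

lemma σ_mem {g : GL (Fin G.n) k} (hg : g ∈ G.toSubgroup) : L.σ g ∈ L.Γ := ⟨g, hg, rfl⟩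

lemma σ_inv {g : GL (Fin G.n) k} (hg : g ∈ G.toSubgroup) : L.σ g * L.σ g⁻¹ = 1 := by
  rw [← L.map_mul g hg _ (G.toSubgroup.inv_mem hg), mul_inv_cancel, L.map_one]

/-- Evaluate a polynomial identity valid on `Γ`. -/
lemma pts_eq {A : Matrix J J k} (hA : A ∈ pts L.Γ k) (f : MvPolynomial (J × J) k)
    (hf : ∀ g ∈ G.toSubgroup, evM (L.σ g) f = 0) : evM A f = 0 := by
  apply hA
  rintro _ ⟨g, hg, rfl⟩
  exact hf g hg

theorem isSL : IsSLGroup L.Γ where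
  one_mem := ⟨1, G.toSubgroup.one_mem, L.map_one⟩
  mul_mem := by
    rintro _ ⟨g, hg, rfl⟩ _ ⟨h, hh, rfl⟩
    exact ⟨g * h, G.toSubgroup.mul_mem hg hh, L.map_mul g hg h hh⟩
  inv_mem := by
    rintro _ ⟨g, hg, rfl⟩
    refine ⟨g⁻¹, G.toSubgroup.inv_mem hg, ?_⟩
    have h1 := L.σ_inv hg
    have h2 : (L.σ g).adjugate * L.σ g = 1 := by rw [Matrix.adjugate_mul, L.det_one g hg, one_smul]
    calc L.σ g⁻¹ = ((L.σ g).adjugate * L.σ g) * L.σ g⁻¹ := by rw [h2, one_mul]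
      _ = _ := by rw [mul_assoc, h1, mul_one]
  det_one := by
    rintro _ ⟨g, hg, rfl⟩
    exact L.det_one g hg
  closed := by
    intro A hA
    let B : Matrix (Fin G.n) (Fin G.n) k := Matrix.of fun a b => A (L.e1 a) (L.e1 b)
    let B' : Matrix (Fin G.n) (Fin G.n) k := Matrix.of fun a b => A (L.e2 b) (L.e2 a)
    have hBB : B * B' = 1 := by
      ext a b
      have h1 := L.pts_eq hA (∑ c, X (L.e1 a, L.e1 c) * X (L.e2 b, L.e2 c) - MvPolynomial.C ((1 : Matrix (Fin G.n) (Fin G.n) k) a b)) (by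
        intro g hg
        have h2 : ((g : Matrix (Fin G.n) (Fin G.n) k) * ((g⁻¹ : GL (Fin G.n) k) : Matrix (Fin G.n) (Fin G.n) k)) a b = (1 : Matrix (Fin G.n) (Fin G.n) k) a b := by
          rw [← Units.val_mul, mul_inv_cancel]; rfl
        simp only [evM, map_sub, map_sum, map_mul, aeval_X, L.he1 g hg, L.he2 g hg]
        rw [← h2, Matrix.mul_apply]
        simp [L.he1 g hg, L.he2 g hg])
      simp only [evM, map_sub, map_sum, map_mul, aeval_X] at h1
      rw [Matrix.mul_apply]
      simpa [B, B'] using sub_eq_zero.1 h1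
    let g : GL (Fin G.n) k := ⟨B, B', hBB, mul_eq_one_comm.1 hBB⟩
    have hg : g ∈ G.toSubgroup := by
      obtain ⟨I, hI⟩ := G.closed
      rw [hI]
      intro f hf
      have h1 := L.pts_eq hA (rename (fun p => (L.e1 p.1, L.e1 p.2)) f) (by
        intro g hg
        have h2 := (hI g).1 hg f hf
        rw [evM, aeval_rename]
        have : ((fun p : J × J => L.σ g p.1 p.2) ∘ fun p : Fin G.n × Fin G.n => (L.e1 p.1, L.e1 p.2)) = mat2pt (g : Matrix (Fin G.n) (Fin G.n) k) := by
          funext p; exact L.he1 g hg _ _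
        rw [this]; exact h2)
      rw [evM, aeval_rename] at h1
      exact h1
    refine ⟨g, hg, ?_⟩
    ext i j
    rw [L.reg g hg]
    let s : (Fin G.n × Fin G.n) ⊕ Unit → MvPolynomial (J × J) k := Sum.elim (fun p => X (L.e1 p.1, L.e1 p.2))
      (fun _ => (Matrix.of fun a b => (X (L.e2 b, L.e2 a) : MvPolynomial (J × J) k)).det)
    have hs : ∀ (C : Matrix J J k) (g : GL (Fin G.n) k), (∀ a b, C (L.e1 a) (L.e1 b) = (g : Matrix (Fin G.n) (Fin G.n) k) a b) →
        (∀ a b, C (L.e2 a) (L.e2 b) = ((g⁻¹ : GL (Fin G.n) k) : Matrix (Fin G.n) (Fin G.n) k) b a) →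
        ∀ f, evM C (aeval s f) = eval (gpt g) f := by
      intro C g h1 h2 f
      have : (evM C).comp (aeval s) = aeval (gpt g) := by
        apply MvPolynomial.algHom_ext
        rintro (p | p)
        · simp [s, evM, gpt, h1, mat2pt]
        · simp only [AlgHom.comp_apply, aeval_X, s, gpt, Sum.elim_inr]
          rw [AlgHom.map_det]
          congr 1
          ext a b
          simp [evM, h2]
      exact DFunLike.congr_fun this f
    have h1 := L.pts_eq hA (aeval s (L.P i j) - X (i, j)) (by
      intro g hg
      rw [map_sub, hs (L.σ g) g (L.he1 g hg) (L.he2 g hg), ← L.reg g hg]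
      simp [evM])
    rw [map_sub, hs A g (fun _ _ => rfl) (fun _ _ => rfl), sub_eq_zero] at h1
    rw [h1]; simp [evM]
end LinRep
end F21
end PaperGIT

namespace PaperGIT
section F22
set_option linter.unusedSectionVars false
set_option linter.unusedVariables false
open MvPolynomial
variable {k : Type} [Field k]

/-- Evaluation of a Laurent polynomial at a unit. -/
noncomputable def lev {A : Type} [CommRing A] [Algebra k A] (u : Aˣ) : LaurentPolynomial k →ₐ[k] A :=
  AddMonoidAlgebra.lift k A ℤ ((Units.coeHom A).comp (zpowersHom Aˣ u))

lemma lev_apply {A : Type} [CommRing A] [Algebra k A] (u : Aˣ) (f : LaurentPolynomial k) :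
    lev u f = f.coeff.sum fun a b => b • ((u ^ a : Aˣ) : A) := by
  rw [lev, AddMonoidAlgebra.lift_apply]
  rfl

lemma lev_apply_sup {A : Type} [CommRing A] [Algebra k A] (u : Aˣ) (f : LaurentPolynomial k) (S : Finset ℤ)
    (hS : f.coeff.support ⊆ S) :
    lev u f = ∑ a ∈ S, f.coeff a • ((u ^ a : Aˣ) : A) := by
  rw [lev_apply, Finsupp.sum_of_support_subset _ hS]
  simp

lemma lev_T {A : Type} [CommRing A] [Algebra k A] (u : Aˣ) (n : ℤ) :
    lev u (LaurentPolynomial.T n : LaurentPolynomial k) = ((u ^ n : Aˣ) : A) := by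
  rw [lev, LaurentPolynomial.T, AddMonoidAlgebra.lift_single]
  simp

lemma lev_inj [Infinite k] {f : LaurentPolynomial k} (h : ∀ t : kˣ, lev t f = 0) : f = 0 := by
  have h1 := laurent_indep f.coeff.support f.coeff (fun t ht => by
    have := h (Units.mk0 t ht)
    rw [lev_apply_sup _ _ _ subset_rfl] at this
    rw [← this]
    apply Finset.sum_congr rfl
    intro a _
    simp [mul_comm])
  apply AddMonoidAlgebra.ext
  ext a
  by_cases ha : a ∈ f.coeff.support
  · rw [h1 a ha]; rfl
  · rw [Finsupp.notMem_support_iff.1 ha]; rfl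

/-- the unit `1+ε` -/
noncomputable def ueps : (DualNumber k)ˣ where
  val := 1 + DualNumber.eps
  inv := 1 - DualNumber.eps
  val_inv := by
    have := DualNumber.eps_mul_eps (R := k)
    linear_combination -this
  inv_val := by
    have := DualNumber.eps_mul_eps (R := k)
    linear_combination -this

lemma ueps_pow (n : ℤ) : ((ueps ^ n : (DualNumber k)ˣ) : DualNumber k) = 1 + (n : DualNumber k) * DualNumber.eps := by
  have he := DualNumber.eps_mul_eps (R := k)
  induction n using Int.induction_on with
  | zero => simp
  | succ n ih =>
    rw [zpow_add, zpow_one, Units.val_mul, ih, show ((ueps : (DualNumber k)ˣ) : DualNumber k) = 1 + DualNumber.eps from rfl]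
    push_cast
    linear_combination (n : DualNumber k) * he
  | pred n ih =>
    rw [zpow_sub, zpow_one, Units.val_mul, ih, show ((ueps⁻¹ : (DualNumber k)ˣ) : DualNumber k) = 1 - DualNumber.eps from rfl]
    push_cast
    linear_combination (n : DualNumber k) * he

lemma ueps_sum (S : Finset ℤ) (E : ℤ → k) :
    ∑ a ∈ S, E a • ((ueps ^ a : (DualNumber k)ˣ) : DualNumber k) =
      TrivSqZeroExt.inl (∑ a ∈ S, E a) + TrivSqZeroExt.inr (∑ a ∈ S, (a : k) * E a) := by
  classical
  induction S using Finset.induction_on with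
  | empty => simp
  | insert a S ha ih =>
    rw [Finset.sum_insert ha, ih, Finset.sum_insert ha, Finset.sum_insert ha, ueps_pow,
      TrivSqZeroExt.inl_add, TrivSqZeroExt.inr_add]
    have : E a • (1 + (a : DualNumber k) * DualNumber.eps) =
      TrivSqZeroExt.inl (E a) + TrivSqZeroExt.inr ((a : k) * E a) := by
      ext
      · simp
      · simp [mul_comm]
    rw [this]
    abel

variable {J : Type} [Fintype J] [DecidableEq J]

/-- A family of matrices with Laurent polynomial entries, multiplicative and in `Γ`, is a `PS`. -/
lemma PS_of_laurent [CharZero k] {Γ : Set (Matrix J J k)} (hΓ : IsSLGroup Γ)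
    (M : Matrix J J (LaurentPolynomial k)) (hM : ∀ t : kˣ, M.map (lev t) ∈ Γ)
    (h1 : M.map (lev (1 : kˣ)) = 1)
    (hmul : ∀ s t : kˣ, M.map (lev (s * t)) = M.map (lev s) * M.map (lev t)) :
    ∃ l : PS Γ, ∀ t : kˣ, M.map (lev t) = l.at' (t : k) := by
  classical
  let S : Finset ℤ := Finset.univ.biUnion fun p : J × J => (M p.1 p.2).coeff.support
  have hS : ∀ i j, (M i j).coeff.support ⊆ S := by
    intro i j
    exact Finset.subset_biUnion_of_mem (fun p : J × J => (M p.1 p.2).coeff.support) (Finset.mem_univ (i, j))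
  let e : ℤ → Matrix J J k := fun a => Matrix.of fun i j => (M i j).coeff a
  have he0 : ∀ a, a ∉ S → e a = 0 := by
    intro a ha
    ext i j
    have : a ∉ (M i j).coeff.support := fun h => ha (hS i j h)
    exact Finsupp.notMem_support_iff.1 this
  have hev : ∀ {A : Type} [CommRing A] [Algebra k A] (u : Aˣ) (i j : J),
      (M.map (lev u)) i j = ∑ a ∈ S, e a i j • ((u ^ a : Aˣ) : A) := by
    intro A _ _ u i j
    exact lev_apply_sup u (M i j) S (hS i j)
  have hevk : ∀ (t : kˣ), M.map (lev t) = ∑ a ∈ S, ((t : k) ^ a) • e a := by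
    intro t
    ext i j
    rw [hev, Matrix.sum_apply]
    apply Finset.sum_congr rfl
    intro a _
    simp [mul_comm]
  have key : ∀ s : kˣ, ∀ a ∈ S, e a * (M.map (lev s)) = ((s : k) ^ a) • e a := by
    intro s a ha
    ext i j
    have := laurent_indep S (fun a => (e a * (M.map (lev s))) i j - (((s : k) ^ a) • e a) i j) (fun t ht => by
      have h2 := hmul (Units.mk0 t ht) s
      rw [hevk (Units.mk0 t ht), Finset.sum_mul, hevk (Units.mk0 t ht * s)] at h2
      have h3 := congrFun (congrFun h2 i) j
      rw [Matrix.sum_apply, Matrix.sum_apply] at h3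
      rw [← sub_eq_zero, ← Finset.sum_sub_distrib] at h3
      rw [← neg_eq_zero, ← h3, ← Finset.sum_neg_distrib]
      apply Finset.sum_congr rfl
      intro b _
      simp only [Units.val_mul, Units.val_mk0, Matrix.smul_apply, smul_eq_mul, Matrix.smul_mul, mul_zpow]
      ring) a ha
    exact sub_eq_zero.1 this
  have horth : ∀ p q, e p * e q = if p = q then e p else 0 := by
    intro p q
    by_cases hp : p ∈ S
    · by_cases hq : q ∈ S
      · ext i j
        have := laurent_indep S (fun b => (e p * e b) i j - (if p = b then e p else 0) i j) (fun t ht => by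
          have h2 := key (Units.mk0 t ht) p hp
          rw [hevk (Units.mk0 t ht), Finset.mul_sum] at h2
          have h3 := congrFun (congrFun h2 i) j
          rw [Matrix.sum_apply] at h3
          simp only [mul_sub]
          rw [Finset.sum_sub_distrib, sub_eq_zero]
          have h4 : ∑ b ∈ S, t ^ b * (if p = b then e p else 0) i j = t ^ p * e p i j := by
            rw [Finset.sum_eq_single p]
            · simp
            · intro b _ hb
              rw [if_neg (Ne.symm hb)]; simp
            · intro h; exact absurd hp h
          rw [h4]
          simp only [Units.val_mk0, Matrix.smul_apply, smul_eq_mul] at h3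
          rw [← h3]
          apply Finset.sum_congr rfl
          intro b _
          simp) q hq
        exact sub_eq_zero.1 this
      · rw [he0 q hq, mul_zero, if_neg]
        rintro rfl; exact hq hp
    · rw [he0 p hp, zero_mul]; simp
  have hsum : ∑ p ∈ S, e p = 1 := by
    rw [← h1, hevk]; simp
  obtain ⟨c, c', d, hc, h5, h6⟩ := diag_idem S e horth hsum
  have hzero : ∀ f ∈ van Γ, evM M f = 0 := by
    intro f hf
    apply lev_inj
    intro t
    have := evM_map (lev t) M f
    rw [← this]
    exact hf _ (hM t)
  refine ⟨⟨c, c', d, hc, ?_⟩, ?_⟩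
  · rw [mem_lie_iff hΓ]
    intro f hf
    have h7 : Matrix.map (1 : Matrix J J k) TrivSqZeroExt.inl +
        (c' * Matrix.diagonal (fun i => (d i : k)) * c).map TrivSqZeroExt.inr = M.map (lev (A := DualNumber k) (ueps (k := k))) := by
      ext1 i j
      rw [hev, h6 (fun a => (a : k)), ← hsum]
      rw [Matrix.add_apply, Matrix.map_apply, Matrix.map_apply, Matrix.sum_apply, Matrix.sum_apply]
      exact (ueps_sum S (fun a => e a i j)).symm
    have h8 := evM_map (lev (A := DualNumber k) (ueps (k := k))) M f
    rw [h7]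
    refine h8.trans ?_
    rw [hzero f hf, _root_.map_zero]
  · intro t
    rw [hevk, PS.at']
    exact (h6 (fun a => (t : k) ^ a)).symm

end F22
end PaperGIT

namespace PaperGIT
section F23
set_option linter.unusedSectionVars false
set_option linter.unusedVariables false
open MvPolynomial
variable {k : Type} [Field k]

lemma poly_eq_of_units [Infinite k] {p q : Polynomial k} (h : ∀ t : kˣ, p.eval (t : k) = q.eval (t : k)) : p = q := by
  rw [← sub_eq_zero]
  apply Polynomial.eq_zero_of_infinite_isRoot
  apply Set.Infinite.mono (s := {t : k | t ≠ 0})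
  · intro t ht
    change (p - q).eval t = 0
    have := h (Units.mk0 t ht)
    rw [Units.val_mk0] at this
    rw [Polynomial.eval_sub, this, sub_self]
  · exact (Set.finite_singleton (0 : k)).infinite_compl

lemma zpow_poly_zero [Infinite k] {q : Polynomial k} {c : k} {d : ℤ} (hd : d < 0)
    (h : ∀ t : kˣ, (t : k) ^ d * c = q.eval (t : k)) : c = 0 := by
  have h1 : Polynomial.C c = q * Polynomial.X ^ (-d).toNat := by
    apply poly_eq_of_units
    intro t
    have h2 := h t
    rw [Polynomial.eval_C, Polynomial.eval_mul, Polynomial.eval_pow, Polynomial.eval_X, ← h2,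
      ← zpow_natCast, Int.toNat_of_nonneg (by omega)]
    have : (t : k) ^ d * (t : k) ^ (-d) = 1 := by
      rw [← zpow_add₀ t.ne_zero]; simp
    linear_combination -c * this
  have h3 := congrArg (Polynomial.eval 0) h1
  rw [Polynomial.eval_C, Polynomial.eval_mul, Polynomial.eval_pow, Polynomial.eval_X, zero_pow (by omega), mul_zero] at h3
  exact h3

lemma zpow_poly_pos [Infinite k] {q : Polynomial k} {c : k} {d : ℤ} (hd : 0 < d)
    (h : ∀ t : kˣ, (t : k) ^ d * c = q.eval (t : k)) : q.eval 0 = 0 := by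
  have h1 : q = Polynomial.C c * Polynomial.X ^ d.toNat := by
    apply poly_eq_of_units
    intro t
    rw [← h t, Polynomial.eval_mul, Polynomial.eval_pow, Polynomial.eval_X, Polynomial.eval_C,
      ← zpow_natCast, Int.toNat_of_nonneg (by omega), mul_comm]
  rw [h1]
  simp
  right; omega

lemma zpow_poly_eval {c : k} {d : ℤ} (hd : d < 0 → c = 0) (t : kˣ) :
    (Polynomial.C c * Polynomial.X ^ d.toNat).eval (t : k) = (t : k) ^ d * c := by
  by_cases h : d < 0
  · rw [hd h]; simp
  · rw [Polynomial.eval_mul, Polynomial.eval_pow, Polynomial.eval_X, Polynomial.eval_C,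
      ← zpow_natCast, Int.toNat_of_nonneg (by omega), mul_comm]

lemma alg_aeval {τ A : Type} [CommRing A] [Algebra k A] (φ : A →ₐ[k] k) (f : τ → A) (y : τ → k)
    (h : ∀ s, φ (f s) = y s) (p : MvPolynomial τ k) : φ (aeval f p) = eval y p := by
  rw [← AlgHom.comp_apply, comp_aeval, ← MvPolynomial.coe_aeval_eq_eval]
  have : (fun i => φ (f i)) = y := funext h
  rw [this]
  rfl

/-- `t^d` as a polynomial in `t, t⁻¹` -/
noncomputable def zpB (d : ℤ) : MvPolynomial Bool k :=
  if 0 ≤ d then MvPolynomial.X true ^ d.toNat else MvPolynomial.X false ^ (-d).toNat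

lemma zpB_eval (d : ℤ) (t : kˣ) :
    MvPolynomial.eval (fun b => if b then (t : k) else ((t⁻¹ : kˣ) : k)) (zpB d) = (t : k) ^ d := by
  unfold zpB
  split_ifs with h
  · simp [← zpow_natCast, Int.toNat_of_nonneg h]
  · simp [← zpow_natCast, Int.toNat_of_nonneg (show 0 ≤ -d by omega)]

section
variable {J : Type} [Fintype J] [DecidableEq J] {Γ : Set (Matrix J J k)} (l : PS Γ)

lemma PS.at_one : l.at' 1 = 1 := by
  apply l.hat_inj
  rw [l.hat_at, l.hat_one]
  simp

lemma PS.at_mul (s t : k) : l.at' (s * t) = l.at' s * l.at' t := by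
  apply l.hat_inj
  rw [l.hat_mul, l.hat_at, l.hat_at, l.hat_at, Matrix.diagonal_mul_diagonal]
  simp only [mul_zpow]

lemma PS.conj_hat {t : k} (ht : t ≠ 0) (A : Matrix J J k) (i j : J) :
    l.hat (l.at' t * A * l.at' t⁻¹) i j = t ^ (l.d i - l.d j) * l.hat A i j := by
  rw [l.hat_mul, l.hat_mul, l.hat_at, l.hat_at, Matrix.mul_diagonal, Matrix.diagonal_mul, zpow_sub₀ ht, inv_zpow]
  rw [div_eq_mul_inv]; ring

lemma PS.vhat_at (t : k) (v : J → k) (i : J) :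
    l.vhat ((l.at' t).mulVec v) i = t ^ l.d i * l.vhat v i := by
  rw [l.vhat_mulVec, l.hat_at, Matrix.mulVec_diagonal]
end

namespace LinRep
variable {G : AlgGroup k} {m : ℕ} {Y : GVariety G m} {J : Type} [Fintype J] [DecidableEq J] (L : LinRep G Y J)

/-- correspondence of one-parameter subgroups -/
def Rel (lam : OnePS G) (l : PS L.Γ) : Prop := ∀ t : kˣ, L.σ (lam.toFun t) = l.at' (t : k)

theorem exists_ps [CharZero k] (lam : OnePS G) : ∃ l : PS L.Γ, L.Rel lam l := by
  obtain ⟨p, hp⟩ := lam.regular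
  let q : Fin G.n × Fin G.n → LaurentPolynomial k := fun ij =>
    aeval (fun b => if b then LaurentPolynomial.T 1 else LaurentPolynomial.T (-1)) (p ij)
  let q' : Matrix (Fin G.n) (Fin G.n) (LaurentPolynomial k) := Matrix.of fun i j =>
    aeval (fun b => if b then LaurentPolynomial.T (-1) else LaurentPolynomial.T 1) (p (i, j))
  let M : Matrix J J (LaurentPolynomial k) := Matrix.of fun i j =>
    aeval (Sum.elim q (fun _ => q'.det)) (L.P i j)
  have hq : ∀ (t : kˣ) ij, lev t (q ij) = (lam.toFun t : Matrix (Fin G.n) (Fin G.n) k) ij.1 ij.2 := by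
    intro t ij
    rw [hp t ij]
    simp only [q]
    apply alg_aeval
    intro b
    cases b <;> simp [lev_T]
  have hq' : ∀ (t : kˣ), q'.map (lev t) = (((lam.toFun t)⁻¹ : GL (Fin G.n) k) : Matrix (Fin G.n) (Fin G.n) k) := by
    intro t
    ext i j
    rw [← map_inv]
    refine Eq.trans ?_ (hp t⁻¹ (i, j)).symm
    rw [Matrix.map_apply]
    simp only [q', Matrix.of_apply]
    apply alg_aeval
    intro b
    cases b <;> simp [lev_T]
  have hM : ∀ t : kˣ, M.map (lev t) = L.σ (lam.toFun t) := by
    intro t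
    ext i j
    rw [L.reg _ (lam.mem t), Matrix.map_apply]
    simp only [M, Matrix.of_apply]
    apply alg_aeval
    intro b
    rcases b with ij | u
    · exact hq t ij
    · change lev t q'.det = (((lam.toFun t)⁻¹ : GL (Fin G.n) k) : Matrix (Fin G.n) (Fin G.n) k).det
      rw [← hq' t]
      exact AlgHom.map_det (lev t) q'
  obtain ⟨l, hl⟩ := PS_of_laurent L.isSL M (fun t => by rw [hM]; exact L.σ_mem (lam.mem t))
    (by rw [hM, _root_.map_one, L.map_one])
    (fun s t => by rw [hM, hM, hM, _root_.map_mul, L.map_mul _ (lam.mem s) _ (lam.mem t)])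
  exact ⟨l, fun t => by rw [← hl, hM]⟩

theorem exists_onePS [CharZero k] (l : PS L.Γ) : ∃ lam : OnePS G, L.Rel lam l := by
  have h : ∀ t : kˣ, ∃ g ∈ G.toSubgroup, L.σ g = l.at' (t : k) := fun t => l.at_mem L.isSL t.ne_zero
  choose g hg hσ using h
  refine ⟨⟨⟨⟨g, ?_⟩, ?_⟩, hg, ?_⟩, hσ⟩
  · apply L.σ_inj (hg 1) G.toSubgroup.one_mem
    rw [hσ, L.map_one, Units.val_one, l.at_one]
  · intro s t
    apply L.σ_inj (hg _) (G.toSubgroup.mul_mem (hg s) (hg t))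
    rw [hσ, L.map_mul _ (hg s) _ (hg t), hσ, hσ, Units.val_mul, l.at_mul]
  · refine ⟨fun ab => ∑ i, C (l.c' (L.e1 ab.1) i * l.c i (L.e1 ab.2)) * zpB (l.d i), ?_⟩
    rintro t ⟨a, b⟩
    change (g t : Matrix (Fin G.n) (Fin G.n) k) a b = _
    rw [← L.he1 _ (hg t), hσ, PS.at', Matrix.mul_apply, _root_.map_sum]
    apply Finset.sum_congr rfl
    intro i _
    rw [Matrix.mul_diagonal, _root_.map_mul, zpB_eval, eval_C]
    ring

variable {L} {lam : OnePS G} {l : PS L.Γ}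

theorem inLambda_iff [CharZero k] (hr : L.Rel lam l) {x : Fin m → k} (hx : x ∈ Y.carrier) :
    InLambda Y x lam ↔ l.Lam (L.w x) := by
  constructor
  · rintro ⟨y, hy, q, hq, -⟩ i hi
    let Q : Polynomial k := ∑ j, Polynomial.C (l.c i j) * aeval q (L.wp j)
    apply zpow_poly_zero (q := Q) hi
    intro t
    rw [← l.vhat_at, ← hr t, ← L.w_act (lam.mem t) hx]
    change ∑ j, l.c i j * L.w (Y.act (lam.toFun t) x) j = _
    rw [Polynomial.eval_finset_sum]
    apply Finset.sum_congr rfl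
    intro j _
    rw [Polynomial.eval_mul, Polynomial.eval_C]
    congr 1
    have : Y.act (lam.toFun t) x = fun i => (q i).eval (t : k) := funext (hq t)
    rw [this, w, ← Polynomial.coe_aeval_eq_eval, ← AlgHom.comp_apply, comp_aeval, ← MvPolynomial.coe_aeval_eq_eval]
    rfl
  · intro hl
    let r : J → Polynomial k := fun a => Polynomial.C (l.vhat (L.w x) a) * Polynomial.X ^ (l.d a).toNat
    let q : Fin m → Polynomial k := fun i => ∑ a, Polynomial.C ((L.lc * l.c') i a) * r a
    have hq : ∀ (t : kˣ) (i : Fin m), Y.act (lam.toFun t) x i = (q i).eval (t : k) := by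
      intro t i
      rw [← L.lc_w (Y.act_mem _ (lam.mem t) x hx), L.w_act (lam.mem t) hx, hr t,
        ← l.unvhat ((l.at' (t : k)).mulVec (L.w x)), Matrix.mulVec_mulVec]
      simp only [q]
      rw [Polynomial.eval_finset_sum]
      change ∑ a, _ = _
      apply Finset.sum_congr rfl
      intro a _
      rw [Polynomial.eval_mul, Polynomial.eval_C, zpow_poly_eval (hl a), l.vhat_at]
    refine ⟨fun i => (q i).eval 0, ?_, q, hq, fun i => rfl⟩
    obtain ⟨I, hI⟩ := Y.closed
    rw [hI]
    intro f hf
    have key : ∀ t : k, eval (fun i => (q i).eval t) f = (aeval q f).eval t := by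
      intro t
      rw [← Polynomial.coe_aeval_eq_eval, ← AlgHom.comp_apply, comp_aeval, ← MvPolynomial.coe_aeval_eq_eval]
      rfl
    have h0 : aeval q f = 0 := by
      apply poly_eq_of_units
      intro t
      rw [← key, Polynomial.eval_zero]
      have h1 := Y.act_mem _ (lam.mem t) x hx
      rw [hI] at h1
      rw [← h1 f hf]
      congr 2
      funext i
      exact (hq t i).symm
    rw [key, h0, Polynomial.eval_zero]

lemma σ_conj (hr : L.Rel lam l) {g : GL (Fin G.n) k} (hg : g ∈ G.toSubgroup) (t : kˣ) :
    L.σ (lam.toFun t * g * (lam.toFun t)⁻¹) = l.at' (t : k) * L.σ g * l.at' (t : k)⁻¹ := by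
  rw [L.map_mul _ (G.toSubgroup.mul_mem (lam.mem t) hg) _ (G.toSubgroup.inv_mem (lam.mem t)),
    L.map_mul _ (lam.mem t) _ hg, ← map_inv, hr t, hr t⁻¹, Units.val_inv_eq_inv_val]

lemma conj_mem (lam : OnePS G) {g : GL (Fin G.n) k} (hg : g ∈ G.toSubgroup) (t : kˣ) :
    lam.toFun t * g * (lam.toFun t)⁻¹ ∈ G.toSubgroup :=
  G.toSubgroup.mul_mem (G.toSubgroup.mul_mem (lam.mem t) hg) (G.toSubgroup.inv_mem (lam.mem t))

/-- polynomials describing the conjugation curve in the eigenbasis -/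
lemma glimit_poly (hr : L.Rel lam l) {g : GL (Fin G.n) k} (hg : g ∈ G.toSubgroup)
    {q : Fin G.n × Fin G.n → Polynomial k}
    (hq : ∀ (t : kˣ) (ij : Fin G.n × Fin G.n),
      ((lam.toFun t * g * (lam.toFun t)⁻¹ : GL (Fin G.n) k) :
          Matrix (Fin G.n) (Fin G.n) k) ij.1 ij.2 = (q ij).eval (t : k)) :
    ∃ R : J → J → Polynomial k, (∀ (t : kˣ) i j, (t : k) ^ (l.d i - l.d j) * l.hat (L.σ g) i j = (R i j).eval (t : k)) ∧
      ((∀ ij : Fin G.n × Fin G.n, (g : Matrix (Fin G.n) (Fin G.n) k) ij.1 ij.2 = (q ij).eval 0) →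
        ∀ i j, l.hat (L.σ g) i j = (R i j).eval 0) := by
  let δ : k := ((g⁻¹ : GL (Fin G.n) k) : Matrix (Fin G.n) (Fin G.n) k).det
  let Q : Matrix J J (Polynomial k) := Matrix.of fun i j => aeval (Sum.elim q (fun _ => Polynomial.C δ)) (L.P i j)
  let R : Matrix J J (Polynomial k) := l.c.map Polynomial.C * Q * l.c'.map Polynomial.C
  have hQ : ∀ (t : k) i j, (Q i j).eval t = eval (Sum.elim (fun ij => (q ij).eval t) (fun _ => δ)) (L.P i j) := by
    intro t i j
    simp only [Q, Matrix.of_apply]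
    rw [← Polynomial.coe_aeval_eq_eval]
    apply alg_aeval
    intro b
    rcases b with b | b <;> simp [Polynomial.coe_aeval_eq_eval]
  have hR : ∀ (t : k) i j, (R i j).eval t = l.hat (Q.map (Polynomial.eval t)) i j := by
    intro t i j
    have : R.map (Polynomial.evalRingHom t) = l.hat (Q.map (Polynomial.eval t)) := by
      simp only [R]
      rw [Matrix.map_mul, Matrix.map_mul, PS.hat]
      have h1 : ∀ A : Matrix J J k, (A.map Polynomial.C).map (Polynomial.evalRingHom t) = A := by
        intro A; ext; simp
      rw [h1, h1]
      rfl
    rw [← this]; rfl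
  refine ⟨R, ?_, ?_⟩
  · intro t i j
    rw [hR, ← l.conj_hat t.ne_zero, ← σ_conj hr hg]
    congr 1
    congr 1
    ext a b
    rw [L.reg _ (conj_mem lam hg t)]
    change _ = (Q a b).eval _
    rw [hQ]
    congr 2
    funext s
    rcases s with ij | u
    · exact hq t ij
    · change Matrix.det (((lam.toFun t * g * (lam.toFun t)⁻¹)⁻¹ : GL (Fin G.n) k) : Matrix (Fin G.n) (Fin G.n) k) = δ
      simp only [mul_inv_rev, inv_inv, Units.val_mul, Matrix.det_mul, δ]
      have : Matrix.det (lam.toFun t : Matrix (Fin G.n) (Fin G.n) k) *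
        Matrix.det (((lam.toFun t)⁻¹ : GL (Fin G.n) k) : Matrix (Fin G.n) (Fin G.n) k) = 1 := by
        rw [← Matrix.det_mul, ← Units.val_mul, mul_inv_cancel, Units.val_one, Matrix.det_one]
      linear_combination (Matrix.det ((g⁻¹ : GL (Fin G.n) k) : Matrix (Fin G.n) (Fin G.n) k)) * this
  · intro h0 i j
    rw [hR]
    congr 1
    congr 1
    ext a b
    rw [L.reg _ hg]
    change _ = (Q a b).eval _
    rw [hQ]
    congr 2
    funext s
    rcases s with ij | u
    · exact h0 ij
    · rfl

theorem mem_Pset_iff [CharZero k] (hr : L.Rel lam l) {g : GL (Fin G.n) k} (hg : g ∈ G.toSubgroup) :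
    g ∈ Pset lam ↔ l.InP (L.σ g) := by
  constructor
  · rintro ⟨-, h, hh, q, hq, -⟩ i j hij
    obtain ⟨R, hR, -⟩ := glimit_poly hr hg hq
    exact zpow_poly_zero (show l.d i - l.d j < 0 by omega) (fun t => hR t i j)
  · intro hP
    refine ⟨hg, ?_⟩
    let R : Matrix J J (Polynomial k) := Matrix.of fun i j =>
      Polynomial.C (l.hat (L.σ g) i j) * Polynomial.X ^ (l.d i - l.d j).toNat
    let Q : Matrix J J (Polynomial k) := l.c'.map Polynomial.C * R * l.c.map Polynomial.C
    have hQ : ∀ t : kˣ, Q.map (Polynomial.evalRingHom (t : k)) = L.σ (lam.toFun t * g * (lam.toFun t)⁻¹) := by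
      intro t
      rw [← l.unhat (L.σ (lam.toFun t * g * (lam.toFun t)⁻¹))]
      simp only [Q]
      rw [Matrix.map_mul, Matrix.map_mul]
      have h1 : ∀ A : Matrix J J k, (A.map Polynomial.C).map (Polynomial.evalRingHom (t : k)) = A := by
        intro A; ext; simp
      rw [h1, h1]
      congr 2
      ext i j
      rw [σ_conj hr hg, l.conj_hat t.ne_zero]
      exact zpow_poly_eval (fun h => hP i j (by omega)) t
    have h0 : Q.map (Polynomial.aeval (0 : k)) ∈ L.Γ := by
      apply L.isSL.closed
      intro f hf
      rw [evM_map (Polynomial.aeval (0 : k)) Q f]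
      have : evM Q f = 0 := by
        apply poly_eq_of_units
        intro t
        have h2 := evM_map (Polynomial.aeval (t : k)) Q f
        rw [Polynomial.eval_zero, ← Polynomial.coe_aeval_eq_eval, ← h2]
        apply hf
        refine ⟨_, conj_mem lam hg t, ?_⟩
        rw [← hQ]
        ext i j
        simp [Polynomial.coe_aeval_eq_eval]
      rw [this, _root_.map_zero]
    obtain ⟨h, hh, hσ⟩ := h0
    refine ⟨h, hh, fun ij => Q (L.e1 ij.1) (L.e1 ij.2), ?_, ?_⟩
    · intro t ij
      rw [← L.he1 _ (conj_mem lam hg t), ← hQ]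
      rfl
    · intro ij
      rw [← L.he1 _ hh, hσ]
      simp [Polynomial.coe_aeval_eq_eval]

theorem mem_Lset_iff [CharZero k] (hr : L.Rel lam l) {g : GL (Fin G.n) k} (hg : g ∈ G.toSubgroup) :
    g ∈ Lset lam ↔ l.InL (L.σ g) := by
  constructor
  · rintro ⟨-, hh, q, hq, hq0⟩ i j hij
    obtain ⟨R, hR, hR0⟩ := glimit_poly hr hg hq
    rcases lt_or_gt_of_ne hij with h | h
    · exact zpow_poly_zero (show l.d i - l.d j < 0 by omega) (fun t => hR t i j)
    · rw [hR0 hq0]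
      exact zpow_poly_pos (show 0 < l.d i - l.d j by omega) (fun t => hR t i j)
  · intro hL
    refine ⟨hg, hg, fun ij => Polynomial.C ((g : Matrix (Fin G.n) (Fin G.n) k) ij.1 ij.2), ?_, ?_⟩
    · intro t ij
      have : lam.toFun t * g * (lam.toFun t)⁻¹ = g := by
        apply L.σ_inj (conj_mem lam hg t) hg
        rw [σ_conj hr hg]
        apply l.hat_inj
        ext i j
        rw [l.conj_hat t.ne_zero]
        by_cases h : l.d i = l.d j
        · rw [h, sub_self, zpow_zero, one_mul]
        · rw [hL i j h, mul_zero]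
      rw [this, Polynomial.eval_C]
    · intro ij
      rw [Polynomial.eval_C]

variable (L)

theorem mem_Hx_iff [CharZero k] {x : Fin m → k} (hx : x ∈ Y.carrier) {g : GL (Fin G.n) k} (hg : g ∈ G.toSubgroup) :
    g ∈ Hx Y x ↔ L.σ g ∈ Hs L.Γ (L.w x) := by
  constructor
  · rintro ⟨-, h⟩
    refine ⟨L.σ_mem hg, fun l hl => ?_⟩
    obtain ⟨lam, hr⟩ := L.exists_onePS l
    exact (mem_Pset_iff hr hg).1 (h lam ((inLambda_iff hr hx).2 hl))
  · rintro ⟨-, h⟩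
    refine ⟨hg, fun lam hl => ?_⟩
    obtain ⟨l, hr⟩ := L.exists_ps lam
    exact (mem_Pset_iff hr hg).2 (h l ((inLambda_iff hr hx).1 hl))

theorem Hx_sub_iff [CharZero k] {x : Fin m → k} (hx : x ∈ Y.carrier) {lam : OnePS G} {l : PS L.Γ} (hr : L.Rel lam l) :
    Hx Y x ⊆ Pset lam ↔ ∀ A ∈ Hs L.Γ (L.w x), l.InP A := by
  constructor
  · rintro h A hA
    obtain ⟨g, hg, rfl⟩ := hA.1
    exact (mem_Pset_iff hr hg).1 (h ((L.mem_Hx_iff hx hg).2 hA))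
  · intro h g hgx
    have hg := hgx.1
    exact (mem_Pset_iff hr hg).2 (h _ ((L.mem_Hx_iff hx hg).1 hgx))

theorem properAt [CharZero k] (hE : EtaProper Y) {x : Fin m → k} (hx : x ∈ Y.carrier) : ProperAt L.Γ (L.w x) := by
  intro l hl
  obtain ⟨lam, hr⟩ := L.exists_onePS l
  exact (inLambda_iff hr hx).1 (hE x hx lam ((L.Hx_sub_iff hx hr).2 hl))

theorem cr_iff [CharZero k] {x : Fin m → k} (hx : x ∈ Y.carrier) :
    CompletelyReducible G (Hx Y x) ↔ CRat L.Γ (L.w x) := by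
  constructor
  · intro h l hl
    obtain ⟨lam, hr⟩ := L.exists_onePS l
    obtain ⟨M, ⟨mu, hP, rfl⟩, hsub⟩ := h lam ((L.Hx_sub_iff hx hr).2 hl)
    obtain ⟨mm, hmm⟩ := L.exists_ps mu
    refine ⟨mm, ?_, ?_⟩
    · rintro _ ⟨g, hg, rfl⟩
      rw [← mem_Pset_iff hmm hg, ← mem_Pset_iff hr hg, hP]
    · intro A hA
      obtain ⟨g, hg, rfl⟩ := hA.1
      exact (mem_Lset_iff hmm hg).1 (hsub ((L.mem_Hx_iff hx hg).2 hA))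
  · intro h lam hsub
    obtain ⟨l, hr⟩ := L.exists_ps lam
    obtain ⟨mm, h1, h2⟩ := h l ((L.Hx_sub_iff hx hr).1 hsub)
    obtain ⟨mu, hmm⟩ := L.exists_onePS mm
    refine ⟨Lset mu, ⟨mu, ?_, rfl⟩, ?_⟩
    · ext g
      constructor
      · intro hg
        exact (mem_Pset_iff hr hg.1).2 ((h1 _ (L.σ_mem hg.1)).1 ((mem_Pset_iff hmm hg.1).1 hg))
      · intro hg
        exact (mem_Pset_iff hmm hg.1).2 ((h1 _ (L.σ_mem hg.1)).2 ((mem_Pset_iff hr hg.1).1 hg))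
    · intro g hgx
      exact (mem_Lset_iff hmm hgx.1).2 (h2 _ ((L.mem_Hx_iff hx hgx.1).1 hgx))

theorem polystable_iff {x : Fin m → k} (hx : x ∈ Y.carrier) :
    Polystable Y x ↔ OrbClosed L.Γ (L.w x) := by
  constructor
  · rintro ⟨I, hI⟩ y hy
    have h1 : L.lc.mulVec y ∈ orbitSet Y x := by
      rw [hI]
      intro f hf
      let f' : MvPolynomial J k := aeval (fun i => ∑ j, C (L.lc i j) * MvPolynomial.X j) f
      have hf' : ∀ z : J → k, eval z f' = eval (L.lc.mulVec z) f := by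
        intro z
        simp only [f']
        rw [← MvPolynomial.coe_aeval_eq_eval, ← MvPolynomial.coe_aeval_eq_eval]
        change aeval z (aeval _ f) = aeval _ f
        rw [← AlgHom.comp_apply, comp_aeval]
        congr 2
        funext i
        rw [_root_.map_sum]
        change _ = ∑ j, L.lc i j * z j
        apply Finset.sum_congr rfl
        intro j _
        simp
      rw [← hf']
      apply hy
      rintro _ ⟨g, hg, rfl⟩
      rw [hf', ← L.w_act hg hx, L.lc_w (Y.act_mem g hg x hx)]
      have : Y.act g x ∈ orbitSet Y x := ⟨g, hg, rfl⟩
      rw [hI] at this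
      exact this f hf
    obtain ⟨g, hg, hgx⟩ := h1
    refine ⟨L.σ g, L.σ_mem hg, ?_⟩
    rw [← L.w_act hg hx, ← hgx]
    funext j
    let f' : MvPolynomial J k := MvPolynomial.X j - aeval (fun i => ∑ j, C (L.lc i j) * MvPolynomial.X j) (L.wp j)
    have hf' : ∀ z : J → k, eval z f' = z j - eval (L.lc.mulVec z) (L.wp j) := by
      intro z
      simp only [f']
      rw [_root_.map_sub, eval_X, ← MvPolynomial.coe_aeval_eq_eval, ← MvPolynomial.coe_aeval_eq_eval]
      change z j - aeval z (aeval _ (L.wp j)) = z j - aeval _ (L.wp j)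
      rw [← AlgHom.comp_apply, comp_aeval]
      congr 3
      funext i
      rw [_root_.map_sum]
      change _ = ∑ j, L.lc i j * z j
      apply Finset.sum_congr rfl
      intro j _
      simp
    have h2 := hy f' (by
      rintro _ ⟨g, hg, rfl⟩
      rw [hf', ← L.w_act hg hx, L.lc_w (Y.act_mem g hg x hx)]
      exact sub_self _)
    rw [hf'] at h2
    exact sub_eq_zero.1 h2
  · intro h
    refine ⟨{f | ∀ y ∈ orbitSet Y x, eval y f = 0}, ?_⟩
    apply Set.Subset.antisymm
    · intro y hy f hf
      exact hf y hy
    · intro y hy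
      have hyc : y ∈ Y.carrier := by
        obtain ⟨I, hI⟩ := Y.closed
        rw [hI]
        intro f hf
        apply hy
        rintro _ ⟨g, hg, rfl⟩
        have := Y.act_mem g hg x hx
        rw [hI] at this
        exact this f hf
      obtain ⟨_, ⟨g, hg, rfl⟩, hgy⟩ := h (L.w y) (by
        intro f hf
        have hc : ∀ z, eval z (aeval L.wp f) = eval (L.w z) f := by
          intro z
          rw [← MvPolynomial.coe_aeval_eq_eval, ← MvPolynomial.coe_aeval_eq_eval]
          change aeval z (aeval _ f) = aeval _ f
          rw [← AlgHom.comp_apply, comp_aeval]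
          rfl
        rw [← hc]
        apply hy
        rintro _ ⟨g, hg, rfl⟩
        rw [hc, L.w_act hg hx]
        exact hf _ (L.σ_mem hg))
      refine ⟨g, hg, ?_⟩
      rw [← L.w_act hg hx] at hgy
      rw [← L.lc_w hyc, hgy, L.lc_w (Y.act_mem g hg x hx)]

end LinRep
end F23
end PaperGIT

namespace PaperGIT
section F24
set_option linter.unusedSectionVars false
set_option linter.unusedVariables false
open MvPolynomial
variable {k : Type} [Field k]

lemma nilp_pow_card {ι : Type} [Fintype ι] [DecidableEq ι] {A : Matrix ι ι k} (h : IsNilpotent A) :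
    A ^ Fintype.card ι = 0 := by
  have h1 := (Matrix.isNilpotent_charpoly_sub_pow_of_isNilpotent h).eq_zero
  have h2 := Matrix.aeval_self_charpoly A
  rw [sub_eq_zero.1 h1] at h2
  simpa using h2

section
variable {J : Type} [Fintype J] [DecidableEq J]

/-- exponential of nilpotent matrices -/
noncomputable def ex (ξ : Matrix J J k) : Matrix J J k := expN (Fintype.card J + 2) ξ

lemma nilp_pow_card2 {ξ : Matrix J J k} (h : IsNilpotent ξ) : ξ ^ (Fintype.card J + 2) = 0 :=
  pow_eq_zero_of_le (by omega) (nilp_pow_card h)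

lemma ex_eq [CharZero k] {ξ : Matrix J J k} (h : IsNilpotent ξ) : ex ξ = IsNilpotent.exp ξ := by
  rw [IsNilpotent.exp_eq_sum (nilp_pow_card2 h), ex, expN]
  apply Finset.sum_congr rfl
  intro i _
  ext a b
  rw [Matrix.smul_apply, Matrix.smul_apply, Rat.smul_def, smul_eq_mul]
  push_cast
  rfl

lemma ex_add [CharZero k] {ξ η : Matrix J J k} (hc : ξ * η = η * ξ) (h : IsNilpotent ξ) (h' : IsNilpotent η) :
    ex (ξ + η) = ex ξ * ex η := by
  rw [ex_eq h, ex_eq h', ex_eq (Commute.isNilpotent_add hc h h'), IsNilpotent.exp_add_of_commute hc h h']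

lemma ex_zero : ex (0 : Matrix J J k) = 1 := by
  rw [ex, expN, Finset.sum_range_succ']
  simp

lemma ex_conj {g g' : Matrix J J k} (h : g * g' = 1) (ξ : Matrix J J k) : g * ex ξ * g' = ex (g * ξ * g') := by
  have h' : g' * g = 1 := mul_eq_one_comm.1 h
  have hp : ∀ i : ℕ, (g * ξ * g') ^ i = g * ξ ^ i * g' := by
    intro i
    induction i with
    | zero => simp [h]
    | succ i ih =>
      rw [pow_succ, ih, pow_succ, show g * ξ ^ i * g' * (g * ξ * g') = g * ξ ^ i * (g' * g) * ξ * g' by noncomm_ring, h']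
      noncomm_ring
  simp only [ex, expN, hp, Finset.mul_sum, Finset.sum_mul, Matrix.mul_smul, Matrix.smul_mul]

lemma ex_sub_one_nilp {ξ : Matrix J J k} (h : IsNilpotent ξ) : IsNilpotent (ex ξ - 1) := by
  have h1 : ex ξ - 1 = (∑ i ∈ Finset.range (Fintype.card J + 1), (((i + 1).factorial : k)⁻¹) • ξ ^ i) * ξ := by
    rw [ex, expN, Finset.sum_range_succ', Finset.sum_mul]
    simp [pow_succ]
  rw [h1]
  apply Commute.isNilpotent_mul_left _ h
  apply Commute.sum_left
  intro i _
  apply Commute.smul_left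
  exact (Commute.refl ξ).pow_left i

lemma ex_one_imp [CharZero k] {ξ : Matrix J J k} (h : ∀ s : k, ex (s • ξ) = 1) : ξ = 0 := by
  ext i j
  have h1 : expP (Fintype.card J + 2) ξ i j = Polynomial.C ((1 : Matrix J J k) i j) := by
    apply poly_eq_of_units
    intro t
    have h2 := expP_eval (Fintype.card J + 2) ξ (t : k)
    have h3 := h (t : k)
    rw [ex, ← h2] at h3
    rw [Polynomial.eval_C, ← h3]
    rfl
  have h2 := congrArg (fun p => Polynomial.coeff p 1) h1
  simp only [expP, Matrix.sum_apply, Matrix.smul_apply, Matrix.map_apply, smul_eq_mul, Polynomial.finset_sum_coeff,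
    Polynomial.coeff_C] at h2
  rw [Finset.sum_eq_single 1] at h2
  · simpa using h2
  · intro b _ hb
    rw [Polynomial.coeff_mul_C, Polynomial.coeff_C_mul, Polynomial.coeff_X_pow, if_neg (Ne.symm hb)]
    simp
  · intro h; exact absurd (Finset.mem_range.2 (by omega)) h
end

namespace LinRep
variable {G : AlgGroup k} {m : ℕ} {Y : GVariety G m} {J : Type} [Fintype J] [DecidableEq J] (L : LinRep G Y J)

lemma unip_of {g : GL (Fin G.n) k} (hg : g ∈ G.toSubgroup) (h : IsNilpotent (L.σ g - 1)) : IsUnipotentEl g := by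
  let E : Matrix (Fin G.n) J k := Matrix.of fun a q => if q = L.e1 a then 1 else 0
  have h1 : E * L.σ g = (g : Matrix (Fin G.n) (Fin G.n) k) * E := by
    ext a q
    rw [Matrix.mul_apply, Matrix.mul_apply]
    have e1 : ∑ j, E a j * L.σ g j q = L.σ g (L.e1 a) q := by
      rw [Finset.sum_eq_single (L.e1 a)]
      · simp [E]
      · intro b _ hb; simp [E, hb]
      · intro h; exact absurd (Finset.mem_univ _) h
    rw [e1]
    by_cases hq : ∃ b, q = L.e1 b
    · obtain ⟨b, rfl⟩ := hq
      rw [L.he1 g hg, Finset.sum_eq_single b]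
      · simp [E]
      · intro c _ hc
        have : L.e1 b ≠ L.e1 c := fun h => hc (L.e1_inj h).symm
        simp [E, this]
      · intro h; exact absurd (Finset.mem_univ _) h
    · push Not at hq
      rw [L.he1' g hg a q hq]
      symm
      apply Finset.sum_eq_zero
      intro b _
      simp [E, hq b]
  have h2 : ∀ r : ℕ, E * (L.σ g - 1) ^ r = ((g : Matrix (Fin G.n) (Fin G.n) k) - 1) ^ r * E := by
    intro r
    induction r with
    | zero => simp
    | succ r ih =>
      rw [pow_succ, ← Matrix.mul_assoc, ih, Matrix.mul_assoc, Matrix.mul_sub, h1, Matrix.mul_one, pow_succ,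
        Matrix.mul_assoc, Matrix.sub_mul, Matrix.one_mul]
  have h3 : E * E.transpose = 1 := by
    ext a b
    rw [Matrix.mul_apply, Finset.sum_eq_single (L.e1 a)]
    · by_cases hab : a = b
      · subst hab; simp [E]
      · have : L.e1 a ≠ L.e1 b := fun h => hab (L.e1_inj h)
        simp [E, this, hab]
    · intro c _ hc; simp [E, hc]
    · intro h; exact absurd (Finset.mem_univ _) h
  obtain ⟨r, hr⟩ := h
  have h4 : IsNilpotent ((g : Matrix (Fin G.n) (Fin G.n) k) - 1) := by
    refine ⟨r, ?_⟩
    have := h2 r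
    rw [hr, Matrix.mul_zero] at this
    calc ((g : Matrix (Fin G.n) (Fin G.n) k) - 1) ^ r = ((g : Matrix (Fin G.n) (Fin G.n) k) - 1) ^ r * (E * E.transpose) := by
          rw [h3, Matrix.mul_one]
      _ = 0 := by rw [← Matrix.mul_assoc, ← this, Matrix.zero_mul]
  have h5 := nilp_pow_card h4
  rw [Fintype.card_fin] at h5
  exact h5

theorem noUnip [CharZero k] (hG : IsReductive G) : NoUnip L.Γ := by
  intro z hz hcomm hnil hnorm
  let H : Set (GL (Fin G.n) k) := {g | g ∈ G.toSubgroup ∧ ∃ ξ ∈ z, L.σ g = ex ξ}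
  have hex : ∀ ξ ∈ z, ∃ g ∈ H, L.σ g = ex ξ := by
    intro ξ hξ
    have h1 := expN_mem L.isSL (hz hξ) (nilp_pow_card2 (hnil ξ hξ)) 1
    rw [one_smul] at h1
    obtain ⟨g, hg, e⟩ := h1
    exact ⟨g, ⟨hg, ξ, hξ, e⟩, e⟩
  have h1H : (1 : GL (Fin G.n) k) ∈ H := ⟨G.toSubgroup.one_mem, 0, z.zero_mem, by rw [L.map_one, ex_zero]⟩
  have hmul : ∀ a ∈ H, ∀ b ∈ H, a * b ∈ H := by
    rintro a ⟨ha, ξ, hξ, ea⟩ b ⟨hb, η, hη, eb⟩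
    exact ⟨G.toSubgroup.mul_mem ha hb, ξ + η, z.add_mem hξ hη, by
      rw [L.map_mul a ha b hb, ea, eb, ex_add (hcomm ξ hξ η hη) (hnil ξ hξ) (hnil η hη)]⟩
  have hinv : ∀ a ∈ H, a⁻¹ ∈ H := by
    rintro a ⟨ha, ξ, hξ, ea⟩
    refine ⟨G.toSubgroup.inv_mem ha, -ξ, z.neg_mem hξ, ?_⟩
    have h1 := L.σ_inv ha
    have h2 : ex (-ξ) * ex ξ = 1 := by
      rw [← ex_add (by noncomm_ring) (hnil ξ hξ).neg (hnil ξ hξ), neg_add_cancel, ex_zero]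
    rw [ea] at h1
    calc L.σ a⁻¹ = (ex (-ξ) * ex ξ) * L.σ a⁻¹ := by rw [h2, one_mul]
      _ = _ := by rw [mul_assoc, h1, mul_one]
  have hidG : ∀ g ∈ idComponent G, g ∈ G.toSubgroup := by
    rintro g ⟨C, ⟨hC, -, -⟩, hg⟩
    exact hC hg
  have hconj : ∀ g ∈ idComponent G, ∀ h ∈ H, g * h * g⁻¹ ∈ H := by
    rintro g hg h ⟨hh, ξ, hξ, e⟩
    have hg := hidG g hg
    have h1 := L.σ_inv hg
    have h2 : (L.σ g)⁻¹ = L.σ g⁻¹ := Matrix.inv_eq_right_inv h1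
    refine ⟨G.toSubgroup.mul_mem (G.toSubgroup.mul_mem hg hh) (G.toSubgroup.inv_mem hg), L.σ g * ξ * L.σ g⁻¹, ?_, ?_⟩
    · rw [← h2]; exact hnorm _ (L.σ_mem hg) ξ hξ
    · rw [L.map_mul _ (G.toSubgroup.mul_mem hg hh) _ (G.toSubgroup.inv_mem hg), L.map_mul g hg h hh, e, ex_conj h1]
  have hconn0 : ∀ V W : Set (GL (Fin G.n) k), ClosedInGL V → ClosedInGL W →
      H ⊆ V ∪ W → H ∩ V ∩ W = ∅ → (1 : GL (Fin G.n) k) ∈ V → H ⊆ V := by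
    rintro V W ⟨I, hI⟩ ⟨I', hI'⟩ hVW hem h1V h hh
    by_contra hhV
    obtain ⟨hhG, ξ, hξ, e⟩ := id hh
    let q : Fin G.n × Fin G.n → Polynomial k := fun ab => expP (Fintype.card J + 2) ξ (L.e1 ab.1) (L.e1 ab.2)
    have hcur : ∀ s : k, ∀ g ∈ G.toSubgroup, L.σ g = ex (s • ξ) →
        ∀ f : MvPolynomial (Fin G.n × Fin G.n) k, eval (mat2pt (g : Matrix (Fin G.n) (Fin G.n) k)) f = (aeval q f).eval s := by
      intro s g hg hgs f
      rw [← Polynomial.coe_aeval_eq_eval]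
      symm
      apply alg_aeval
      rintro ⟨a, b⟩
      change Polynomial.aeval s (q (a, b)) = (g : Matrix (Fin G.n) (Fin G.n) k) a b
      rw [← L.he1 g hg, hgs, ex, ← expP_eval, Polynomial.coe_aeval_eq_eval]
      rfl
    have h0 : ∃ f ∈ I, eval (mat2pt (h : Matrix (Fin G.n) (Fin G.n) k)) f ≠ 0 := by
      by_contra hcon
      push Not at hcon
      apply hhV
      rw [hI]
      exact hcon
    obtain ⟨f, hf, hfh⟩ := h0
    rw [hcur 1 h hhG (by rw [one_smul, e])] at hfh
    have hF : aeval q f ≠ 0 := by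
      intro h0; rw [h0] at hfh; simp at hfh
    have h1W : (1 : GL (Fin G.n) k) ∈ W := by
      rw [hI']
      intro f' hf'
      rw [hcur 0 1 G.toSubgroup.one_mem (by rw [zero_smul, L.map_one, ex_zero])]
      have hprod : aeval q f * aeval q f' = 0 := by
        apply poly_eq_of_units
        intro t
        obtain ⟨g, hgH, hgs⟩ := hex ((t : k) • ξ) (z.smul_mem _ hξ)
        rw [Polynomial.eval_mul, Polynomial.eval_zero, ← hcur _ g hgH.1 hgs, ← hcur _ g hgH.1 hgs]
        rcases hVW hgH with hv | hw
        · rw [hI] at hv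
          rw [hv f hf, zero_mul]
        · rw [hI'] at hw
          rw [hw f' hf', mul_zero]
      rcases mul_eq_zero.1 hprod with h2 | h2
      · exact absurd h2 hF
      · rw [h2, Polynomial.eval_zero]
    have : (1 : GL (Fin G.n) k) ∈ H ∩ V ∩ W := ⟨⟨h1H, h1V⟩, h1W⟩
    rw [hem] at this
    exact this
  have hconn : IsConnSet H := by
    intro V W hV hW hVW hem
    rcases hVW h1H with h | h
    · left; exact hconn0 V W hV hW hVW hem h
    · right
      refine hconn0 W V hW hV (by rwa [Set.union_comm]) ?_ h
      rw [← hem, Set.inter_assoc, Set.inter_assoc, Set.inter_comm W V]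
  have hH := hG H (fun h hh => ⟨H, ⟨fun g hg => hg.1, h1H, hconn⟩, hh⟩) h1H hmul hinv hconj hconn (by
    rintro h ⟨hh, ξ, hξ, e⟩
    apply L.unip_of hh
    rw [e]
    exact ex_sub_one_nilp (hnil ξ hξ))
  rw [eq_bot_iff]
  intro ξ hξ
  rw [Submodule.mem_bot]
  apply ex_one_imp
  intro s
  obtain ⟨g, hg, e⟩ := hex (s • ξ) (z.smul_mem s hξ)
  rw [hH] at hg
  rw [Set.mem_singleton_iff] at hg
  rw [← e, hg, L.map_one]

end LinRep
end F24
end PaperGIT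

namespace PaperGIT
section F25
set_option linter.unusedSectionVars false
set_option linter.unusedVariables false
open MvPolynomial
variable {k : Type} [Field k]

lemma split_poly {A : Type} [Fintype A] {m : ℕ} (p : MvPolynomial (A ⊕ (Unit ⊕ Fin m)) k) :
    ∃ (D : Type) (_ : Fintype D) (a : D → MvPolynomial (A ⊕ Unit) k) (b : D → MvPolynomial (Fin m) k),
      ∀ (g : A → k) (u : Unit → k) (x : Fin m → k),
        eval (Sum.elim g (Sum.elim u x)) p = ∑ d, eval (Sum.elim g u) (a d) * eval x (b d) := by
  classical
  refine ⟨p.support, inferInstance, fun d => C (p.coeff d) * ((∏ s : A, MvPolynomial.X (Sum.inl s) ^ (d.1 (Sum.inl s))) *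
    ∏ s : Unit, MvPolynomial.X (Sum.inr s) ^ (d.1 (Sum.inr (Sum.inl s)))),
    fun d => ∏ i, MvPolynomial.X i ^ (d.1 (Sum.inr (Sum.inr i))), ?_⟩
  intro g u x
  rw [eval_eq', ← Finset.sum_coe_sort]
  apply Finset.sum_congr rfl
  intro d _
  rw [Fintype.prod_sum_type, Fintype.prod_sum_type]
  simp only [_root_.map_mul, eval_C, _root_.map_prod, _root_.map_pow, eval_X, Sum.elim_inl, Sum.elim_inr]
  ring

variable {G : AlgGroup k} {m : ℕ} (Y : GVariety G m)

lemma act_split (f : MvPolynomial (Fin m) k) :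
    ∃ (D : Type) (_ : Fintype D) (a : D → MvPolynomial ((Fin G.n × Fin G.n) ⊕ Unit) k) (b : D → MvPolynomial (Fin m) k),
      ∀ g ∈ G.toSubgroup, ∀ x ∈ Y.carrier,
        eval (Y.act g x) f = ∑ d, eval (gpt g) (a d) * eval x (b d) := by
  obtain ⟨p, hp⟩ := Y.regular
  obtain ⟨D, iD, a, b, h⟩ := split_poly (aeval p f)
  refine ⟨D, iD, a, b, ?_⟩
  intro g hg x hx
  refine Eq.trans ?_ (h _ _ _)
  symm
  refine alg_aeval (aeval (Sum.elim (mat2pt (g : Matrix (Fin G.n) (Fin G.n) k))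
            (Sum.elim
              (fun _ => ((g⁻¹ : GL (Fin G.n) k) : Matrix (Fin G.n) (Fin G.n) k).det)
              x))) p _ ?_ f
  intro i
  exact (hp g hg x hx i).symm

/-- restriction of polynomials to functions on the variety -/
noncomputable def resF : MvPolynomial (Fin m) k →ₗ[k] (Y.carrier → k) where
  toFun f := fun x => eval x.1 f
  map_add' f g := by funext x; simp
  map_smul' c f := by funext x; simp [smul_eval]

/-- translation of functions -/
def trF (g : G.toSubgroup) : (Y.carrier → k) →ₗ[k] (Y.carrier → k) where
  toFun f := fun x => f ⟨Y.act g.1 x.1, Y.act_mem g.1 g.2 x.1 x.2⟩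
  map_add' f g := rfl
  map_smul' c f := rfl

lemma trF_trF (g h : G.toSubgroup) (f : Y.carrier → k) : trF Y g (trF Y h f) = trF Y (h * g) f := by
  funext x
  change f _ = f _
  congr 1
  apply Subtype.ext
  exact (Y.act_mul h.1 h.2 g.1 g.2 x.1 x.2).symm

lemma trF_one (f : Y.carrier → k) : trF Y 1 f = f := by
  funext x
  change f _ = f _
  congr 1
  apply Subtype.ext
  exact Y.act_one x.1 x.2

/-- the invariant space of functions generated by the coordinates -/
def spW : Submodule k (Y.carrier → k) :=
  Submodule.span k {f | ∃ (g : G.toSubgroup) (i : Fin m), f = trF Y g (resF Y (MvPolynomial.X i))}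

lemma spW_inv (g : G.toSubgroup) {f : Y.carrier → k} (hf : f ∈ spW Y) : trF Y g f ∈ spW Y := by
  have : spW Y ≤ (spW Y).comap (trF Y g) := by
    refine Submodule.span_le.2 ?_
    rintro _ ⟨h, i, rfl⟩
    change trF Y g (trF Y h (resF Y (MvPolynomial.X i))) ∈ spW Y
    rw [trF_trF]
    exact Submodule.subset_span ⟨_, i, rfl⟩
  exact this hf

lemma trF_split (f : MvPolynomial (Fin m) k) :
    ∃ (D : Type) (_ : Fintype D) (a : D → MvPolynomial ((Fin G.n × Fin G.n) ⊕ Unit) k) (b : D → MvPolynomial (Fin m) k),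
      ∀ g : G.toSubgroup, trF Y g (resF Y f) = ∑ d, eval (gpt g.1) (a d) • resF Y (b d) := by
  obtain ⟨D, iD, a, b, h⟩ := act_split Y f
  refine ⟨D, iD, a, b, ?_⟩
  intro g
  funext x
  rw [Finset.sum_apply]
  exact h g.1 g.2 x.1 x.2

lemma spW_le : ∃ S : Set (Y.carrier → k), S.Finite ∧ spW Y ≤ Submodule.span k S ∧ S ⊆ LinearMap.range (resF Y) := by
  have h := fun i : Fin m => trF_split Y (MvPolynomial.X i)
  choose D iD a b h using h
  refine ⟨⋃ i, Set.range (fun d => resF Y (b i d)), Set.finite_iUnion fun i => Set.finite_range _, ?_, ?_⟩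
  · rw [spW, Submodule.span_le]
    rintro _ ⟨g, i, rfl⟩
    rw [h i g]
    apply Submodule.sum_mem
    intro d _
    apply Submodule.smul_mem
    apply Submodule.subset_span
    exact Set.mem_iUnion.2 ⟨i, d, rfl⟩
  · intro f hf
    obtain ⟨i, d, rfl⟩ := Set.mem_iUnion.1 hf
    exact ⟨_, rfl⟩

/-- linearization data -/
theorem exists_rho : ∃ (N : ℕ) (wp : Fin N → MvPolynomial (Fin m) k)
    (Rp : Matrix (Fin N) (Fin N) (MvPolynomial ((Fin G.n × Fin G.n) ⊕ Unit) k)) (lc : Matrix (Fin m) (Fin N) k),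
    (∀ g ∈ G.toSubgroup, ∀ x ∈ Y.carrier, (fun j => eval (Y.act g x) (wp j)) =
      (Rp.map (eval (gpt g))).mulVec (fun j => eval x (wp j))) ∧
    (∀ x ∈ Y.carrier, lc.mulVec (fun j => eval x (wp j)) = x) ∧
    (∀ c : Fin N → k, (∀ x ∈ Y.carrier, ∑ j, c j * eval x (wp j) = 0) → c = 0) := by
  obtain ⟨S, hS, hle, hSr⟩ := spW_le Y
  have hfin : FiniteDimensional k (Submodule.span k S) := FiniteDimensional.span_of_finite k hS
  have hfW : FiniteDimensional k (spW Y) := Submodule.finiteDimensional_of_le hle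
  let B := Module.finBasis k (spW Y)
  have hpoly : ∀ j, ∃ f, resF Y f = (B j : Y.carrier → k) := by
    intro j
    have h1 : (B j : Y.carrier → k) ∈ LinearMap.range (resF Y) :=
      (Submodule.span_le.2 hSr) (hle (B j).2)
    exact h1
  choose wp hwp using hpoly
  have hext : ∀ l, ∃ Φ : (Y.carrier → k) →ₗ[k] k, Φ ∘ₗ (spW Y).subtype = B.coord l := fun l =>
    LinearMap.exists_extend (B.coord l)
  choose Φ hΦ using hext
  have hs := fun j => trF_split Y (wp j)
  choose D iD a b hs using hs
  have hX : ∀ i : Fin m, resF Y (MvPolynomial.X i) ∈ spW Y := by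
    intro i
    apply Submodule.subset_span
    exact ⟨1, i, (trF_one Y _).symm⟩
  have hexp : ∀ f (hf : f ∈ spW Y), f = ∑ l, Φ l f • resF Y (wp l) := by
    intro f hf
    have h1 := congrArg Subtype.val (B.sum_repr ⟨f, hf⟩)
    rw [Submodule.coe_sum] at h1
    refine h1.symm.trans ?_
    apply Finset.sum_congr rfl
    intro l _
    rw [hwp, Submodule.coe_smul]
    congr 1
    have := LinearMap.congr_fun (hΦ l) ⟨f, hf⟩
    exact this.symm
  refine ⟨_, wp, Matrix.of fun j l => ∑ d, C (Φ l (resF Y (b j d))) * a j d, Matrix.of fun i l => Φ l (resF Y (MvPolynomial.X i)),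
    ?_, ?_, ?_⟩
  · intro g hg x hx
    funext j
    have hmem : trF Y ⟨g, hg⟩ (resF Y (wp j)) ∈ spW Y := by
      apply spW_inv
      rw [hwp]; exact (B j).2
    have h1 := congrFun (hexp _ hmem) ⟨x, hx⟩
    refine h1.trans ?_
    rw [Finset.sum_apply]
    change _ = ∑ l, eval (gpt g) (∑ d, C (Φ l (resF Y (b j d))) * a j d) * eval x (wp l)
    apply Finset.sum_congr rfl
    intro l _
    change Φ l (trF Y ⟨g, hg⟩ (resF Y (wp j))) * eval x (wp l) = eval (gpt g) (∑ d, C (Φ l (resF Y (b j d))) * a j d) * eval x (wp l)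
    congr 1
    rw [hs j ⟨g, hg⟩, _root_.map_sum, _root_.map_sum]
    apply Finset.sum_congr rfl
    intro d _
    rw [LinearMap.map_smul, _root_.map_mul, eval_C, smul_eq_mul, mul_comm]
  · intro x hx
    funext i
    have h1 := congrFun (hexp _ (hX i)) ⟨x, hx⟩
    rw [Finset.sum_apply] at h1
    have h2 : resF Y (MvPolynomial.X i) ⟨x, hx⟩ = x i := eval_X i
    rw [h2] at h1
    exact h1.symm
  · intro c hc
    have h1 : ∑ j, c j • B j = 0 := by
      apply Subtype.ext
      rw [Submodule.coe_sum]
      funext x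
      rw [Finset.sum_apply]
      refine Eq.trans ?_ (hc x.1 x.2)
      apply Finset.sum_congr rfl
      intro j _
      rw [Submodule.coe_smul, ← hwp]
      rfl
    funext j
    exact Fintype.linearIndependent_iff.1 B.linearIndependent c h1 j

/-- polynomials for inversion -/
noncomputable def invp (n : ℕ) : (Fin n × Fin n) ⊕ Unit → MvPolynomial ((Fin n × Fin n) ⊕ Unit) k :=
  Sum.elim (fun ab => MvPolynomial.X (Sum.inr ()) *
      (Matrix.adjugate (Matrix.of fun a b => MvPolynomial.X (Sum.inl (a, b)))) ab.1 ab.2)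
    (fun _ => Matrix.det (Matrix.of fun a b => MvPolynomial.X (Sum.inl (a, b))))

lemma invp_eval {n : ℕ} (g : GL (Fin n) k) (s) : eval (gpt g) (invp n s) = gpt g⁻¹ s := by
  have h0 : (Matrix.of fun a b => (MvPolynomial.X (Sum.inl (a, b)) : MvPolynomial ((Fin n × Fin n) ⊕ Unit) k)).map (eval (gpt g)) =
      (g : Matrix (Fin n) (Fin n) k) := by
    ext a b
    simp [gpt, mat2pt]
  rcases s with ⟨a, b⟩ | u
  · simp only [invp, Sum.elim_inl, _root_.map_mul, eval_X]
    have h1 := RingHom.map_adjugate (eval (gpt g)) (Matrix.of fun a b => (MvPolynomial.X (Sum.inl (a, b)) : MvPolynomial ((Fin n × Fin n) ⊕ Unit) k))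
    rw [RingHom.mapMatrix_apply, RingHom.mapMatrix_apply, h0] at h1
    have h2 := congrFun (congrFun h1 a) b
    rw [Matrix.map_apply] at h2
    rw [h2]
    change ((g⁻¹ : GL (Fin n) k) : Matrix (Fin n) (Fin n) k).det * _ = ((g⁻¹ : GL (Fin n) k) : Matrix (Fin n) (Fin n) k) a b
    have h3 : ((g⁻¹ : GL (Fin n) k) : Matrix (Fin n) (Fin n) k).det * (g : Matrix (Fin n) (Fin n) k).det = 1 := by
      rw [← Matrix.det_mul, ← Units.val_mul, inv_mul_cancel, Units.val_one, Matrix.det_one]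
    have h4 : ((g⁻¹ : GL (Fin n) k) : Matrix (Fin n) (Fin n) k) =
        ((g⁻¹ : GL (Fin n) k) : Matrix (Fin n) (Fin n) k).det • (g : Matrix (Fin n) (Fin n) k).adjugate := by
      calc ((g⁻¹ : GL (Fin n) k) : Matrix (Fin n) (Fin n) k) =
          ((g⁻¹ : GL (Fin n) k) : Matrix (Fin n) (Fin n) k) * ((((g⁻¹ : GL (Fin n) k) : Matrix (Fin n) (Fin n) k).det) •
            ((g : Matrix (Fin n) (Fin n) k) * (g : Matrix (Fin n) (Fin n) k).adjugate)) := by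
              rw [Matrix.mul_adjugate, smul_smul, h3, one_smul, mul_one]
        _ = _ := by
          rw [Matrix.mul_smul, ← Matrix.mul_assoc, ← Units.val_mul, inv_mul_cancel, Units.val_one, Matrix.one_mul]
    conv_rhs => rw [h4]
    rfl
  · simp only [invp, Sum.elim_inr]
    have h1 := RingHom.map_det (eval (gpt g)) (Matrix.of fun a b => (MvPolynomial.X (Sum.inl (a, b)) : MvPolynomial ((Fin n × Fin n) ⊕ Unit) k))
    rw [RingHom.mapMatrix_apply, h0] at h1
    rw [h1]
    simp [gpt]

theorem exists_linRep : ∃ (N : ℕ), Nonempty (LinRep G Y ((Fin G.n ⊕ Fin N) ⊕ (Fin G.n ⊕ Fin N))) := by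
  obtain ⟨N, wp, Rp, lc, hw, hlc, hli⟩ := exists_rho Y
  refine ⟨N, ?_⟩
  let ρ : GL (Fin G.n) k → Matrix (Fin N) (Fin N) k := fun g => Rp.map (eval (gpt g))
  have huniq : ∀ A B : Matrix (Fin N) (Fin N) k,
      (∀ x ∈ Y.carrier, A.mulVec (fun j => eval x (wp j)) = B.mulVec (fun j => eval x (wp j))) → A = B := by
    intro A B h
    ext i j
    have := hli (fun j => A i j - B i j) (by
      intro x hx
      have h1 : ∑ j, A i j * eval x (wp j) = ∑ j, B i j * eval x (wp j) := congrFun (h x hx) i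
      simp only [sub_mul]
      rw [Finset.sum_sub_distrib, h1, sub_self])
    exact sub_eq_zero.1 (congrFun this j)
  have hρ1 : ρ 1 = 1 := by
    apply huniq
    intro x hx
    rw [Matrix.one_mulVec]
    have := hw 1 G.toSubgroup.one_mem x hx
    rw [Y.act_one x hx] at this
    exact this.symm
  have hρm : ∀ g ∈ G.toSubgroup, ∀ h ∈ G.toSubgroup, ρ (g * h) = ρ g * ρ h := by
    intro g hg h hh
    apply huniq
    intro x hx
    have h1 := hw (g * h) (G.toSubgroup.mul_mem hg hh) x hx
    have h2 := hw g hg _ (Y.act_mem h hh x hx)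
    have h3 := hw h hh x hx
    rw [Y.act_mul g hg h hh x hx] at h1
    rw [← Matrix.mulVec_mulVec]
    refine h1.symm.trans (h2.trans ?_)
    rw [h3]
  let τ : GL (Fin G.n) k → Matrix (Fin G.n ⊕ Fin N) (Fin G.n ⊕ Fin N) k := fun g =>
    Matrix.fromBlocks (g : Matrix (Fin G.n) (Fin G.n) k) 0 0 (ρ g)
  have hτ1 : τ 1 = 1 := by
    simp only [τ, hρ1, Units.val_one, Matrix.fromBlocks_one]
  have hτm : ∀ g ∈ G.toSubgroup, ∀ h ∈ G.toSubgroup, τ (g * h) = τ g * τ h := by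
    intro g hg h hh
    simp [τ, hρm g hg h hh, Matrix.fromBlocks_multiply]
  let τp : Matrix (Fin G.n ⊕ Fin N) (Fin G.n ⊕ Fin N) (MvPolynomial ((Fin G.n × Fin G.n) ⊕ Unit) k) :=
    Matrix.fromBlocks (Matrix.of fun a b => MvPolynomial.X (Sum.inl (a, b))) 0 0 Rp
  have hτp : ∀ g i j, eval (gpt g) (τp i j) = τ g i j := by
    intro g i j
    rcases i with i | i <;> rcases j with j | j <;> simp [τp, τ, ρ, gpt, mat2pt]
  have hτinv : ∀ g i j, eval (gpt g) (aeval (invp G.n) (τp i j)) = τ g⁻¹ i j := by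
    intro g i j
    rw [← hτp]
    exact alg_aeval (aeval (gpt g)) (invp G.n) (gpt g⁻¹) (fun s => invp_eval g s) (τp i j)
  exact ⟨{
    σ := fun g => Matrix.fromBlocks (τ g) 0 0 (τ g⁻¹).transpose
    map_one := by
      simp only [inv_one, hτ1, Matrix.transpose_one, Matrix.fromBlocks_one]
    map_mul := by
      intro g hg h hh
      have h1 : τ (g * h)⁻¹ = τ h⁻¹ * τ g⁻¹ := by
        rw [mul_inv_rev, hτm _ (G.toSubgroup.inv_mem hh) _ (G.toSubgroup.inv_mem hg)]
      simp only [h1, hτm g hg h hh, Matrix.fromBlocks_multiply, Matrix.transpose_mul, Matrix.mul_zero, Matrix.zero_mul,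
        add_zero, zero_add]
    det_one := by
      intro g hg
      rw [Matrix.det_fromBlocks_zero₂₁, Matrix.det_transpose, ← Matrix.det_mul,
        ← hτm g hg _ (G.toSubgroup.inv_mem hg), mul_inv_cancel, hτ1, Matrix.det_one]
    e1 := fun a => Sum.inl (Sum.inl a)
    e2 := fun a => Sum.inr (Sum.inl a)
    e1_inj := fun a b h => Sum.inl_injective (Sum.inl_injective h)
    he1 := fun g hg a b => rfl
    he1' := by
      intro g hg a q hq
      rcases q with (q | q) | q
      · exact absurd rfl (hq q)
      · rfl
      · rfl
    he2 := fun g hg a b => rfl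
    P := Matrix.fromBlocks τp 0 0 (τp.map (aeval (invp G.n))).transpose
    reg := by
      intro g hg i j
      rcases i with i | i <;> rcases j with j | j
      · exact (hτp g i j).symm
      · exact (_root_.map_zero (eval (gpt g))).symm
      · exact (_root_.map_zero (eval (gpt g))).symm
      · exact (hτinv g j i).symm
    wp := Sum.elim (Sum.elim 0 wp) 0
    hw := by
      intro g hg x hx
      have e : ∀ y : Fin m → k, (fun j => eval y ((Sum.elim (Sum.elim (0 : Fin G.n → MvPolynomial (Fin m) k) wp)
          (0 : Fin G.n ⊕ Fin N → MvPolynomial (Fin m) k)) j)) =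
          Sum.elim (Sum.elim (0 : Fin G.n → k) (fun j => eval y (wp j))) (0 : Fin G.n ⊕ Fin N → k) := by
        intro y
        funext j
        rcases j with (j | j) | j <;> simp
      rw [e, e, Matrix.fromBlocks_mulVec, hw g hg x hx]
      rw [Sum.elim_comp_inl, Sum.elim_comp_inr, Matrix.fromBlocks_mulVec, Sum.elim_comp_inl, Sum.elim_comp_inr]
      simp only [Matrix.mulVec_zero, Matrix.zero_mulVec, add_zero, zero_add]
      rfl
    lc := Matrix.of fun i => Sum.elim (Sum.elim 0 (lc i)) 0
    hlc := by
      intro x hx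
      funext i
      refine Eq.trans ?_ (congrFun (hlc x hx) i)
      change ∑ j, (Sum.elim (Sum.elim (0 : Fin G.n → k) (lc i)) (0 : Fin G.n ⊕ Fin N → k)) j *
        eval x ((Sum.elim (Sum.elim (0 : Fin G.n → MvPolynomial (Fin m) k) wp)
          (0 : Fin G.n ⊕ Fin N → MvPolynomial (Fin m) k)) j) = ∑ j, lc i j * eval x (wp j)
      rw [Fintype.sum_sum_type, Fintype.sum_sum_type]
      simp }⟩

end F25
end PaperGIT

namespace PaperGIT

/-- Theorem 1.2(1) / Theorem 4.15 of the paper. If the map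
`η : X → S(G)`, `x ↦ H_x`, is proper, then `x ∈ X` is polystable if and only
if `H_x` is completely reducible in `G`. -/
theorem polystable_iff_Hx_completelyReducible
    {k : Type} [Field k] [IsAlgClosed k] [CharZero k]
    (G : AlgGroup k) (hG : IsReductive G)
    {m : ℕ} (X : GVariety G m) (hEta : EtaProper X)
    (x : Fin m → k) (hx : x ∈ X.carrier) :
    Polystable X x ↔ CompletelyReducible G (Hx X x) := by
  obtain ⟨N, ⟨L⟩⟩ := exists_linRep X
  rw [L.polystable_iff hx, L.cr_iff hx]
  exact abstract_main L.isSL (L.noUnip hG) (L.properAt hEta hx)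

end PaperGIT
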